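/- Let q be a braiding matrix with connected Dynkin diagram such that B_q is finite dimensional, and let B be a pre-Nichols algebra of q with finite GKdim. Let i,j ∈ I_θ with c_{ij} < 0 and q̃_{ij}^{1−c_{ij}} ≠ 1. Assume that either the Dynkin diagram of k x_i ⊕ k x_j is different from the diagram with both vertices labeled q and edge labeled q^{−1} for q ∈ G_3', or c_{ij} = −1, q_{ii} = q_{jj} = q̃_{ij}^{−1} ∈ G_3' and there exists k ∈ I_θ \ {i,j} with q̃_{ik}² q̃_{jk} ≠ 1. Then (ad_c x_i)^{1−c_{ij}} x_j = 0 in B. -/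

import Mathlib

/-
Common framework for formalizing statements from
"Finite GK-dimensional pre-Nichols algebras of (super)modular and unidentified type"
(Angiono, Campagnolo, Sanmarco).

We work over `ℂ` (an algebraically closed field of characteristic zero).
A braiding matrix is `q : Fin θ → Fin θ → ℂˣ`.  The tensor algebra `T(V)` of the
associated braided vector space of diagonal type is realized as the free algebra
on `Fin θ`.  The braided bialgebra structure on `T(V)` (the braided coproduct,
uniquely determined by the braiding matrix) is packaged in the structure
`BraidedStr`: its fields characterize it uniquely, so quantifying over
`S : BraidedStr θ q` is equivalent to using "the" braided coproduct.

A pre-Nichols algebra of `q` is the quotient `T(V)/I` by an ℕ₀-homogeneous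
(two-sided) braided bi-ideal `I` generated in degrees ≥ 2 (`IsPreNicholsIdeal`);
such an ideal is automatically contained in the defining ideal `Jq` of the
Nichols algebra, which is the largest such ideal.  A statement
"`x = 0` holds in the pre-Nichols algebra `T(V)/I`" is formalized as `x ∈ I`.
-/

open scoped TensorProduct

noncomputable section

namespace PreNicholsPaper

/-- The tensor algebra `T(V)` of the braided vector space of diagonal type of rank `θ`. -/
abbrev TV (θ : ℕ) := FreeAlgebra ℂ (Fin θ)

/-- The generator `x_i` of `T(V)`. -/
def gen (θ : ℕ) (i : Fin θ) : TV θ := FreeAlgebra.ι ℂ i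

/-- The monomial `x_{i_1} ⋯ x_{i_n}` associated to a word. -/
def wordElem (θ : ℕ) (w : List (Fin θ)) : TV θ := (w.map (gen θ)).prod

/-- The multidegree in `ℕ₀^θ` of a word. -/
def degW (θ : ℕ) (w : List (Fin θ)) : Fin θ → ℕ := fun i => w.count i

/-- `α_i`, the `i`-th canonical basis vector of `ℕ₀^θ`. -/
def δ (θ : ℕ) (i : Fin θ) : Fin θ → ℕ := fun k => if k = i then 1 else 0

/-- The bilinear form `ℕ₀^θ × ℕ₀^θ → ℂˣ` attached to the braiding matrix,
`q(α_i, α_j) = q_{ij}`, evaluated in `ℂ`. -/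
def qf {θ : ℕ} (q : Fin θ → Fin θ → ℂˣ) (a b : Fin θ → ℕ) : ℂ :=
  ∏ i : Fin θ, ∏ j : Fin θ, (q i j : ℂ) ^ (a i * b j)

/-- `q̃_{ij} = q_{ij} q_{ji}`. -/
def qtil {θ : ℕ} (q : Fin θ → Fin θ → ℂˣ) (i j : Fin θ) : ℂ := (q i j : ℂ) * (q j i : ℂ)

/-- The braided commutator `[u,v]_c = uv - q(a,b) vu` of elements `u, v`
which are homogeneous of multidegrees `a`, `b` respectively. -/
def brk {θ : ℕ} (q : Fin θ → Fin θ → ℂˣ) (a b : Fin θ → ℕ) (u v : TV θ) : TV θ :=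
  u * v - qf q a b • (v * u)

/-- `(ad_c x_i) y = x_i y - q(α_i, b) y x_i` for `y` homogeneous of multidegree `b`. -/
def ad1 {θ : ℕ} (q : Fin θ → Fin θ → ℂˣ) (i : Fin θ) (b : Fin θ → ℕ) (y : TV θ) : TV θ :=
  brk q (δ θ i) b (gen θ i) y

/-- The iterated braided adjoint `x_{i_1 i_2 ⋯ i_k} = (ad_c x_{i_1}) x_{i_2 ⋯ i_k}`. -/
def xw {θ : ℕ} (q : Fin θ → Fin θ → ℂˣ) : List (Fin θ) → TV θ
  | [] => 1
  | [i] => gen θ i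
  | i :: w => ad1 q i (degW θ w) (xw q w)

/-- `(ad_c x_i)^m x_j`. -/
def adpow {θ : ℕ} (q : Fin θ → Fin θ → ℂˣ) (i j : Fin θ) : ℕ → TV θ
  | 0 => gen θ j
  | m + 1 => ad1 q i (fun k => m * δ θ i k + δ θ j k) (adpow q i j m)

/-- The homogeneous component of total degree `n` of `T(V)`. -/
def homogTot (θ : ℕ) (n : ℕ) : Submodule ℂ (TV θ) :=
  Submodule.span ℂ {x | ∃ w : List (Fin θ), w.length = n ∧ x = wordElem θ w}

/-- The homogeneous component of multidegree `d ∈ ℕ₀^θ` of `T(V)`. -/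
def homogD (θ : ℕ) (d : Fin θ → ℕ) : Submodule ℂ (TV θ) :=
  Submodule.span ℂ {x | ∃ w : List (Fin θ), degW θ w = d ∧ x = wordElem θ w}

/-- The braided bialgebra structure on `T(V)` determined by the braiding matrix `q`:
the braided coproduct `Δ` together with the multiplication `mulB` of the braided
tensor product `T(V) ⊗ T(V)`.  These axioms determine `Δ` and `mulB` uniquely. -/
structure BraidedStr (θ : ℕ) (q : Fin θ → Fin θ → ℂˣ) where
  Δ : TV θ →ₗ[ℂ] TensorProduct ℂ (TV θ) (TV θ)
  mulB : TensorProduct ℂ (TV θ) (TV θ) →ₗ[ℂ]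
    TensorProduct ℂ (TV θ) (TV θ) →ₗ[ℂ] TensorProduct ℂ (TV θ) (TV θ)
  mulB_spec : ∀ (a d : TV θ) (wb wc : List (Fin θ)),
    mulB (a ⊗ₜ[ℂ] wordElem θ wb) (wordElem θ wc ⊗ₜ[ℂ] d)
      = qf q (degW θ wb) (degW θ wc) • ((a * wordElem θ wc) ⊗ₜ[ℂ] (wordElem θ wb * d))
  Δ_one : Δ 1 = 1 ⊗ₜ[ℂ] 1
  Δ_gen : ∀ i, Δ (gen θ i) = gen θ i ⊗ₜ[ℂ] 1 + 1 ⊗ₜ[ℂ] gen θ i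
  Δ_mul : ∀ u v : TV θ, Δ (u * v) = mulB (Δ u) (Δ v)

variable {θ : ℕ} {q : Fin θ → Fin θ → ℂˣ}

/-- `x` is a primitive element. -/
def IsPrimitiveIn (S : BraidedStr θ q) (x : TV θ) : Prop :=
  S.Δ x = x ⊗ₜ[ℂ] (1 : TV θ) + (1 : TV θ) ⊗ₜ[ℂ] x

/-- The submodule `I ⊗ T(V) + T(V) ⊗ J` of `T(V) ⊗ T(V)`. -/
def mixedPair (I J : Submodule ℂ (TV θ)) : Submodule ℂ (TensorProduct ℂ (TV θ) (TV θ)) :=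
  Submodule.span ℂ
    ({x | ∃ a b : TV θ, a ∈ I ∧ x = a ⊗ₜ[ℂ] b} ∪ {x | ∃ a b : TV θ, b ∈ J ∧ x = a ⊗ₜ[ℂ] b})

/-- The submodule `I ⊗ T(V) + T(V) ⊗ I` of `T(V) ⊗ T(V)`. -/
def mixedSub (I : Submodule ℂ (TV θ)) : Submodule ℂ (TensorProduct ℂ (TV θ) (TV θ)) :=
  mixedPair I I

/-- `I` is the defining ideal of a pre-Nichols algebra of `q`：an ℕ₀-homogeneous
two-sided (bi-)ideal of `T(V)` generated in degrees `≥ 2` which is also a coideal.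
Such an ideal is automatically contained in the defining ideal `Jq` of the Nichols
algebra, and the pre-Nichols algebra is the quotient `T(V)/I`. -/
structure IsPreNicholsIdeal (S : BraidedStr θ q) (I : Submodule ℂ (TV θ)) : Prop where
  mul_left : ∀ a x : TV θ, x ∈ I → a * x ∈ I
  mul_right : ∀ a x : TV θ, x ∈ I → x * a ∈ I
  homog_ge2 : I = Submodule.span ℂ {x | x ∈ I ∧ ∃ n, 2 ≤ n ∧ x ∈ homogTot θ n}
  coideal : ∀ x ∈ I, S.Δ x ∈ mixedSub I

/-- The defining ideal `J_q` of the Nichols algebra `B_q = T(V)/J_q`: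
the maximal homogeneous braided Hopf ideal generated in degrees `≥ 2`. -/
def Jq (S : BraidedStr θ q) : Submodule ℂ (TV θ) := sSup {I | IsPreNicholsIdeal S I}

/-- The standard filtration of `T(V)`: span of words of length `≤ n`. -/
def Wfil (θ : ℕ) (n : ℕ) : Submodule ℂ (TV θ) :=
  Submodule.span ℂ {x | ∃ w : List (Fin θ), w.length ≤ n ∧ x = wordElem θ w}

/-- The quotient algebra `T(V)/I` has finite Gelfand–Kirillov dimension, i.e.
the standard filtration of the (finitely generated) quotient has polynomial growth. -/
def FinGK (I : Submodule ℂ (TV θ)) : Prop :=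
  ∃ C d : ℕ, ∀ n : ℕ, Module.finrank ℂ ((Wfil θ n).map I.mkQ) ≤ C * (n + 1) ^ d

/-- The Gelfand–Kirillov dimension of the quotient algebra `T(V)/I`. -/
def GKdim (I : Submodule ℂ (TV θ)) : ℝ :=
  Filter.limsup
    (fun n : ℕ => Real.log (Module.finrank ℂ ((Wfil θ n).map I.mkQ)) / Real.log n)
    Filter.atTop

/-- `I` defines an eminent pre-Nichols algebra: it is a finite-GKdim pre-Nichols
algebra, and every finite-GKdim pre-Nichols algebra of `q` is a quotient of it. -/
def IsEminent (S : BraidedStr θ q) (I : Submodule ℂ (TV θ)) : Prop :=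
  IsPreNicholsIdeal S I ∧ FinGK I ∧
    ∀ I' : Submodule ℂ (TV θ), IsPreNicholsIdeal S I' → FinGK I' → I ≤ I'

/-- The Dynkin diagram of the braiding matrix `q`: vertices `Fin θ`, an edge between
`i ≠ j` iff `q̃_{ij} ≠ 1`. -/
def dynkin {θ : ℕ} (q : Fin θ → Fin θ → ℂˣ) : SimpleGraph (Fin θ) :=
  SimpleGraph.fromRel (fun i j => qtil q i j ≠ 1)

/-- The quantum number `(m)_t = 1 + t + ⋯ + t^{m-1}`. -/
def qnum (t : ℂ) (m : ℕ) : ℂ := ∑ k ∈ Finset.range m, t ^ k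

/-- The set of `n ∈ ℕ₀` such that `(n+1)_{q_{ii}} (1 - q_{ii}^n q̃_{ij}) = 0`,
i.e. such that `(ad_c x_i)^{n+1} x_j = 0` in the Nichols algebra.  The entry
`c_{ij}` of the generalized Cartan matrix is `-(min of this set)`. -/
def cSet {θ : ℕ} (q : Fin θ → Fin θ → ℂˣ) (i j : Fin θ) : Set ℕ :=
  {n | qnum (q i i : ℂ) (n + 1) * (1 - (q i i : ℂ) ^ n * qtil q i j) = 0}

/-- The generalized Cartan matrix of `q`. -/
def cij {θ : ℕ} (q : Fin θ → Fin θ → ℂˣ) (i j : Fin θ) : ℤ :=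
  if i = j then 2 else -(Int.ofNat (sInf (cSet q i j)))

/-- All entries `c_{ij}` are defined at the vertex `i`. -/
def reflectable {θ : ℕ} (q : Fin θ → Fin θ → ℂˣ) (i : Fin θ) : Prop :=
  ∀ j, j ≠ i → (cSet q i j).Nonempty

/-- The `i`-th reflection of the braiding matrix:
`(r_i q)_{jk} = q(s_i α_j, s_i α_k)` where `s_i α_j = α_j - c_{ij} α_i`. -/
def reflectMat {θ : ℕ} (q : Fin θ → Fin θ → ℂˣ) (i : Fin θ) : Fin θ → Fin θ → ℂˣ :=
  fun j k =>
    q j k * q j i ^ (-(cij q i k)) * q i k ^ (-(cij q i j)) * q i i ^ (cij q i j * cij q i k)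

/-- The reflection `s_i` acting on `ℤ^θ`. -/
def sRefl {θ : ℕ} (q : Fin θ → Fin θ → ℂˣ) (i : Fin θ) (β : Fin θ → ℤ) : Fin θ → ℤ :=
  fun k => β k - (if k = i then ∑ j, cij q i j * β j else 0)

/-- The (real) roots of `q`, together with the base points of the Weyl groupoid at
which they live: pairs `(q', β)` obtained from a simple root of `q` by iterated
reflections. -/
inductive ReachRoot {θ : ℕ} (q₀ : Fin θ → Fin θ → ℂˣ) :
    (Fin θ → Fin θ → ℂˣ) → (Fin θ → ℤ) → Prop
  | simple (j : Fin θ) : ReachRoot q₀ q₀ (fun k => if k = j then 1 else 0)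
  | reflect {q' : Fin θ → Fin θ → ℂˣ} {β : Fin θ → ℤ} (i : Fin θ) :
      ReachRoot q₀ q' β → ReachRoot q₀ (reflectMat q' i) (sRefl q' i β)

/-- `q` has a finite (generalized) root system: all reflections are defined at every
point of the Weyl groupoid, and the set of roots so obtained is finite. -/
def FiniteRootSystem {θ : ℕ} (q : Fin θ → Fin θ → ℂˣ) : Prop :=
  (∀ q' i, (∃ β, ReachRoot q q' β) → reflectable q' i) ∧
    Set.Finite {β : Fin θ → ℤ | ∃ q', ReachRoot q q' β}

/-- Conjecture (Andruskiewitsch–Angiono–Heckenberger): the root system of a Nichols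
algebra of diagonal type with finite Gelfand–Kirillov dimension is finite. -/
def AAH : Prop :=
  ∀ (θ : ℕ) (q : Fin θ → Fin θ → ℂˣ) (S : BraidedStr θ q), FinGK (Jq S) → FiniteRootSystem q

/-- The two-sided ideal of `T(V)` generated by a set. -/
def idealGen (θ : ℕ) (s : Set (TV θ)) : Submodule ℂ (TV θ) :=
  Submodule.span ℂ {x | ∃ g ∈ s, ∃ a b : TV θ, x = a * g * b}

end PreNicholsPaper

namespace PreNicholsPaper

/-- All integer solutions of `f (k+2) = c k * f (k+1) - f k` are bounded. -/
def BoundedRec (c : ℕ → ℕ) : Prop :=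
  ∀ f : ℕ → ℤ, (∀ k, f (k + 2) = c k * f (k + 1) - f k) → ∃ M : ℤ, ∀ k, |f k| ≤ M

theorem BoundedRec.succ {c : ℕ → ℕ} (h : BoundedRec c) : BoundedRec fun k => c (k + 1) := by
  intro f hf
  obtain ⟨M, hM⟩ := h (fun k => Nat.casesOn k (c 0 * f 0 - f 1) f) (by
    intro k
    cases k with
    | zero => simp
    | succ k => simpa using hf k)
  exact ⟨M, fun k => hM (k + 1)⟩

theorem BoundedRec.shift {c : ℕ → ℕ} (h : BoundedRec c) (s : ℕ) :
    BoundedRec fun k => c (s + k) := by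
  induction s with
  | zero => simpa using h
  | succ s ih =>
    have := ih.succ
    simpa [Nat.add_assoc, Nat.add_comm 1] using this

/-- A solution of the linear recursion with prescribed initial values. -/
def recSol (c : ℕ → ℕ) (x y : ℤ) : ℕ → ℤ × ℤ
  | 0 => (x, y)
  | k + 1 => ((recSol c x y k).2, c k * (recSol c x y k).2 - (recSol c x y k).1)

theorem exists_rec_solution (c : ℕ → ℕ) (x y : ℤ) :
    ∃ f : ℕ → ℤ, f 0 = x ∧ f 1 = y ∧ ∀ k, f (k + 2) = c k * f (k + 1) - f k :=
  ⟨fun k => (recSol c x y k).1, rfl, rfl, fun _ => rfl⟩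

/-- The lower bounds around short patterns of a sequence that force the associated recursion
to grow. -/
structure GrowthPattern (c : ℕ → ℕ) : Prop where
  pos : ∀ k, 1 ≤ c k
  one_one : ∀ k, c k = 1 → c (k + 1) ≠ 1
  one_two_right : ∀ k, c k = 1 → c (k + 1) = 2 → 4 ≤ c (k + 2)
  one_two_left : ∀ k, c (k + 1) = 1 → c (k + 2) = 2 → 6 ≤ c k
  two_one_right : ∀ k, c k = 2 → c (k + 1) = 1 → 6 ≤ c (k + 2)
  two_one_left : ∀ k, c (k + 1) = 2 → c (k + 2) = 1 → 4 ≤ c k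
  one_three_right : ∀ k, c k = 1 → c (k + 1) = 3 → c (k + 2) = 1 → 6 ≤ c (k + 3)
  one_three_left : ∀ k, c (k + 1) = 1 → c (k + 2) = 3 → c (k + 3) = 1 → 6 ≤ c k

/-- The amount by which the pattern that follows position `k` lowers the coefficient `c k` once
that pattern is eliminated from the recursion. -/
def rightDefect (c : ℕ → ℕ) (k : ℕ) : ℕ :=
  if c (k + 1) = 1 then
    if c (k + 2) = 2 then 2 else if c (k + 2) = 3 ∧ c (k + 3) = 1 then 2 else 1
  else if c (k + 1) = 2 ∧ c (k + 2) = 1 then 1 else 0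

theorem GrowthPattern.step {c : ℕ → ℕ} (h : GrowthPattern c) {f : ℕ → ℤ}
    (hf : ∀ k, f (k + 2) = c k * f (k + 1) - f k) {k r : ℕ}
    (hc : 2 + r + rightDefect c k ≤ c k) (hpos : 0 < f (k + 1))
    (hup : f k < (r + 1) * f (k + 1)) :
    ∃ k' r' : ℕ, 2 + r' + rightDefect c k' ≤ c k' ∧ f (k + 1) < f (k' + 1) ∧
      f k' < (r' + 1) * f (k' + 1) := by
  have e0 := hf k
  have e1 := hf (k + 1)
  have e2 := hf (k + 2)
  have e3 := hf (k + 3)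
  have p1 := h.pos (k + 1)
  have p2 := h.pos (k + 2)
  have p3 := h.pos (k + 3)
  have p4 := h.pos (k + 4)
  have key : ∀ s : ℕ, 2 + r + s ≤ c k → f (k + 1) < f (k + 2) - s * f (k + 1) := by
    intro s hs
    have : ((2 + r + s : ℕ) : ℤ) * f (k + 1) ≤ c k * f (k + 1) := by gcongr
    push_cast at this
    nlinarith
  have a1 := h.one_one (k + 1)
  have a2 := h.one_one (k + 2)
  have a3 := h.one_one (k + 3)
  have b1 := h.one_two_left (k + 1)
  have b2 := h.one_two_left (k + 2)
  have b3 := h.one_two_left (k + 3)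
  have b1' := h.one_two_right (k + 1)
  have g1 := h.two_one_left (k + 1)
  have g2 := h.two_one_left (k + 2)
  have g3 := h.two_one_left (k + 3)
  have g1' := h.two_one_right (k + 1)
  have d1 := h.one_three_left (k + 1)
  have d2 := h.one_three_left (k + 2)
  have d3 := h.one_three_left (k + 3)
  have d1' := h.one_three_right (k + 1)
  simp only [Nat.add_assoc, Nat.reduceAdd] at *
  unfold rightDefect at hc ⊢
  by_cases h1 : c (k + 1) = 1
  · rw [if_pos h1] at hc
    rw [h1] at e1
    by_cases h2 : c (k + 2) = 2
    · rw [if_pos h2] at hc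
      rw [h2] at e2
      have := key 2 hc
      refine ⟨k + 3, 1, ?_, ?_⟩
      · simp only [Nat.add_assoc, Nat.reduceAdd]
        grind
      · simp only [Nat.add_assoc, Nat.reduceAdd]; push_cast at *
        constructor <;> linarith
    · rw [if_neg h2] at hc
      by_cases h3 : c (k + 2) = 3 ∧ c (k + 3) = 1
      · rw [if_pos h3] at hc
        rw [h3.1] at e2
        rw [h3.2] at e3
        have := key 2 hc
        refine ⟨k + 4, 2, ?_, ?_⟩
        · simp only [Nat.add_assoc, Nat.reduceAdd]
          have := d1' h1 h3.1 h3.2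
          grind
        · simp only [Nat.add_assoc, Nat.reduceAdd]; push_cast at *
          constructor <;> linarith
      · rw [if_neg h3] at hc
        have := key 1 hc
        refine ⟨k + 2, 1, ?_, ?_⟩
        · simp only [Nat.add_assoc, Nat.reduceAdd]
          grind
        · simp only [Nat.add_assoc, Nat.reduceAdd]; push_cast at *
          constructor <;> linarith
  · rw [if_neg h1] at hc
    by_cases h2 : c (k + 1) = 2 ∧ c (k + 2) = 1
    · rw [if_pos h2] at hc
      rw [h2.1] at e1
      rw [h2.2] at e2
      have := key 1 hc
      refine ⟨k + 3, 2, ?_, ?_⟩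
      · simp only [Nat.add_assoc, Nat.reduceAdd]
        have := g1' h2.1 h2.2
        grind
      · simp only [Nat.add_assoc, Nat.reduceAdd]; push_cast at *
        constructor <;> linarith
    · rw [if_neg h2] at hc
      have := key 0 hc
      refine ⟨k + 1, 0, ?_, ?_⟩
      · simp only [Nat.add_assoc, Nat.reduceAdd]
        grind
      · simp only [Nat.add_assoc, Nat.reduceAdd]; push_cast at *
        constructor <;> linarith

theorem GrowthPattern.exists_start {c : ℕ → ℕ} (h : GrowthPattern c) :
    ∃ s, 2 + rightDefect c s ≤ c s := by
  have p0 := h.pos 0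
  have p1 := h.pos 1
  have p2 := h.pos 2
  have a0 := h.one_one 0
  have a1 := h.one_one 1
  have b0 := h.one_two_left 0
  have b1 := h.one_two_left 1
  have b2 := h.one_two_left 2
  have b3 := h.one_two_left 3
  have b0' := h.one_two_right 0
  have g0 := h.two_one_left 0
  have g1 := h.two_one_left 1
  have g2 := h.two_one_left 2
  have g3 := h.two_one_left 3
  have g0' := h.two_one_right 0
  have d0 := h.one_three_left 0
  have d1 := h.one_three_left 1
  have d2 := h.one_three_left 2
  have d3 := h.one_three_left 3
  have d0' := h.one_three_right 0
  by_contra! hs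
  have s0 := hs 0
  have s1 := hs 1
  have s2 := hs 2
  have s3 := hs 3
  clear hs
  unfold rightDefect at *
  simp only [Nat.reduceAdd, zero_add] at *
  grind

theorem GrowthPattern.not_boundedRec {c : ℕ → ℕ} (h : GrowthPattern c) : ¬ BoundedRec c := by
  intro hb
  obtain ⟨s, hs⟩ := h.exists_start
  obtain ⟨g, hg0, hg1, hg⟩ := exists_rec_solution (fun k => c (s + k)) 0 1
  have hc' : ∀ k, rightDefect (fun k => c (s + k)) k = rightDefect c (s + k) := fun k => rfl
  have h' : GrowthPattern fun k => c (s + k) :=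
    ⟨fun k => h.pos _, fun k => h.one_one _, fun k => h.one_two_right _,
      fun k => h.one_two_left _, fun k => h.two_one_right _, fun k => h.two_one_left _,
      fun k => h.one_three_right _, fun k => h.one_three_left _⟩
  obtain ⟨M, hM⟩ := hb.shift s g hg
  have grow : ∀ n : ℕ, ∃ k r : ℕ, 2 + r + rightDefect (fun k => c (s + k)) k ≤ c (s + k) ∧
      (n : ℤ) < g (k + 1) ∧ g k < (r + 1) * g (k + 1) := by
    intro n
    induction n with
    | zero => exact ⟨0, 0, by simpa [hc'] using hs, by simp [hg1],
        by simp [hg0, hg1]⟩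
    | succ n ih =>
      obtain ⟨k, r, h1, h2, h3⟩ := ih
      obtain ⟨k', r', h1', h2', h3'⟩ := h'.step hg h1 (by omega) h3
      exact ⟨k', r', h1', by push_cast; omega, h3'⟩
  obtain ⟨k, r, -, hk, -⟩ := grow M.toNat
  have := (abs_le.1 (hM (k + 1))).2
  have := Int.self_le_toNat M
  omega

theorem qnum_succ_eq_zero_iff {t : ℂ} {n : ℕ} :
    qnum t (n + 1) = 0 ↔ t ≠ 1 ∧ t ^ (n + 1) = 1 := by
  unfold qnum
  rcases eq_or_ne t 1 with rfl | ht
  · simp only [one_pow, Finset.sum_const, Finset.card_range, nsmul_eq_mul, mul_one, ne_eq,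
      not_true_eq_false, and_true, iff_false]
    exact_mod_cast Nat.succ_ne_zero n
  · have h := geom_sum_eq ht (n + 1)
    rw [h, div_eq_zero_iff, sub_eq_zero, sub_eq_zero]
    simp [ht]

/-- The set of `n` with `(n+1)_u (1 - u^n e) = 0`. -/
def cartanSet (u e : ℂ) : Set ℕ := {n | qnum u (n + 1) * (1 - u ^ n * e) = 0}

/-- The minimum of `cartanSet u e`. -/
def cartanNum (u e : ℂ) : ℕ := sInf (cartanSet u e)

theorem mem_cartanSet {u e : ℂ} {n : ℕ} :
    n ∈ cartanSet u e ↔ (u ≠ 1 ∧ u ^ (n + 1) = 1) ∨ u ^ n * e = 1 := by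
  simp only [cartanSet, Set.mem_ofPred_eq, mul_eq_zero, qnum_succ_eq_zero_iff, sub_eq_zero]
  rw [eq_comm (a := (1 : ℂ))]

theorem cartanNum_mem {u e : ℂ} (h : (cartanSet u e).Nonempty) :
    cartanNum u e ∈ cartanSet u e := Nat.sInf_mem h

theorem cartanNum_le {u e : ℂ} {n : ℕ} (h : n ∈ cartanSet u e) : cartanNum u e ≤ n :=
  Nat.sInf_le h

theorem cartanNum_eq {u e : ℂ} {n : ℕ} (h : n ∈ cartanSet u e)
    (h' : ∀ m < n, m ∉ cartanSet u e) : cartanNum u e = n :=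
  le_antisymm (cartanNum_le h) (not_lt.1 fun hlt => h' _ hlt (cartanNum_mem ⟨n, h⟩))

theorem cartanNum_pos {u e : ℂ} (h : (cartanSet u e).Nonempty) (he : e ≠ 1) :
    1 ≤ cartanNum u e := by
  by_contra! h0
  have := cartanNum_mem h
  rw [Nat.lt_one_iff.1 h0, mem_cartanSet] at this
  simp only [zero_add, pow_one, pow_zero, one_mul] at this
  tauto

/-- Reflecting an edge does not change its Cartan number. -/
theorem cartanNum_reflect {u e : ℂ} (hu : u ≠ 0) (he : e ≠ 0) (h : (cartanSet u e).Nonempty) :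
    cartanNum u e ∈ cartanSet u (e * u ^ (2 * cartanNum u e))⁻¹ ∧
      cartanNum u (e * u ^ (2 * cartanNum u e))⁻¹ = cartanNum u e := by
  set c := cartanNum u e with hc
  have hmem := cartanNum_mem h
  rw [← hc] at hmem
  have hmin : ∀ m < c, m ∉ cartanSet u e := fun m hm hm' => absurd (cartanNum_le hm') (by omega)
  suffices hm : c ∈ cartanSet u (e * u ^ (2 * c))⁻¹ ∧
      ∀ m < c, m ∉ cartanSet u (e * u ^ (2 * c))⁻¹ from ⟨hm.1, cartanNum_eq hm.1 hm.2⟩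
  by_cases h1 : u ^ c * e = 1
  · have : (e * u ^ (2 * c))⁻¹ = e := by
      refine inv_eq_of_mul_eq_one_right ?_
      calc e * u ^ (2 * c) * e = (u ^ c * e) * (u ^ c * e) := by ring
        _ = 1 := by rw [h1, one_mul]
    rw [this]
    exact ⟨hmem, hmin⟩
  · have h2 := (mem_cartanSet.1 hmem).resolve_right h1
    refine ⟨mem_cartanSet.2 (.inl h2), fun m hm hm' => ?_⟩
    rcases mem_cartanSet.1 hm' with h3 | h3
    · exact hmin m hm (mem_cartanSet.2 (.inl h3))
    · refine hmin (c - 1 - m) (by omega) (mem_cartanSet.2 (.inr ?_))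
      rw [← div_eq_mul_inv, div_eq_one_iff_eq (by positivity)] at h3
      have h4 : u ^ (m + 2) = e := by
        calc u ^ (m + 2) = e * (u ^ (c + 1)) ^ 2 := by rw [pow_add, h3]; ring
          _ = e := by rw [h2.2]; ring
      rw [← h4, ← pow_add, show c - 1 - m + (m + 2) = c + 1 by omega, h2.2]

/-- The Dynkin diagram of rank two with vertices labelled `u`, `v` and edge labelled `e`; the
vertex labelled `u` is the next one to be reflected. -/
@[ext]
structure Diag2 where
  u : ℂ
  e : ℂ
  v : ℂ

namespace Diag2

/-- The Cartan number at the first vertex. -/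
def c (D : Diag2) : ℕ := cartanNum D.u D.e

/-- The diagram with the vertices exchanged. -/
def sw (D : Diag2) : Diag2 := ⟨D.v, D.e, D.u⟩

/-- Reflection at the first vertex, followed by an exchange of the vertices. -/
def step (D : Diag2) : Diag2 :=
  ⟨D.v * D.e ^ D.c * D.u ^ (D.c * D.c), (D.e * D.u ^ (2 * D.c))⁻¹, D.u⟩

/-- All entries are nonzero. -/
structure Ne0 (D : Diag2) : Prop where
  u : D.u ≠ 0
  e : D.e ≠ 0
  v : D.v ≠ 0

/-- The first vertex can be reflected. -/
def Refl (D : Diag2) : Prop := (cartanSet D.u D.e).Nonempty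

variable {D : Diag2}

@[simp] theorem sw_sw : D.sw.sw = D := rfl
@[simp] theorem sw_u : D.sw.u = D.v := rfl
@[simp] theorem sw_e : D.sw.e = D.e := rfl
@[simp] theorem sw_v : D.sw.v = D.u := rfl

theorem Ne0.sw (h : D.Ne0) : D.sw.Ne0 := ⟨h.v, h.e, h.u⟩

theorem Ne0.step (h : D.Ne0) : D.step.Ne0 := by
  obtain ⟨hu, he, hv⟩ := h
  exact ⟨by simp [Diag2.step, *], by simp [Diag2.step, *], hu⟩

theorem refl_sw_step (h : D.Ne0) (hr : D.Refl) : D.step.sw.Refl :=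
  ⟨_, (cartanNum_reflect h.u h.e hr).1⟩

theorem c_sw_step (h : D.Ne0) (hr : D.Refl) : D.step.sw.c = D.c :=
  (cartanNum_reflect h.u h.e hr).2

theorem step_sw_step (h : D.Ne0) (hr : D.Refl) : D.step.sw.step = D.sw := by
  have hc := c_sw_step h hr
  obtain ⟨hu, he, hv⟩ := h
  ext
  · rw [step, hc]
    simp only [sw, step]
    rw [inv_pow, mul_pow, ← pow_mul]
    field_simp
    ring
  · rw [step, hc]
    simp only [sw, step]
    field_simp
  · rfl

theorem step_e_ne_one (h : D.Ne0) (hr : D.Refl) (he : D.e ≠ 1) : D.step.e ≠ 1 := by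
  intro h1
  have hc := c_sw_step h hr
  have : D.step.sw.c = 0 := Nat.le_zero.1 (cartanNum_le (mem_cartanSet.2 (.inr (by simpa using h1))))
  have := cartanNum_pos hr he
  have : D.c = cartanNum D.u D.e := rfl
  omega

/-- The rank two Weyl groupoid of `D` is finite: all reflections are defined and the real roots
are bounded. -/
structure Fin2 (D : Diag2) : Prop where
  ne0 : D.Ne0
  refl : ∀ k, (step^[k] D).Refl
  bdd : BoundedRec fun k => (step^[k] D).c

/-- The diagrams around which the growth pattern fails. -/
def Exceptional (D : Diag2) : Prop :=
  (D.sw.c = 1 ∧ D.c = 1) ∨ (D.sw.c = 1 ∧ D.c = 2 ∧ (D.step.c ≤ 3 ∨ D.sw.step.c ≤ 5)) ∨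
    (D.sw.c = 1 ∧ D.c = 3 ∧ D.step.c = 1 ∧ D.sw.step.c ≤ 5)

theorem Ne0.iterate (h : D.Ne0) (k : ℕ) : (Diag2.step^[k] D).Ne0 := by
  induction k with
  | zero => exact h
  | succ k ih => rw [Function.iterate_succ_apply']; exact ih.step

theorem iterate_e_ne_one (h : D.Ne0) (hr : ∀ k, (step^[k] D).Refl) (he : D.e ≠ 1) (k : ℕ) :
    (step^[k] D).e ≠ 1 := by
  induction k with
  | zero => exact he
  | succ k ih => rw [Function.iterate_succ_apply']; exact step_e_ne_one (h.iterate k) (hr k) ih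

theorem iterate_sw_iterate (h : D.Ne0) (hr : ∀ k, (step^[k] D).Refl) (k : ℕ) :
    step^[k] (step^[k] D).sw = D.sw := by
  induction k with
  | zero => rfl
  | succ k ih =>
    rw [Function.iterate_succ_apply, Function.iterate_succ_apply' (x := D),
      step_sw_step (h.iterate k) (hr k), ih]

theorem Fin2.exists_exceptional (h : D.Fin2) (he : D.e ≠ 1) :
    ∃ k, (step^[k + 1] D).Exceptional ∨ (step^[k + 1] D).sw.Exceptional := by
  by_contra! hno
  refine GrowthPattern.not_boundedRec (c := fun k => (step^[k] D).c) ?_ h.bdd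
  have hS : ∀ k, (step^[k + 1] D).sw.c = (step^[k] D).c := fun k => by
    rw [Function.iterate_succ_apply']; exact c_sw_step (h.ne0.iterate k) (h.refl k)
  have hR : ∀ k, (step^[k] D).step.c = (step^[k + 1] D).c := fun k => by
    rw [Function.iterate_succ_apply']
  have hL : ∀ k, (step^[k + 2] D).sw.step.c = (step^[k] D).c := fun k => by
    rw [Function.iterate_succ_apply', step_sw_step (h.ne0.iterate _) (h.refl _), hS]
  have e1 : ∀ k, ¬ (step^[k + 1] D).Exceptional := fun k => (hno k).1
  have e2 : ∀ k, ¬ (step^[k + 1] D).sw.Exceptional := fun k => (hno k).2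
  simp only [Exceptional, sw_sw, hS, hR] at e1 e2
  have hpos : ∀ k, 1 ≤ (step^[k] D).c := fun k =>
    cartanNum_pos (h.refl k) (iterate_e_ne_one h.ne0 h.refl he k)
  refine ⟨hpos, ?_, ?_, ?_, ?_, ?_, ?_, ?_⟩ <;> intro k
  · have := e1 k; grind
  · have := e1 k; grind
  · have := e1 (k + 1); rw [hL] at this; grind
  · have := e2 k; grind
  · have := e2 (k + 1); rw [hL] at this; grind
  · have := e2 (k + 1); rw [hL] at this; grind
  · have := e1 (k + 1); rw [hL] at this; grind

end Diag2

namespace Diag2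

variable {D : Diag2}

/-- The oriented form of `Fam`. -/
def Fam0 (D : Diag2) : Prop :=
  (D.v = -1 ∨ D.v * D.e = 1) ∧
    (D.u = -1 ∨ D.u * D.e = 1 ∨ D.u ^ 2 * D.e = 1 ∨
      (D.v * D.e = 1 ∧ (D.u ^ 3 * D.e = 1 ∨ D.u ^ 2 + D.u + 1 = 0)))

/-- The connected rank two diagrams of Cartan type, of super type, and the one-parameter family
of standard type `B₂` at a third root of unity. -/
def Fam (D : Diag2) : Prop := D.e ≠ 1 ∧ (D.Fam0 ∨ D.sw.Fam0)

theorem Fam.sw (h : D.Fam) : D.sw.Fam := ⟨h.1, h.2.symm⟩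

theorem step_eq_sw (h : D.Ne0) (hc : D.u ^ D.c * D.e = 1) : D.step = D.sw := by
  obtain ⟨hu, he, hv⟩ := h
  ext
  · calc D.v * D.e ^ D.c * D.u ^ (D.c * D.c) = D.v * (D.u ^ D.c * D.e) ^ D.c := by
          rw [mul_pow, ← pow_mul]; ring
      _ = D.v := by rw [hc]; ring
  · refine inv_eq_of_mul_eq_one_left ?_
    calc D.e * (D.e * D.u ^ (2 * D.c)) = (D.u ^ D.c * D.e) ^ 2 := by ring
      _ = 1 := by rw [hc]; ring
  · rfl

theorem c_eq_one (he : D.e ≠ 1) (h : D.u = -1) : D.c = 1 := by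
  have h1 : 1 ∈ cartanSet D.u D.e := mem_cartanSet.2 (.inl ⟨by rw [h]; norm_num, by rw [h]; ring⟩)
  exact le_antisymm (cartanNum_le h1) (cartanNum_pos ⟨_, h1⟩ he)

theorem step_of_neg_one (he : D.e ≠ 1) (h : D.u = -1) :
    D.step = ⟨-(D.v * D.e), D.e⁻¹, -1⟩ := by
  simp [step, c_eq_one he h, h]

theorem refl_and_c_le {n : ℕ} (h : (D.u ≠ 1 ∧ D.u ^ (n + 1) = 1) ∨ D.u ^ n * D.e = 1) :
    D.Refl ∧ D.c ≤ n :=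
  ⟨⟨n, mem_cartanSet.2 h⟩, cartanNum_le (mem_cartanSet.2 h)⟩

theorem c_spec (h : D.Refl) : (D.u ≠ 1 ∧ D.u ^ (D.c + 1) = 1) ∨ D.u ^ D.c * D.e = 1 :=
  mem_cartanSet.1 (cartanNum_mem h)

theorem ne_one_of_cyclotomic_three {z : ℂ} (h : z ^ 2 + z + 1 = 0) : z ≠ 1 := by
  rintro rfl; norm_num at h

theorem pow_three_of_cyclotomic_three {z : ℂ} (h : z ^ 2 + z + 1 = 0) : z ^ 3 = 1 := by
  linear_combination (z - 1) * h

theorem eq_neg_one_of_sq {z : ℂ} (h : z ^ 2 = 1) (h1 : z ≠ 1) : z = -1 :=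
  (sq_eq_one_iff.1 h).resolve_left h1

theorem Fam.step (h : D.Fam) (h0 : D.Ne0) : D.step.Fam := by
  have he := h.1
  have hrefl : D.Refl ∧ D.c ≤ 3 := by
    rcases h.2 with ⟨h1, h2⟩ | ⟨h1, h2⟩ <;> (try simp only [sw_u, sw_e, sw_v] at h1 h2)
    · rcases h2 with h2 | h2 | h2 | ⟨-, h2 | h2⟩
      · exact (refl_and_c_le (n := 1) (.inl ⟨by rw [h2]; norm_num, by rw [h2]; ring⟩)).imp id
          (by omega)
      · exact (refl_and_c_le (n := 1) (.inr (by simpa using h2))).imp id (by omega)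
      · exact (refl_and_c_le (n := 2) (.inr h2)).imp id (by omega)
      · exact refl_and_c_le (n := 3) (.inr h2)
      · exact (refl_and_c_le (n := 2) (.inl ⟨ne_one_of_cyclotomic_three h2,
          pow_three_of_cyclotomic_three h2⟩)).imp id (by omega)
    · rcases h1 with h1 | h1
      · exact (refl_and_c_le (n := 1) (.inl ⟨by rw [h1]; norm_num, by rw [h1]; ring⟩)).imp id
          (by omega)
      · exact (refl_and_c_le (n := 1) (.inr (by simpa using h1))).imp id (by omega)
  have he' := step_e_ne_one h0 hrefl.1 he
  by_cases hcar : D.u ^ D.c * D.e = 1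
  · rw [step_eq_sw h0 hcar]; exact h.sw
  have hroot := (c_spec hrefl.1).resolve_right hcar
  have hpos : 1 ≤ D.c := cartanNum_pos hrefl.1 he
  refine ⟨he', ?_⟩
  by_cases hu : D.u = -1
  · rw [step_of_neg_one he hu]
    left
    refine ⟨.inl rfl, ?_⟩
    have e0 := h0.e
    rcases h.2 with ⟨h1, h2⟩ | ⟨h1, h2⟩ <;> (try simp only [sw_u, sw_e, sw_v] at h1 h2 ⊢)
    · rcases h1 with h1 | h1
      · right; left; rw [h1]; field_simp
      · left; rw [h1]
    · rcases h2 with h2 | h2 | h2 | ⟨h2, -⟩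
      · right; left; rw [h2]; field_simp
      · left; rw [h2]
      · right; right; left
        field_simp
        linear_combination h2
      · exfalso
        apply hcar
        rw [c_eq_one he hu, pow_one, h2]
  · have hc : D.c ≠ 1 := by
      intro hc
      rw [hc] at hroot
      exact hu (eq_neg_one_of_sq hroot.2 hroot.1)
    rcases h.2 with ⟨h1, h2⟩ | ⟨h1, h2⟩ <;> (try simp only [sw_u, sw_e, sw_v] at h1 h2)
    · have two : D.u ^ 2 * D.e ≠ 1 := by
        intro h2
        have := (refl_and_c_le (D := D) (.inr h2)).2
        have hc2 : D.c = 2 := by omega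
        rw [hc2] at hcar
        exact hcar h2
      have one : D.u * D.e ≠ 1 := by
        intro h2
        have := (refl_and_c_le (D := D) (n := 1) (.inr (by simpa using h2))).2
        omega
      obtain ⟨h3, h2⟩ := ((h2.resolve_left hu).resolve_left one).resolve_left two
      rcases h2 with h2 | h2
      · exfalso
        have := hrefl.2
        have hc2 : D.c = 2 ∨ D.c = 3 := by omega
        rcases hc2 with hc2 | hc2 <;> rw [hc2] at hroot hcar
        · rw [hroot.2, one_mul] at h2
          exact he h2
        · exact hcar h2
      · have h4 := pow_three_of_cyclotomic_three h2
        have := (refl_and_c_le (D := D) (.inl ⟨ne_one_of_cyclotomic_three h2, h4⟩)).2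
        have hc2 : D.c = 2 := by omega
        right
        have hu0 := h0.u
        have he0 := h0.e
        have hv : D.v * D.e ^ 2 * D.u ^ 4 = D.e * D.u := by
          linear_combination D.e * D.u * h4 + D.e * D.u ^ 4 * h3
        have hE : D.e * D.u ^ 4 = D.e * D.u := by linear_combination D.e * D.u * h4
        have hs : D.step.sw = ⟨D.u, (D.e * D.u)⁻¹, D.e * D.u⟩ := by
          simp only [Diag2.step, Diag2.sw, hc2, Nat.reduceMul, hv, hE]
        rw [hs]
        refine ⟨.inr ?_, .inr (.inr (.inr ⟨?_, .inr h2⟩))⟩ <;> simp only <;> field_simp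
    · exfalso
      rcases h1.resolve_left hu with h1
      have := (refl_and_c_le (D := D) (n := 1) (.inr (by simpa using h1))).2
      omega

theorem Fam.iterate (h : D.Fam) (h0 : D.Ne0) (k : ℕ) : (Diag2.step^[k] D).Fam := by
  induction k with
  | zero => exact h
  | succ k ih => rw [Function.iterate_succ_apply']; exact ih.step (h0.iterate k)

theorem fam_of_iterate (h0 : D.Ne0) (hr : ∀ k, (Diag2.step^[k] D).Refl) (k : ℕ)
    (h : (Diag2.step^[k] D).Fam) : D.Fam := by
  have := h.sw.iterate (h0.iterate k).sw k
  rw [iterate_sw_iterate h0 hr] at this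
  exact this.sw

end Diag2

namespace Diag2

variable {D : Diag2}

/-- The diagram whose labels are the powers of `ω` with the given exponents. -/
def ofExp (ω : ℂ) (t : ℕ × ℕ × ℕ) : Diag2 := ⟨ω ^ t.1, ω ^ t.2.1, ω ^ t.2.2⟩

/-- The list of the divisors of a natural number. -/
def divisorList (L : ℕ) : List ℕ := (List.range (L + 1)).filter fun k => L % k == 0

/-- Orders of a root of unity together with exponents of the labels of a diagram. -/
def sporadicList : List (ℕ × ℕ × ℕ × ℕ) :=
  ([30, 24, 18].flatMap fun L =>
    (divisorList L).flatMap fun e => [(L, L / 3, e, L / 2), (L, 2 * (L / 3), e, L / 2)]) ++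
  (([24, 20, 14].flatMap fun L =>
    (divisorList L).map fun t => (L, t, (3 * L - 3 * t) % L, L / 2)) ++
  ((divisorList 24).flatMap fun e =>
    [6, 18].flatMap fun i => [(24, i, e, 12), (24, i, e, (24 - e) % 24)]))

/-- The diagrams with labels in a finite list of roots of unity given by `sporadicList`. -/
def Sporadic (D : Diag2) : Prop :=
  ∃ (L : ℕ) (ω : ℂ) (t : ℕ × ℕ × ℕ), IsPrimitiveRoot ω L ∧ (L, t) ∈ sporadicList ∧ D = ofExp ω t

theorem primitiveRoot_half {ω : ℂ} {L : ℕ} (hω : IsPrimitiveRoot ω (2 * L)) (hL : 0 < L) :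
    ω ^ L = -1 := by
  refine eq_neg_one_of_sq ?_ fun h => ?_
  · rw [← pow_mul, mul_comm, hω.pow_eq_one]
  · have := Nat.le_of_dvd hL ((hω.pow_eq_one_iff_dvd L).1 h)
    omega

theorem exists_exp {ω x : ℂ} {L : ℕ} (hω : IsPrimitiveRoot ω L) (hL : 0 < L) (hx : x ^ L = 1) :
    ∃ k < L, x = ω ^ k := by
  have : NeZero L := ⟨hL.ne'⟩
  obtain ⟨k, hk, h⟩ := hω.eq_pow_of_pow_eq_one hx
  exact ⟨k, hk, h.symm⟩

theorem mem_divisorList {L k : ℕ} (hL : 0 < L) : k ∈ divisorList L ↔ k ∣ L := by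
  simp only [divisorList, List.mem_filter, List.mem_range, beq_iff_eq, Nat.dvd_iff_mod_eq_zero]
  refine ⟨fun h => h.2, fun h => ⟨Nat.lt_succ_of_le (Nat.le_of_dvd hL ?_), h⟩⟩
  exact Nat.dvd_of_mod_eq_zero h

/-- A root of unity is a power of a suitable primitive root, with exponent a divisor of the order. -/
theorem exists_primitiveRoot_pow {x : ℂ} {L : ℕ} (hL : 0 < L) (hx : x ^ L = 1) :
    ∃ (ω : ℂ) (k : ℕ), IsPrimitiveRoot ω L ∧ k ∣ L ∧ x = ω ^ k := by
  have : NeZero L := ⟨hL.ne'⟩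
  obtain ⟨ω, hω⟩ : ∃ ω : ℂ, IsPrimitiveRoot ω L := ⟨_, Complex.isPrimitiveRoot_exp L hL.ne'⟩
  obtain ⟨m, hm⟩ : orderOf x ∣ L := orderOf_dvd_of_pow_eq_one hx
  have hpos : 0 < orderOf x := Nat.pos_of_dvd_of_pos ⟨m, hm⟩ hL
  have hωm : IsPrimitiveRoot (ω ^ m) (orderOf x) := hω.pow hL (by rw [hm, mul_comm])
  have : NeZero (orderOf x) := ⟨hpos.ne'⟩
  obtain ⟨j, -, hjc, hj⟩ := hωm.isPrimitiveRoot_iff.1 (IsPrimitiveRoot.orderOf x)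
  obtain ⟨u, hu⟩ := ZMod.unitsMap_surjective (Dvd.intro m hm.symm) (ZMod.unitOfCoprime j hjc)
  have hu' : ((u : ZMod L).val) % orderOf x = j % orderOf x := by
    have h1 := congrArg (fun t : (ZMod (orderOf x))ˣ => (t : ZMod (orderOf x))) hu
    simp only [ZMod.unitsMap_val, ZMod.coe_unitOfCoprime] at h1
    rw [ZMod.cast_eq_val] at h1
    exact (ZMod.natCast_eq_natCast_iff' _ _ _).1 h1
  refine ⟨ω ^ (u : ZMod L).val, m, hω.pow_of_coprime _ (ZMod.val_coe_unit_coprime u),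
    ⟨orderOf x, by rw [mul_comm]; exact hm⟩, ?_⟩
  rw [← pow_mul, mul_comm, pow_mul, ← Nat.mod_add_div (u : ZMod L).val (orderOf x), pow_add,
    pow_mul _ (orderOf x), hωm.pow_eq_one, one_pow, mul_one, hu']
  conv_lhs => rw [← hj, ← Nat.mod_add_div j (orderOf x), pow_add, pow_mul, hωm.pow_eq_one, one_pow,
    mul_one]

theorem primitiveRoot_pow_mod {ω : ℂ} {L : ℕ} (hω : IsPrimitiveRoot ω L) (k : ℕ) :
    ω ^ (k % L) = ω ^ k := by
  conv_rhs => rw [← Nat.mod_add_div k L, pow_add, pow_mul, hω.pow_eq_one, one_pow, mul_one]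

theorem primitiveRoot_pow_third {ω : ℂ} {m k : ℕ} (hω : IsPrimitiveRoot ω (3 * m))
    (hk : k < 3 * m) (h : (ω ^ k) ^ 2 + ω ^ k + 1 = 0) : k = m ∨ k = 2 * m := by
  have h3 := pow_three_of_cyclotomic_three h
  have h1 := ne_one_of_cyclotomic_three h
  rw [← pow_mul, hω.pow_eq_one_iff_dvd, mul_comm k, Nat.mul_dvd_mul_iff_left (by norm_num)] at h3
  obtain ⟨t, rfl⟩ := h3
  have : t < 3 := by
    by_contra! ht
    have := Nat.mul_le_mul_left m ht
    omega
  interval_cases t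
  · simp at h1
  · left; ring
  · right; ring

theorem primitiveRoot_pow_fourth {ω : ℂ} {m k : ℕ} (hω : IsPrimitiveRoot ω (4 * m))
    (hk : k < 4 * m) (h : (ω ^ k) ^ 2 = -1) : k = m ∨ k = 3 * m := by
  have h3 : (ω ^ k) ^ 4 = 1 := by linear_combination ((ω ^ k) ^ 2 - 1) * h
  rw [← pow_mul, hω.pow_eq_one_iff_dvd, mul_comm k, Nat.mul_dvd_mul_iff_left (by norm_num)] at h3
  obtain ⟨t, rfl⟩ := h3
  have : t < 4 := by
    by_contra! ht
    have := Nat.mul_le_mul_left m ht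
    omega
  interval_cases t
  · norm_num at h
  · left; ring
  · exfalso
    rw [← pow_mul, show m * 2 * 2 = 4 * m by ring, hω.pow_eq_one] at h
    norm_num at h
  · right; ring

theorem sporadic_third {L : ℕ} (hL : L = 30 ∨ L = 24 ∨ L = 18) (hu : D.u ^ 2 + D.u + 1 = 0)
    (hv : D.v = -1) (he : D.e ^ L = 1) : D.Sporadic := by
  have hpos : 0 < L := by omega
  obtain ⟨m, hm⟩ : ∃ m, L = 3 * m := ⟨L / 3, by omega⟩
  obtain ⟨n, hn⟩ : ∃ n, L = 2 * n := ⟨L / 2, by omega⟩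
  obtain ⟨ω, l, hω, hl, hle⟩ := exists_primitiveRoot_pow (x := D.e) hpos he
  obtain ⟨k, hk, hku⟩ := exists_exp (x := D.u) hω hpos (by
    rw [hm, pow_mul, pow_three_of_cyclotomic_three hu, one_pow])
  have hn' := primitiveRoot_half (hn ▸ hω) (by omega)
  refine ⟨L, ω, (k, l, n), hω, ?_, by ext <;> simp only [ofExp] <;> simp [*]⟩
  have hk' := primitiveRoot_pow_third (hm ▸ hω) (hm ▸ hk) (by rw [← hku]; exact hu)
  simp only [sporadicList, List.mem_append, List.mem_flatMap]
  refine .inl ⟨L, by simpa using hL, l, (mem_divisorList hpos).2 hl, ?_⟩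
  have e1 : L / 3 = m := by omega
  have e2 : L / 2 = n := by omega
  rcases hk' with rfl | rfl <;> simp [e1, e2]

theorem sporadic_cube {L : ℕ} (hL : L = 24 ∨ L = 20 ∨ L = 14) (hu : D.u ^ 3 * D.e = 1)
    (hv : D.v = -1) (hu' : D.u ^ L = 1) : D.Sporadic := by
  have hpos : 0 < L := by omega
  obtain ⟨n, hn⟩ : ∃ n, L = 2 * n := ⟨L / 2, by omega⟩
  obtain ⟨ω, k, hω, hkL, hku⟩ := exists_primitiveRoot_pow (x := D.u) hpos hu'
  have hk : k ≤ L := Nat.le_of_dvd hpos hkL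
  have hn' := primitiveRoot_half (hn ▸ hω) (by omega)
  have he : D.e = ω ^ ((3 * L - 3 * k) % L) := by
    rw [primitiveRoot_pow_mod hω]
    have h1 : ω ^ (3 * k) * ω ^ (3 * L - 3 * k) = 1 := by
      rw [← pow_add, show 3 * k + (3 * L - 3 * k) = L * 3 by omega, pow_mul, hω.pow_eq_one, one_pow]
    have h2 : ω ^ (3 * k) * D.e = 1 := by rw [mul_comm 3, pow_mul, ← hku, hu]
    have h0 : ω ^ (3 * k) ≠ 0 := left_ne_zero_of_mul_eq_one h2
    exact mul_left_cancel₀ h0 (h2.trans h1.symm)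
  refine ⟨L, ω, (k, (3 * L - 3 * k) % L, n), hω, ?_,
    by ext <;> simp only [ofExp] <;> first | assumption | (rw [hv, hn'])⟩
  simp only [sporadicList, List.mem_append, List.mem_flatMap, List.mem_map]
  have e2 : L / 2 = n := by omega
  exact .inr (.inl ⟨L, by simpa using hL, k, (mem_divisorList hpos).2 hkL, by rw [e2]⟩)

theorem sporadic_fourth (hu : D.u ^ 2 = -1) (hv : D.v = -1 ∨ D.v * D.e = 1) (he : D.e ^ 24 = 1) :
    D.Sporadic := by
  obtain ⟨ω, l, hω, hlL, hle⟩ := exists_primitiveRoot_pow (x := D.e) (L := 24) (by norm_num) he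
  have hl : l ≤ 24 := Nat.le_of_dvd (by norm_num) hlL
  have hlm := (mem_divisorList (by norm_num)).2 hlL
  obtain ⟨k, hk, hku⟩ := exists_exp (x := D.u) hω (by norm_num)
    (by linear_combination (D.u ^ 2 - 1) * (D.u ^ 20 + D.u ^ 16 + D.u ^ 12 + D.u ^ 8 + D.u ^ 4 + 1)
          * hu)
  have hk' := primitiveRoot_pow_fourth (m := 6) hω hk (by rw [← hku]; exact hu)
  have hkm : k ∈ [6, 18] := by simpa using hk'
  have h12 : ω ^ 12 = -1 := primitiveRoot_half (L := 12) hω (by norm_num)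
  rcases hv with hv | hv
  · refine ⟨24, ω, (k, l, 12), hω, ?_,
      by ext <;> simp only [ofExp] <;> first | assumption | rw [hv, h12]⟩
    simp only [sporadicList, List.mem_append, List.mem_flatMap]
    exact .inr (.inr ⟨l, hlm, k, hkm, by simp⟩)
  · refine ⟨24, ω, (k, l, (24 - l) % 24), hω, ?_, ?_⟩
    · simp only [sporadicList, List.mem_append, List.mem_flatMap]
      exact .inr (.inr ⟨l, hlm, k, hkm, by simp⟩)
    · ext <;> simp only [ofExp]
      · assumption
      · assumption
      · rw [primitiveRoot_pow_mod hω]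
        have h1 : ω ^ (24 - l) * ω ^ l = 1 := by
          rw [← pow_add, show 24 - l + l = 24 by omega, hω.pow_eq_one]
        have h0 : ω ^ l ≠ 0 := right_ne_zero_of_mul_eq_one h1
        rw [hle] at hv
        exact mul_right_cancel₀ h0 (hv.trans h1.symm)

theorem pow_eq_one_of_dvd {x : ℂ} {m n : ℕ} (h : x ^ m = 1) (hmn : m ∣ n) : x ^ n = 1 := by
  obtain ⟨k, rfl⟩ := hmn
  rw [pow_mul, h, one_pow]

theorem sporadic_third_of_left {z e : ℂ} (hz : z ^ 2 + z + 1 = 0) (he0 : e ≠ 0) (he : e ≠ 1) {n : ℕ}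
    (hn : n ≤ 5) (h : n ∈ cartanSet (-(z * e)) e⁻¹) : e ^ 30 = 1 ∨ e ^ 24 = 1 ∨ e ^ 18 = 1 := by
  have h3 := pow_three_of_cyclotomic_three hz
  have h6 : (-z) ^ 6 = 1 := by linear_combination (z ^ 3 + 1) * h3
  rcases mem_cartanSet.1 h with ⟨-, h⟩ | h
  · have key : e ^ (6 * (n + 1)) = 1 := by
      have : (e ^ (6 * (n + 1))) * ((-z) ^ 6) ^ (n + 1) = ((-(z * e)) ^ (n + 1)) ^ 6 := by
        rw [← pow_mul, ← pow_mul, ← mul_pow, mul_comm 6, ← neg_mul, mul_comm (-z)]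
      rw [h, h6, one_pow, one_pow, mul_one] at this
      exact this
    interval_cases n
    · exact .inl (pow_eq_one_of_dvd key (by decide))
    · exact .inr (.inl (pow_eq_one_of_dvd key (by decide)))
    · exact .inr (.inr key)
    · exact .inr (.inl key)
    · exact .inl key
    · have : e ^ 6 = 1 := by linear_combination h - e ^ 6 * h6
      exact .inl (pow_eq_one_of_dvd this (by decide))
  · rw [← div_eq_mul_inv, div_eq_one_iff_eq he0] at h
    interval_cases n
    · simp at h; exact absurd h.symm he
    · exfalso
      have : e * (z + 1) = 0 := by linear_combination -h
      have h1 : z = -1 := by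
        linear_combination (mul_eq_zero.1 this).resolve_left he0
      rw [h1] at hz; norm_num at hz
    · have h1 : e * z ^ 2 = 1 := by
        apply mul_left_cancel₀ he0; linear_combination h
      have : e ^ 3 = 1 := by
        linear_combination (e ^ 2 * z ^ 4 + e * z ^ 2 + 1) * h1 - e ^ 3 * (z ^ 3 + 1) * h3
      exact .inl (pow_eq_one_of_dvd this (by decide))
    · have h1 : e ^ 2 = -1 := by
        apply mul_left_cancel₀ he0; linear_combination -h - e ^ 3 * h3
      have : e ^ 4 = 1 := by linear_combination (e ^ 2 - 1) * h1
      exact .inr (.inl (pow_eq_one_of_dvd this (by decide)))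
    · have h1 : e ^ 3 * z = 1 := by
        apply mul_left_cancel₀ he0; linear_combination h - e ^ 4 * z * h3
      have : e ^ 9 = 1 := by
        linear_combination (e ^ 6 * z ^ 2 + e ^ 3 * z + 1) * h1 - e ^ 9 * h3
      exact .inr (.inr (pow_eq_one_of_dvd this (by decide)))
    · have h1 : e ^ 4 * z ^ 2 = -1 := by
        apply mul_left_cancel₀ he0; linear_combination -h - e ^ 5 * z ^ 2 * h3
      have h2 : e ^ 12 = -1 := by
        have : (e ^ 4 * z ^ 2) ^ 3 = -1 := by rw [h1]; norm_num
        linear_combination this - e ^ 12 * (z ^ 3 + 1) * h3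
      exact .inr (.inl (by linear_combination (e ^ 12 - 1) * h2))

theorem sporadic_third_of_right {z e : ℂ} (hz : z ^ 2 + z + 1 = 0) (he0 : e ≠ 0) {n : ℕ}
    (hn : n ≤ 3) (h : n ∈ cartanSet (-(e ^ 2 * z)) (e * z)⁻¹) :
    e ^ 30 = 1 ∨ e ^ 24 = 1 ∨ e ^ 18 = 1 := by
  have h3 := pow_three_of_cyclotomic_three hz
  have hz0 : z ≠ 0 := by rintro rfl; norm_num at hz
  rcases mem_cartanSet.1 h with ⟨-, h⟩ | h
  · interval_cases n
    · have : e ^ 12 = 1 := by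
        have := congrArg (· ^ 6) h
        linear_combination this - e ^ 12 * (z ^ 3 + 1) * h3
      exact .inr (.inl (pow_eq_one_of_dvd this (by decide)))
    · have : e ^ 12 = 1 := by
        have := congrArg (· ^ 3) h
        linear_combination this - e ^ 12 * (z ^ 3 + 1) * h3
      exact .inr (.inl (pow_eq_one_of_dvd this (by decide)))
    · have : e ^ 12 = 1 := by
        have := congrArg (· ^ 2) h
        linear_combination this - e ^ 12 * (z ^ 3 + 1) * h3
      exact .inr (.inl (pow_eq_one_of_dvd this (by decide)))
    · have := congrArg (· ^ 3) h
      exact .inr (.inl (by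
        linear_combination this - e ^ 24 * (z ^ 9 + z ^ 6 + z ^ 3 + 1) * h3))
  · rw [← div_eq_mul_inv, div_eq_one_iff_eq (mul_ne_zero he0 hz0)] at h
    interval_cases n
    · have : e ^ 3 = 1 := by
        have := congrArg (· ^ 3) h
        linear_combination -this - e ^ 3 * h3
      exact .inl (pow_eq_one_of_dvd this (by decide))
    · have h1 : e = -1 := by
        apply mul_left_cancel₀ (mul_ne_zero he0 hz0); linear_combination -h
      exact .inl (by rw [h1]; norm_num)
    · have h1 : e ^ 3 * z = 1 := by
        apply mul_left_cancel₀ (mul_ne_zero he0 hz0); linear_combination h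
      have : e ^ 9 = 1 := by
        linear_combination (e ^ 6 * z ^ 2 + e ^ 3 * z + 1) * h1 - e ^ 9 * h3
      exact .inr (.inr (pow_eq_one_of_dvd this (by decide)))
    · have h1 : e ^ 5 * z ^ 2 = -1 := by
        apply mul_left_cancel₀ (mul_ne_zero he0 hz0); linear_combination -h
      have h2 : e ^ 15 = -1 := by
        have : (e ^ 5 * z ^ 2) ^ 3 = -1 := by rw [h1]; norm_num
        linear_combination this - e ^ 15 * (z ^ 3 + 1) * h3
      exact .inl (by linear_combination (e ^ 15 - 1) * h2)

theorem sporadic_cube_of_left {t e : ℂ} (ht : t ^ 3 * e = 1) (he : e ≠ 1) {n : ℕ} (hn : n ≤ 5)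
    (h : n ∈ cartanSet (-(t * e)) e⁻¹) : t ^ 24 = 1 ∨ t ^ 20 = 1 ∨ t ^ 14 = 1 := by
  have ht0 : t ≠ 0 := by rintro rfl; simp at ht
  have ht1 : t ^ 3 ≠ 1 := fun h1 => he (by rw [h1, one_mul] at ht; exact ht)
  have hx : ∀ m, (-(t * e)) ^ m * t ^ (2 * m) = (-1) ^ m := fun m => by
    rw [pow_mul, ← mul_pow]
    congr 1
    linear_combination -ht
  have he' : e⁻¹ = t ^ 3 := inv_eq_of_mul_eq_one_left ht
  rw [he', mem_cartanSet] at h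
  rcases h with ⟨-, h⟩ | h
  · have h1 := hx (n + 1)
    rw [h, one_mul] at h1
    have h2 : t ^ (4 * (n + 1)) = 1 := by
      rw [show 4 * (n + 1) = 2 * (n + 1) * 2 by ring, pow_mul, h1, ← pow_mul, mul_comm, pow_mul]
      norm_num
    interval_cases n
    · exact .inl (pow_eq_one_of_dvd h2 (by decide))
    · exact .inl (pow_eq_one_of_dvd h2 (by decide))
    · exact .inl (pow_eq_one_of_dvd h2 (by decide))
    · have h3 : t ^ 8 = 1 := h1.trans (by norm_num)
      exact .inl (pow_eq_one_of_dvd h3 (by decide))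
    · exact .inr (.inl h2)
    · exact .inl h2
  · have h1 : t ^ (2 * n) = (-1) ^ n * t ^ 3 := by
      rw [← hx n]; linear_combination -t ^ (2 * n) * h
    interval_cases n
    · exact absurd (by linear_combination -h1) ht1
    · have h2 : t = -1 := by
        apply mul_left_cancel₀ (pow_ne_zero 2 ht0); linear_combination h1
      exact .inl (by rw [h2]; norm_num)
    · have h2 : t = 1 := by
        apply mul_left_cancel₀ (pow_ne_zero 3 ht0); linear_combination h1
      rw [h2] at ht1; norm_num at ht1
    · have h2 : t ^ 3 = -1 := by
        apply mul_left_cancel₀ (pow_ne_zero 3 ht0); linear_combination h1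
      have h3 : t ^ 6 = 1 := by linear_combination (t ^ 3 - 1) * h2
      exact .inl (pow_eq_one_of_dvd h3 (by decide))
    · have h2 : t ^ 5 = 1 := by
        apply mul_left_cancel₀ (pow_ne_zero 3 ht0); linear_combination h1
      exact .inr (.inl (pow_eq_one_of_dvd h2 (by decide)))
    · have h2 : t ^ 7 = -1 := by
        apply mul_left_cancel₀ (pow_ne_zero 3 ht0); linear_combination h1
      exact .inr (.inr (by linear_combination (t ^ 7 - 1) * h2))

theorem fam_or_sporadic_of_exceptional (h0 : D.Ne0) (he : D.e ≠ 1) (hr : D.Refl)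
    (hrs : D.sw.Refl) (hR : D.step.Refl) (hL : D.sw.step.Refl) (h : D.Exceptional) :
    D.Fam ∨ D.Sporadic := by
  have he0 := h0.e
  have hcs : D.sw.c = 1 := by rcases h with h | h | h <;> exact h.1
  have hv : D.v = -1 ∨ D.v * D.e = 1 := by
    have := c_spec hrs
    rw [hcs] at this
    rcases this with h | h
    · exact .inl (eq_neg_one_of_sq h.2 h.1)
    · exact .inr (by simpa using h)
  have hl : D.sw.step.c ≤ 5 → D.v = -1 → ∃ n ≤ 5, n ∈ cartanSet (-(D.u * D.e)) D.e⁻¹ := by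
    intro h5 hv
    have := cartanNum_mem hL
    rw [step_of_neg_one (D := D.sw) he hv] at this h5
    exact ⟨_, h5, this⟩
  have hc := c_spec hr
  rcases h with ⟨-, h⟩ | ⟨-, h, h'⟩ | ⟨-, h, h', h5⟩
  · left
    rw [h] at hc
    refine ⟨he, .inl ⟨hv, ?_⟩⟩
    rcases hc with h | h
    · exact .inl (eq_neg_one_of_sq h.2 h.1)
    · exact .inr (.inl (by simpa using h))
  · rw [h] at hc
    rcases hc with hc | hc
    · have hz : D.u ^ 2 + D.u + 1 = 0 := by
        apply mul_left_cancel₀ (sub_ne_zero.2 hc.1); linear_combination hc.2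
      rcases hv with hv | hv
      · right
        have : D.e ^ 30 = 1 ∨ D.e ^ 24 = 1 ∨ D.e ^ 18 = 1 := by
          rcases h' with h' | h'
          · have hm := cartanNum_mem hR
            refine sporadic_third_of_right hz he0 h' ?_
            have h3 := pow_three_of_cyclotomic_three hz
            have e1 : D.step.u = -(D.e ^ 2 * D.u) := by
              simp only [step, h, hv]; linear_combination -D.e ^ 2 * D.u * h3
            have e2 : D.step.e = (D.e * D.u)⁻¹ := by
              simp only [step, h]; congr 1; linear_combination D.e * D.u * h3
            rw [← e1, ← e2]
            exact hm
          · obtain ⟨n, hn, hm⟩ := hl h' hv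
            exact sporadic_third_of_left hz he0 he hn hm
        rcases this with h1 | h1 | h1
        · exact sporadic_third (by norm_num) hz hv h1
        · exact sporadic_third (by norm_num) hz hv h1
        · exact sporadic_third (by norm_num) hz hv h1
      · exact .inl ⟨he, .inl ⟨.inr hv, .inr (.inr (.inr ⟨hv, .inr hz⟩))⟩⟩
    · exact .inl ⟨he, .inl ⟨hv, .inr (.inr (.inl hc))⟩⟩
  · by_cases hc3 : D.u ^ 3 * D.e = 1
    · rcases hv with hv | hv
      · right
        obtain ⟨n, hn, hm⟩ := hl h5 hv
        rcases sporadic_cube_of_left hc3 he hn hm with h1 | h1 | h1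
        · exact sporadic_cube (by norm_num) hc3 hv h1
        · exact sporadic_cube (by norm_num) hc3 hv h1
        · exact sporadic_cube (by norm_num) hc3 hv h1
      · exact .inl ⟨he, .inl ⟨.inr hv, .inr (.inr (.inr ⟨hv, .inl hc3⟩))⟩⟩
    · right
      rw [h] at hc
      have hc' := hc.resolve_right hc3
      have hne : D.u ≠ -1 := fun hu => by
        have := c_eq_one he hu
        omega
      have hu2 : D.u ^ 2 = -1 := by
        have h1 : D.u + 1 ≠ 0 := fun h => hne (by linear_combination h)
        apply mul_left_cancel₀ (mul_ne_zero (sub_ne_zero.2 hc'.1) h1); linear_combination hc'.2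
      refine sporadic_fourth hu2 hv ?_
      have e1 : D.step.u = D.v * D.e ^ 3 * D.u := by
        simp only [step, h]
        linear_combination D.v * D.e ^ 3 * D.u * (D.u ^ 2 - 1) * (D.u ^ 4 + 1) * hu2
      have e2 : D.step.e * (-D.e) = 1 := by
        simp only [step, h, Nat.reduceMul]
        rw [show D.e * D.u ^ 6 = -D.e by
          linear_combination D.e * (D.u ^ 4 - D.u ^ 2 + 1) * hu2]
        field_simp
      have hs := c_spec hR
      rw [h'] at hs
      have hcase : D.v * D.e ^ 3 * D.u = -1 ∨ D.v * D.e ^ 2 * D.u = -1 := by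
        rw [← e1]
        rcases hs with hs | hs
        · exact .inl (eq_neg_one_of_sq hs.2 hs.1)
        · right
          rw [e1, pow_one] at hs
          apply mul_left_cancel₀ he0
          linear_combination (-D.e) * hs - D.v * D.e ^ 3 * D.u * e2
      have h8 : D.e ^ 12 = 1 ∨ D.e ^ 8 = 1 ∨ D.e ^ 4 = 1 := by
        rcases hv with hv | hv <;> rcases hcase with h1 | h1
        · rw [hv] at h1
          have h2 := congrArg (· ^ 4) h1
          left
          linear_combination h2 - D.e ^ 12 * (D.u ^ 2 - 1) * hu2
        · rw [hv] at h1
          have h2 := congrArg (· ^ 4) h1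
          right; left
          linear_combination h2 - D.e ^ 8 * (D.u ^ 2 - 1) * hu2
        · have h3 : D.e ^ 2 * D.u = -1 := by linear_combination h1 - D.e ^ 2 * D.u * hv
          have h2 := congrArg (· ^ 4) h3
          right; left
          linear_combination h2 - D.e ^ 8 * (D.u ^ 2 - 1) * hu2
        · have h3 : D.e * D.u = -1 := by linear_combination h1 - D.e * D.u * hv
          have h2 := congrArg (· ^ 4) h3
          right; right
          linear_combination h2 - D.e ^ 4 * (D.u ^ 2 - 1) * hu2
      rcases h8 with h1 | h1 | h1 <;> exact pow_eq_one_of_dvd h1 (by decide)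

theorem Fin2.step_and_sw_step (h : D.Fin2) (hs : D.sw.Fin2) :
    D.step.Fin2 ∧ D.step.sw.Fin2 := by
  have hback : ∀ k, Diag2.step^[k + 1] D.step.sw = Diag2.step^[k] D.sw := fun k => by
    rw [Function.iterate_succ_apply, step_sw_step h.ne0 (h.refl 0)]
  refine ⟨⟨h.ne0.step, fun k => h.refl (k + 1), h.bdd.succ⟩, h.ne0.step.sw, fun k => ?_,
    fun f hf => ?_⟩
  · rcases k with _ | k
    · exact refl_sw_step h.ne0 (h.refl 0)
    · rw [hback]; exact hs.refl k
  · obtain ⟨M, hM⟩ := hs.bdd (fun k => f (k + 1)) fun k => by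
      have := hf (k + 1)
      simp only [hback] at this
      exact this
    refine ⟨max M |f 0|, fun k => ?_⟩
    rcases k with _ | k
    · exact le_max_right _ _
    · exact (hM k).trans (le_max_left _ _)

theorem Fin2.iterate (h : D.Fin2) (hs : D.sw.Fin2) (k : ℕ) :
    (Diag2.step^[k] D).Fin2 ∧ (Diag2.step^[k] D).sw.Fin2 := by
  induction k with
  | zero => exact ⟨h, hs⟩
  | succ k ih => rw [Function.iterate_succ_apply']; exact ih.1.step_and_sw_step ih.2

/-- A connected rank two diagram with finite Weyl groupoid belongs to one of the infinite families,
or its Weyl groupoid passes through a sporadic diagram. -/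
theorem Fin2.fam_or_sporadic (h : D.Fin2) (hsw : D.sw.Fin2) (he : D.e ≠ 1) :
    D.Fam ∨ ∃ E : Diag2, E.Fin2 ∧ (E.Sporadic ∨ E.sw.Sporadic) ∧ E.e ≠ 1 ∧
      ∃ n, D = (step^[n] E).sw := by
  obtain ⟨k, hk⟩ := h.exists_exceptional he
  set E := step^[k + 1] D with hE
  have h0 : E.Ne0 := h.ne0.iterate _
  have he' : E.e ≠ 1 := iterate_e_ne_one h.ne0 h.refl he _
  have hr : E.Refl := h.refl _
  have hR : E.step.Refl := by
    rw [hE, ← Function.iterate_succ_apply' (f := step)]; exact h.refl _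
  have hback : step^[k + 1] E.sw = D.sw := iterate_sw_iterate h.ne0 h.refl (k + 1)
  have hEs : E.sw.Fin2 := (h.iterate hsw (k + 1)).2
  have hL : E.sw.step.Refl := hEs.refl 1
  have hrs : E.sw.Refl := hEs.refl 0
  have hfam : E.Fam → D.Fam := fun hf => fam_of_iterate h.ne0 h.refl (k + 1) hf
  have hD : D = (step^[k + 1] E.sw).sw := by rw [hback]; rfl
  rcases hk with hk | hk
  · refine (fam_or_sporadic_of_exceptional h0 he' hr hrs hR hL hk).imp hfam fun hs => ?_
    exact ⟨E.sw, hEs, .inr hs, he', k + 1, hD⟩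
  · refine (fam_or_sporadic_of_exceptional h0.sw he' hrs hr hL hR hk).imp
      (fun hf => hfam hf.sw) fun hs => ?_
    exact ⟨E.sw, hEs, .inl hs, he', k + 1, hD⟩

end Diag2

section Groupoid

variable {r : ℕ}

/-- The reflection `s_i` as a linear map. -/
def reflLin (q : Fin r → Fin r → ℂˣ) (i : Fin r) : (Fin r → ℤ) →ₗ[ℤ] (Fin r → ℤ) where
  toFun := sRefl q i
  map_add' β γ := by
    ext k
    simp only [sRefl, Pi.add_apply, mul_add, Finset.sum_add_distrib]
    split_ifs <;> ring
  map_smul' a β := by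
    ext k
    simp only [sRefl, Pi.smul_apply, smul_eq_mul, RingHom.id_apply, mul_left_comm _ a,
      ← Finset.mul_sum]
    split_ifs <;> ring

/-- The braiding matrix reached by reflecting along a word. -/
def matWord : (Fin r → Fin r → ℂˣ) → List (Fin r) → Fin r → Fin r → ℂˣ
  | q, [] => q
  | q, i :: w => matWord (reflectMat q i) w

/-- The composition of the reflections along a word. -/
def linWord : (Fin r → Fin r → ℂˣ) → List (Fin r) → (Fin r → ℤ) →ₗ[ℤ] (Fin r → ℤ)
  | _, [] => LinearMap.id
  | q, i :: w => linWord (reflectMat q i) w ∘ₗ reflLin q i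

theorem reachRoot_word {q₀ q : Fin r → Fin r → ℂˣ} {β : Fin r → ℤ} (h : ReachRoot q₀ q β)
    (w : List (Fin r)) : ReachRoot q₀ (matWord q w) (linWord q w β) := by
  induction w generalizing q β with
  | nil => exact h
  | cons i w ih => exact ih (h.reflect i)

/-- All reflections are defined, and the orbit of every vector is bounded. -/
structure BoundedGroupoid (q : Fin r → Fin r → ℂˣ) : Prop where
  refl : ∀ w i, reflectable (matWord q w) i
  bdd : ∀ v, ∃ M : ℤ, ∀ w k, |linWord q w v k| ≤ M

theorem FiniteRootSystem.boundedGroupoid {q : Fin r → Fin r → ℂˣ} (h : FiniteRootSystem q) :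
    BoundedGroupoid q := by
  refine ⟨fun w i => h.1 _ _ ⟨_, reachRoot_word (.simple i) w⟩, fun v => ?_⟩
  obtain ⟨M, hM⟩ := (h.2.image fun β => ∑ k, |β k|).bddAbove
  have hroot : ∀ w j k, |linWord q w (fun k => if k = j then 1 else 0) k| ≤ M := fun w j k =>
    (Finset.single_le_sum (f := fun k => |linWord q w (fun k => if k = j then 1 else 0) k|)
      (fun _ _ => abs_nonneg _) (Finset.mem_univ k)).trans
      (hM ⟨_, ⟨_, reachRoot_word (.simple j) w⟩, rfl⟩)
  refine ⟨∑ j, |v j| * M, fun w k => ?_⟩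
  rw [LinearMap.pi_apply_eq_sum_univ (linWord q w) v, Finset.sum_apply]
  refine (Finset.abs_sum_le_sum_abs _ _).trans (Finset.sum_le_sum fun j _ => ?_)
  rw [Pi.smul_apply, smul_eq_mul, abs_mul]
  simp only [eq_comm (a := j)]
  exact mul_le_mul_of_nonneg_left (hroot w j k) (abs_nonneg _)

@[simp] theorem cij_self (q : Fin r → Fin r → ℂˣ) (i : Fin r) : cij q i i = 2 := by simp [cij]

theorem reflLin_reflLin (q : Fin r → Fin r → ℂˣ) (i : Fin r) (β : Fin r → ℤ) :
    reflLin q i (reflLin q i β) = β := by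
  have h : ∑ j, cij q i j * sRefl q i β j = -∑ j, cij q i j * β j := by
    simp only [sRefl, mul_sub, Finset.sum_sub_distrib, mul_ite, mul_zero, Finset.sum_ite_eq',
      Finset.mem_univ, if_true, cij_self]
    ring
  ext k
  change sRefl q i β k - (if k = i then ∑ j, cij q i j * sRefl q i β j else 0) = β k
  rw [h, sRefl]
  split_ifs <;> ring

theorem BoundedGroupoid.reflect {q : Fin r → Fin r → ℂˣ} (h : BoundedGroupoid q) (i : Fin r) :
    BoundedGroupoid (reflectMat q i) := by
  refine ⟨fun w => h.refl (i :: w), fun v => ?_⟩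
  obtain ⟨M, hM⟩ := h.bdd (reflLin q i v)
  refine ⟨M, fun w k => ?_⟩
  have := hM (i :: w) k
  rwa [linWord, LinearMap.comp_apply, reflLin_reflLin] at this

/-- The rank two subdiagram spanned by two vertices. -/
def diagOf (q : Fin r → Fin r → ℂˣ) (a b : Fin r) : Diag2 := ⟨q a a, qtil q a b, q b b⟩

theorem qtil_comm (q : Fin r → Fin r → ℂˣ) (a b : Fin r) : qtil q a b = qtil q b a :=
  mul_comm _ _

theorem diagOf_swap (q : Fin r → Fin r → ℂˣ) (a b : Fin r) : diagOf q b a = (diagOf q a b).sw := by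
  simp [diagOf, Diag2.sw, qtil_comm q a b]

theorem diagOf_ne0 (q : Fin r → Fin r → ℂˣ) (a b : Fin r) : (diagOf q a b).Ne0 :=
  ⟨by simp [diagOf], by simp [diagOf, qtil], by simp [diagOf]⟩

theorem cij_of_ne (q : Fin r → Fin r → ℂˣ) {a b : Fin r} (h : a ≠ b) :
    cij q a b = -((diagOf q a b).c : ℤ) := by
  simp only [cij, if_neg h, Int.ofNat_eq_natCast]; rfl

theorem reflectMat_self (q : Fin r → Fin r → ℂˣ) (a : Fin r) :
    (reflectMat q a a a : ℂ) = q a a := by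
  simp only [reflectMat, cij_self, Units.val_mul, Units.val_zpow_eq_zpow_val]
  have := (q a a).ne_zero
  field_simp
  norm_cast

theorem reflectMat_diag (q : Fin r → Fin r → ℂˣ) {a b : Fin r} (h : a ≠ b) :
    (reflectMat q a b b : ℂ) =
      q b b * qtil q a b ^ (diagOf q a b).c * (q a a : ℂ) ^ ((diagOf q a b).c ^ 2) := by
  simp only [reflectMat, cij_of_ne q h, Units.val_mul, Units.val_pow_eq_pow_val, neg_neg, neg_mul,
    mul_neg, qtil, mul_pow, ← Nat.cast_mul, zpow_natCast]
  ring

theorem qtil_reflectMat_self (q : Fin r → Fin r → ℂˣ) {a b : Fin r} (h : a ≠ b) :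
    qtil (reflectMat q a) a b * (qtil q a b * (q a a : ℂ) ^ (2 * (diagOf q a b).c)) = 1 := by
  have h1 := (q a a).ne_zero
  have h2 := (q a b).ne_zero
  have h3 := (q b a).ne_zero
  have h4 : (q a a : ℂ) ^ (2 * -((diagOf q a b).c : ℤ)) = ((q a a : ℂ) ^ (2 * (diagOf q a b).c))⁻¹ := by
    rw [mul_neg, zpow_neg]; norm_cast
  simp only [reflectMat, cij_of_ne q h, cij_self, Units.val_mul, Units.val_zpow_eq_zpow_val,
    Units.val_pow_eq_pow_val, neg_neg, qtil, zpow_natCast, mul_comm (-((diagOf q a b).c : ℤ)) 2, h4]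
  rw [zpow_neg, zpow_neg, show (2 : ℤ) = ((2 : ℕ) : ℤ) from rfl, zpow_natCast, zpow_natCast]
  field_simp
  ring

theorem qtil_reflectMat (q : Fin r → Fin r → ℂˣ) {a b d : Fin r} (h : a ≠ b) (h' : a ≠ d) :
    qtil (reflectMat q a) b d =
      qtil q b d * qtil q a b ^ (diagOf q a d).c * qtil q a d ^ (diagOf q a b).c *
        (q a a : ℂ) ^ (2 * ((diagOf q a b).c * (diagOf q a d).c)) := by
  simp only [reflectMat, cij_of_ne q h, cij_of_ne q h', Units.val_mul, Units.val_pow_eq_pow_val,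
    neg_neg, neg_mul, mul_neg, qtil, ← Nat.cast_mul, zpow_natCast, mul_pow]
  ring

theorem diagOf_reflectMat (q : Fin r → Fin r → ℂˣ) {a b : Fin r} (h : a ≠ b) :
    diagOf (reflectMat q a) b a = (diagOf q a b).step := by
  ext
  · simp [diagOf, reflectMat_diag q h, Diag2.step, sq]
  · rw [diagOf, qtil_comm]
    exact eq_inv_of_mul_eq_one_left (qtil_reflectMat_self q h)
  · exact reflectMat_self q a

theorem sRefl_pair (q : Fin r → Fin r → ℂˣ) {a b : Fin r} (h : a ≠ b) (x y : ℤ) :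
    reflLin q a (Pi.single a x + Pi.single b y) =
      Pi.single b y + Pi.single a ((diagOf q a b).c * y - x) := by
  have hs : ∑ j, cij q a j * (Pi.single a x + Pi.single b y : Fin r → ℤ) j
      = 2 * x - (diagOf q a b).c * y := by
    simp only [Pi.add_apply, mul_add, Finset.sum_add_distrib, Pi.single_apply, mul_ite, mul_zero,
      Finset.sum_ite_eq', Finset.mem_univ, if_true, cij_self, cij_of_ne q h]
    ring
  ext k
  change (Pi.single a x + Pi.single b y : Fin r → ℤ) k - _ = _
  rw [hs]
  by_cases hk : k = a
  · subst hk; simp [h]; ring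
  · simp [hk]

theorem BoundedGroupoid.exists_word {q : Fin r → Fin r → ℂˣ} (k : ℕ) {a b : Fin r} (h : a ≠ b)
    {f : ℕ → ℤ} (hf : ∀ k, f (k + 2) = (Diag2.step^[k] (diagOf q a b)).c * f (k + 1) - f k) :
    ∃ w a' b', a' ≠ b' ∧ diagOf (matWord q w) a' b' = Diag2.step^[k] (diagOf q a b) ∧
      linWord q w (Pi.single a (f 0) + Pi.single b (f 1)) =
        Pi.single a' (f k) + Pi.single b' (f (k + 1)) := by
  induction k generalizing q a b f with
  | zero => exact ⟨[], a, b, h, rfl, rfl⟩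
  | succ k ih =>
    obtain ⟨w, a', b', h1, h2, h3⟩ := ih (q := reflectMat q a) (f := fun k => f (k + 1)) h.symm (by
      intro k
      rw [diagOf_reflectMat q h, ← Function.iterate_succ_apply]
      exact hf (k + 1))
    refine ⟨a :: w, a', b', h1, ?_, ?_⟩
    · rw [Function.iterate_succ_apply, ← diagOf_reflectMat q h, ← h2, matWord]
    · rw [← h3, linWord, LinearMap.comp_apply, sRefl_pair q h]
      congr 3
      exact (hf 0).symm

theorem BoundedGroupoid.fin2 {q : Fin r → Fin r → ℂˣ} (hq : BoundedGroupoid q) {a b : Fin r}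
    (h : a ≠ b) : (diagOf q a b).Fin2 := by
  refine ⟨diagOf_ne0 q a b, fun k => ?_, fun f hf => ?_⟩
  · obtain ⟨f, -, -, hf⟩ :=
      exists_rec_solution (fun k => (Diag2.step^[k] (diagOf q a b)).c) 0 0
    obtain ⟨w, a', b', h1, h2, -⟩ := exists_word k h hf
    rw [← h2]
    exact hq.refl w a' b' h1.symm
  · obtain ⟨M, hM⟩ := hq.bdd (Pi.single a (f 0) + Pi.single b (f 1))
    refine ⟨M, fun k => ?_⟩
    obtain ⟨w, a', b', h1, -, h3⟩ := exists_word k h hf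
    have := hM w a'
    rw [h3] at this
    simpa [h1] using this

end Groupoid

/-! ### Diagrams with labels in a finite group of roots of unity

Labels are powers of a fixed primitive `L`-th root of unity, represented by their exponents. -/

/-- The test for membership of `n` in `cartanSet (ω ^ u) (ω ^ e)`. -/
def cartTest (L u e n : ℕ) : Bool :=
  (!(u % L == 0) && (n + 1) * u % L == 0) || (n * u + e) % L == 0

/-- Search for the first element `≥ n` of `cartanSet (ω ^ u) (ω ^ e)`. -/
def cartSearch (L u e : ℕ) : ℕ → ℕ → Option ℕ
  | 0, _ => none
  | fuel + 1, n => if cartTest L u e n then some n else cartSearch L u e fuel (n + 1)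

/-- Whether `cartanSet (ω ^ u) (ω ^ e)` is empty. -/
def noCart (L u e : ℕ) : Bool := u % L == 0 && !(e % L == 0)

/-- Exponent version of `cartanNum`. -/
def cartExp (L u e : ℕ) : Option ℕ := if noCart L u e then some 0 else cartSearch L u e L 0

/-- The exponent of the inverse. -/
def negExp (L x : ℕ) : ℕ := (L - x % L) % L

/-- Exponent version of `Diag2.step`, together with the Cartan number. -/
def stepExp (L : ℕ) (t : ℕ × ℕ × ℕ) : Option (ℕ × ℕ × ℕ × ℕ) :=
  match cartExp L t.1 t.2.1 with
  | none => none
  | some c =>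
    some (c, (t.2.2 + c * t.2.1 + c * c * t.1) % L, negExp L (t.2.1 + 2 * c * t.1), t.1)

/-- Follows the orbit of `t₀`, with the matrix `((a, b), (c, d))` expressing the current terms of
the recursion through the initial ones, and looks for a monodromy of infinite order. -/
def infSearch (L : ℕ) (t₀ : ℕ × ℕ × ℕ) : ℕ → ℕ × ℕ × ℕ → ℤ → ℤ → ℤ → ℤ → Bool
  | 0, _, _, _, _, _ => false
  | fuel + 1, t, a, b, c, d =>
    if noCart L t.1 t.2.1 then true else
    match stepExp L t with
    | none => false
    | some (m, t') =>
      if t' = t₀ then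
        decide (2 ≤ (c + (m * d - b)).natAbs ∧ (d ≠ 0 ∨ m * c - a ≠ 0))
      else infSearch L t₀ fuel t' c d (m * c - a) (m * d - b)

/-- A sufficient criterion for a rank two diagram to have an infinite Weyl groupoid. -/
def infExp (L : ℕ) (t : ℕ × ℕ × ℕ) : Bool := infSearch L t 60 t 1 0 0 1

section Sound

variable {ω : ℂ} {L : ℕ}

theorem pow_eq_one_iff_mod (hω : IsPrimitiveRoot ω L) (k : ℕ) : ω ^ k = 1 ↔ k % L = 0 := by
  rw [hω.pow_eq_one_iff_dvd, Nat.dvd_iff_mod_eq_zero]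

theorem pow_negExp (hω : IsPrimitiveRoot ω L) (hL : 0 < L) (x : ℕ) :
    ω ^ negExp L x = (ω ^ x)⁻¹ := by
  refine eq_inv_of_mul_eq_one_left ?_
  rw [negExp, Diag2.primitiveRoot_pow_mod hω, ← Diag2.primitiveRoot_pow_mod hω x, ← pow_add,
    Nat.sub_add_cancel (Nat.mod_lt _ hL).le, hω.pow_eq_one]

theorem cartTest_iff (hω : IsPrimitiveRoot ω L) {u e n : ℕ} :
    cartTest L u e n = true ↔ n ∈ cartanSet (ω ^ u) (ω ^ e) := by
  rw [mem_cartanSet, ← pow_mul, ← pow_mul, ← pow_add, Ne, pow_eq_one_iff_mod hω,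
    pow_eq_one_iff_mod hω, pow_eq_one_iff_mod hω]
  simp [cartTest, mul_comm]

theorem cartSearch_sound (hω : IsPrimitiveRoot ω L) {u e fuel n m : ℕ}
    (h : cartSearch L u e fuel n = some m) :
    m ∈ cartanSet (ω ^ u) (ω ^ e) ∧ ∀ k, n ≤ k → k < m → k ∉ cartanSet (ω ^ u) (ω ^ e) := by
  induction fuel generalizing n with
  | zero => simp [cartSearch] at h
  | succ fuel ih =>
    rw [cartSearch] at h
    split_ifs at h with ht
    · obtain rfl : n = m := by simpa using h
      exact ⟨(cartTest_iff hω).1 ht, fun k h1 h2 => absurd h1 (not_le.2 h2)⟩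
    · obtain ⟨h1, h2⟩ := ih h
      refine ⟨h1, fun k hk hk' => ?_⟩
      rcases hk.eq_or_lt with rfl | hk
      · exact fun h => ht ((cartTest_iff hω).2 h)
      · exact h2 k hk hk'

theorem noCart_sound (hω : IsPrimitiveRoot ω L) {u e : ℕ} (h : noCart L u e = true) :
    cartanSet (ω ^ u) (ω ^ e) = ∅ := by
  simp only [noCart, Bool.and_eq_true, beq_iff_eq, Bool.not_eq_true', beq_eq_false_iff_ne] at h
  have h1 := (pow_eq_one_iff_mod hω u).2 h.1
  have h2 := (pow_eq_one_iff_mod hω e).not.2 h.2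
  ext n
  simp [mem_cartanSet, h1, h2]

theorem cartExp_sound (hω : IsPrimitiveRoot ω L) {u e c : ℕ} (h : cartExp L u e = some c) :
    cartanNum (ω ^ u) (ω ^ e) = c := by
  rw [cartExp] at h
  split_ifs at h with hn
  · rw [cartanNum, noCart_sound hω hn, Nat.sInf_empty]
    simpa using h
  · obtain ⟨h1, h2⟩ := cartSearch_sound hω h
    exact cartanNum_eq h1 fun m hm => h2 m (Nat.zero_le _) hm

theorem stepExp_sound (hω : IsPrimitiveRoot ω L) (hL : 0 < L) {t t' : ℕ × ℕ × ℕ} {c : ℕ}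
    (h : stepExp L t = some (c, t')) :
    (Diag2.ofExp ω t).c = c ∧ (Diag2.ofExp ω t).step = Diag2.ofExp ω t' := by
  rw [stepExp] at h
  split at h
  · simp at h
  · rename_i m hm
    have hc : (Diag2.ofExp ω t).c = m := cartExp_sound hω hm
    simp only [Option.some.injEq, Prod.mk.injEq] at h
    obtain ⟨rfl, rfl⟩ := h
    refine ⟨hc, ?_⟩
    ext
    · rw [Diag2.step, hc]
      simp only [Diag2.ofExp, Diag2.primitiveRoot_pow_mod hω]
      ring
    · rw [Diag2.step, hc]
      simp only [Diag2.ofExp, pow_negExp hω hL]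
      ring
    · rfl

end Sound

theorem le_abs_of_recursion {g : ℕ → ℤ} {T : ℤ} (hT : 2 ≤ |T|)
    (hg : ∀ n, g (n + 2) = T * g (n + 1) - g n) (h : |g 0| < |g 1|) (n : ℕ) :
    |g n| < |g (n + 1)| ∧ (n : ℤ) ≤ |g n| := by
  induction n with
  | zero => exact ⟨h, by simp⟩
  | succ n ih =>
    have h1 : |T * g (n + 1)| ≤ |g (n + 2)| + |g n| := by
      rw [show T * g (n + 1) = g (n + 2) + g n by rw [hg]; ring]
      exact abs_add_le _ _
    rw [abs_mul] at h1
    have h2 : 2 * |g (n + 1)| ≤ |T| * |g (n + 1)| :=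
      mul_le_mul_of_nonneg_right hT (abs_nonneg _)
    refine ⟨by linarith, ?_⟩
    push_cast
    linarith

theorem BoundedRec.monodromy {c : ℕ → ℕ} (hc : BoundedRec c) {P : ℕ} (hP : ∀ k, c (k + P) = c k)
    {m₁ m₂ m₃ m₄ : ℤ} (hdet : m₁ * m₄ - m₂ * m₃ = 1) (hT : 2 ≤ |m₁ + m₄|) (h0 : m₂ ≠ 0 ∨ m₃ ≠ 0)
    (hM : ∀ f : ℕ → ℤ, (∀ k, f (k + 2) = c k * f (k + 1) - f k) →
      f P = m₁ * f 0 + m₂ * f 1 ∧ f (P + 1) = m₃ * f 0 + m₄ * f 1) : False := by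
  have key : ∀ x y, ∃ f : ℕ → ℤ, (∀ k, f (k + 2) = c k * f (k + 1) - f k) ∧ f 0 = x ∧ f 1 = y ∧
      ∀ n, f ((n + 1) * P) = m₁ * f (n * P) + m₂ * f (n * P + 1) ∧
        f ((n + 1) * P + 1) = m₃ * f (n * P) + m₄ * f (n * P + 1) := by
    intro x y
    obtain ⟨f, h1, h2, hf⟩ := exists_rec_solution c x y
    refine ⟨f, hf, h1, h2, fun n => ?_⟩
    have hper : ∀ n k, c (k + n * P) = c k := by
      intro n k
      induction n with
      | zero => simp
      | succ n ih => rw [add_mul, one_mul, ← add_assoc, hP, ih]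
    have := hM (fun k => f (k + n * P)) (fun k => by
      have := hf (k + n * P)
      rw [hper] at this
      rw [show k + 2 + n * P = k + n * P + 2 by ring, this]
      ring_nf)
    simp only [zero_add] at this
    rw [add_mul, one_mul, add_comm (n * P) P, show P + n * P + 1 = P + 1 + n * P by ring,
      add_comm (n * P) 1]
    exact this
  rcases h0 with h0 | h0
  · obtain ⟨f, hf, h1, h2, hstep⟩ := key 0 1
    obtain ⟨M, hM'⟩ := hc f hf
    have := (le_abs_of_recursion (g := fun n => f (n * P)) hT (fun n => by
      rw [(hstep (n + 1)).1, (hstep n).1, (hstep n).2]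
      linear_combination (f (n * P)) * -hdet) (by
      have := (hstep 0).1
      simp only [zero_add, one_mul, zero_mul, h1, h2] at this ⊢
      rw [this]
      simpa using h0) (M.toNat + 1)).2
    have h3 := hM' ((M.toNat + 1) * P)
    push_cast at this
    omega
  · obtain ⟨f, hf, h1, h2, hstep⟩ := key 1 0
    obtain ⟨M, hM'⟩ := hc f hf
    have := (le_abs_of_recursion (g := fun n => f (n * P + 1)) hT (fun n => by
      rw [(hstep (n + 1)).2, (hstep n).1, (hstep n).2]
      linear_combination (f (n * P + 1)) * -hdet) (by
      have := (hstep 0).2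
      simp only [zero_add, one_mul, zero_mul, h1, h2] at this ⊢
      rw [this]
      simpa using h0) (M.toNat + 1)).2
    have h3 := hM' ((M.toNat + 1) * P + 1)
    push_cast at this
    omega

theorem infSearch_sound {ω : ℂ} {L : ℕ} (hω : IsPrimitiveRoot ω L) (hL : 0 < L)
    {t₀ t : ℕ × ℕ × ℕ} (hD : (Diag2.ofExp ω t₀).Fin2) {fuel k : ℕ} {m₁ m₂ m₃ m₄ : ℤ}
    (ht : Diag2.step^[k] (Diag2.ofExp ω t₀) = Diag2.ofExp ω t) (hdet : m₁ * m₄ - m₂ * m₃ = 1)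
    (hM : ∀ f : ℕ → ℤ,
      (∀ k, f (k + 2) = (Diag2.step^[k] (Diag2.ofExp ω t₀)).c * f (k + 1) - f k) →
      f k = m₁ * f 0 + m₂ * f 1 ∧ f (k + 1) = m₃ * f 0 + m₄ * f 1) :
    infSearch L t₀ fuel t m₁ m₂ m₃ m₄ = false := by
  induction fuel generalizing t k m₁ m₂ m₃ m₄ with
  | zero => rfl
  | succ fuel ih =>
    have hn : noCart L t.1 t.2.1 = false := by
      by_contra hn
      have h1 := noCart_sound hω (Bool.of_not_eq_false hn)
      have h2 := hD.refl k
      rw [ht] at h2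
      exact h2.ne_empty h1
    rw [infSearch, hn]
    simp only [Bool.false_eq_true, if_false]
    split
    · rfl
    · rename_i m t' hm
      obtain ⟨hc, hstep⟩ := stepExp_sound hω hL hm
      have ht' : Diag2.step^[k + 1] (Diag2.ofExp ω t₀) = Diag2.ofExp ω t' := by
        rw [Function.iterate_succ_apply', ht, hstep]
      have hdet' : m₃ * (m * m₄ - m₂) - m₄ * (m * m₃ - m₁) = 1 := by linear_combination hdet
      have hM' : ∀ f : ℕ → ℤ,
          (∀ k, f (k + 2) = (Diag2.step^[k] (Diag2.ofExp ω t₀)).c * f (k + 1) - f k) →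
          f (k + 1) = m₃ * f 0 + m₄ * f 1 ∧
            f (k + 1 + 1) = (m * m₃ - m₁) * f 0 + (m * m₄ - m₂) * f 1 := by
        intro f hf
        obtain ⟨h1, h2⟩ := hM f hf
        refine ⟨h2, ?_⟩
        rw [hf k, ht, hc, h1, h2]
        ring
      split_ifs with heq
      · subst heq
        rw [decide_eq_false_iff_not]
        rintro ⟨h2, h0⟩
        refine hD.bdd.monodromy (P := k + 1) (fun n => ?_) hdet' ?_ h0 hM'
        · simp only [Function.iterate_add_apply, ht']
        · rw [Int.abs_eq_natAbs]; exact_mod_cast h2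
      · exact ih ht' hdet' hM'

theorem infExp_sound {ω : ℂ} {L : ℕ} (hω : IsPrimitiveRoot ω L) (hL : 0 < L) {t : ℕ × ℕ × ℕ}
    (hD : (Diag2.ofExp ω t).Fin2) : infExp L t = false :=
  infSearch_sound hω hL hD (k := 0) rfl (by norm_num) fun f _ => by simp

/-- Exponents of the labels of the vertices and of the edges of a diagram of rank three. -/
structure Exp3 where
  u : ℕ
  v : ℕ
  w : ℕ
  uv : ℕ
  uw : ℕ
  vw : ℕ
deriving DecidableEq

namespace Exp3

/-- Cyclic permutation of the vertices. -/
def rot (T : Exp3) : Exp3 := ⟨T.v, T.w, T.u, T.vw, T.uv, T.uw⟩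

/-- Cyclic permutation of coordinates. -/
def rotVec (x : ℤ × ℤ × ℤ) : ℤ × ℤ × ℤ := (x.2.1, x.2.2, x.1)

/-- Action on coordinates of the reflection at the first vertex. -/
def reflVec (c d : ℕ) (x : ℤ × ℤ × ℤ) : ℤ × ℤ × ℤ := (c * x.2.1 + d * x.2.2 - x.1, x.2.1, x.2.2)

/-- Reflection at the first vertex, given the Cartan numbers. -/
def reflWith (L c d : ℕ) (T : Exp3) : Exp3 :=
  ⟨T.u, (T.v + c * T.uv + c ^ 2 * T.u) % L, (T.w + d * T.uw + d ^ 2 * T.u) % L,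
    negExp L (T.uv + 2 * c * T.u), negExp L (T.uw + 2 * d * T.u),
    (T.vw + d * T.uv + c * T.uw + 2 * (c * d) * T.u) % L⟩

/-- Performs a sequence of reflections at the first vertex (`true`) and of cyclic permutations
(`false`); returns the final diagram and the action on coordinates. -/
def run (L : ℕ) : List Bool → Exp3 → Option (Exp3 × (ℤ × ℤ × ℤ → ℤ × ℤ × ℤ))
  | [], T => some (T, id)
  | false :: w, T =>
    match run L w T.rot with
    | none => none
    | some (T', g) => some (T', fun x => g (rotVec x))
  | true :: w, T =>
    match cartExp L T.u T.uv, cartExp L T.u T.uw with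
    | some c, some d =>
      match run L w (reflWith L c d T) with
      | none => none
      | some (T', g) => some (T', fun x => g (reflVec c d x))
    | _, _ => none

/-- Whether some subdiagram of rank two is infinite. -/
def pairInf (L : ℕ) (T : Exp3) : Bool :=
  infExp L (T.u, T.uv, T.v) || infExp L (T.v, T.uv, T.u) || infExp L (T.u, T.uw, T.w) ||
    infExp L (T.w, T.uw, T.u) || infExp L (T.v, T.vw, T.w) || infExp L (T.w, T.vw, T.v)

/-- Whether a subdiagram of rank two becomes infinite along the given moves. -/
def wordInf (L : ℕ) (T : Exp3) (w : List Bool) : Bool :=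
  match run L w T with
  | none => false
  | some (T', _) => pairInf L T'

/-- Whether the given moves return to the same diagram, acting on the given vector by a nontrivial
translation. -/
def loopInf (L : ℕ) (T : Exp3) (w : List Bool) (x : ℤ × ℤ × ℤ) : Bool :=
  match run L w T with
  | none => false
  | some (T', g) => decide (T' = T ∧ g x - x ≠ 0 ∧ g (g x - x) = g x - x)

/-- A sufficient criterion for a diagram of rank three to have an infinite Weyl groupoid. -/
def infCert (L : ℕ) (T : Exp3) : Bool :=
  wordInf L T [] || wordInf L T [false, true] || wordInf L T [false, false, true] ||
    wordInf L T [true, false, false, true] ||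
    loopInf L T [true, false, true, false, true, false] (1, 0, 0) ||
    loopInf L T [true, false, false, true, false, false, true, false, false] (0, 1, 0) ||
    loopInf L T [true, false, false, true, false, true, false, true, false, false] (1, 0, 0)

variable {r : ℕ} {ω : ℂ} {L : ℕ}

/-- The vertices `a`, `b`, `d` of `q` span a diagram whose labels are powers of `ω` with the given
exponents. -/
structure Models (ω : ℂ) (T : Exp3) (q : Fin r → Fin r → ℂˣ) (a b d : Fin r) : Prop where
  ab : a ≠ b
  ad : a ≠ d
  bd : b ≠ d
  u : (q a a : ℂ) = ω ^ T.u
  v : (q b b : ℂ) = ω ^ T.v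
  w : (q d d : ℂ) = ω ^ T.w
  uv : qtil q a b = ω ^ T.uv
  uw : qtil q a d = ω ^ T.uw
  vw : qtil q b d = ω ^ T.vw

variable {T : Exp3} {q : Fin r → Fin r → ℂˣ} {a b d : Fin r}

theorem Models.rot (h : Models ω T q a b d) : Models ω T.rot q b d a :=
  ⟨h.bd, h.ab.symm, h.ad.symm, h.v, h.w, h.u, h.vw, by rw [qtil_comm]; exact h.uv,
    by rw [qtil_comm]; exact h.uw⟩

theorem Models.refl (hω : IsPrimitiveRoot ω L) (hL : 0 < L) (h : Models ω T q a b d) {c e : ℕ}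
    (hc : cartExp L T.u T.uv = some c) (he : cartExp L T.u T.uw = some e) :
    (diagOf q a b).c = c ∧ (diagOf q a d).c = e ∧
      Models ω (T.reflWith L c e) (reflectMat q a) a b d := by
  have h1 : (diagOf q a b).c = c := by
    rw [Diag2.c, diagOf, h.u, h.uv]; exact cartExp_sound hω hc
  have h2 : (diagOf q a d).c = e := by
    rw [Diag2.c, diagOf, h.u, h.uw]; exact cartExp_sound hω he
  refine ⟨h1, h2, h.ab, h.ad, h.bd, ?_, ?_, ?_, ?_, ?_, ?_⟩
  · rw [reflectMat_self, h.u]; rfl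
  · rw [reflectMat_diag q h.ab, h1, h.u, h.v, h.uv]
    simp only [reflWith, Diag2.primitiveRoot_pow_mod hω]
    ring
  · rw [reflectMat_diag q h.ad, h2, h.u, h.w, h.uw]
    simp only [reflWith, Diag2.primitiveRoot_pow_mod hω]
    ring
  · rw [eq_inv_of_mul_eq_one_left (qtil_reflectMat_self q h.ab), h1, h.u, h.uv]
    simp only [reflWith, pow_negExp hω hL]
    ring
  · rw [eq_inv_of_mul_eq_one_left (qtil_reflectMat_self q h.ad), h2, h.u, h.uw]
    simp only [reflWith, pow_negExp hω hL]
    ring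
  · rw [qtil_reflectMat q h.ab h.ad, h1, h2, h.u, h.uv, h.uw, h.vw]
    simp only [reflWith, Diag2.primitiveRoot_pow_mod hω]
    ring

/-- The vector with the given coordinates at three vertices. -/
def vec (a b d : Fin r) (x : ℤ × ℤ × ℤ) : Fin r → ℤ :=
  Pi.single a x.1 + Pi.single b x.2.1 + Pi.single d x.2.2

theorem vec_rot (x : ℤ × ℤ × ℤ) : vec b d a (rotVec x) = vec a b d x := by
  simp only [vec, rotVec]; abel

theorem vec_add (x y : ℤ × ℤ × ℤ) : vec a b d (x + y) = vec a b d x + vec a b d y := by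
  simp only [vec, Prod.fst_add, Prod.snd_add, Pi.single_add]; abel

theorem reflLin_vec (h : Models ω T q a b d) (x : ℤ × ℤ × ℤ) :
    reflLin q a (vec a b d x) = vec a b d (reflVec (diagOf q a b).c (diagOf q a d).c x) := by
  have hs : ∑ j, cij q a j * vec a b d x j
      = 2 * x.1 - (diagOf q a b).c * x.2.1 - (diagOf q a d).c * x.2.2 := by
    simp only [vec, Pi.add_apply, mul_add, Finset.sum_add_distrib, Pi.single_apply, mul_ite,
      mul_zero, Finset.sum_ite_eq', Finset.mem_univ, if_true, cij_self, cij_of_ne q h.ab,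
      cij_of_ne q h.ad]
    ring
  ext k
  change vec a b d x k - _ = _
  rw [hs]
  by_cases hk : k = a
  · subst hk
    simp [vec, reflVec, h.ab, h.ad]; ring
  · simp [vec, reflVec, hk]

theorem run_sound (hω : IsPrimitiveRoot ω L) (hL : 0 < L) {w : List Bool} {T' : Exp3}
    {g : ℤ × ℤ × ℤ → ℤ × ℤ × ℤ} (hrun : run L w T = some (T', g)) (h : Models ω T q a b d) :
    ∃ w' a' b' d', Models ω T' (matWord q w') a' b' d' ∧
      ∀ x, linWord q w' (vec a b d x) = vec a' b' d' (g x) := by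
  induction w generalizing T q a b d g with
  | nil =>
    simp only [run, Option.some.injEq, Prod.mk.injEq] at hrun
    obtain ⟨rfl, rfl⟩ := hrun
    exact ⟨[], a, b, d, h, fun _ => rfl⟩
  | cons m w ih =>
    cases m with
    | false =>
      simp only [run] at hrun
      split at hrun
      · simp at hrun
      · rename_i g' hr
        simp only [Option.some.injEq, Prod.mk.injEq] at hrun
        obtain ⟨rfl, rfl⟩ := hrun
        obtain ⟨w', a', b', d', h1, h2⟩ := ih hr h.rot
        exact ⟨w', a', b', d', h1, fun x => by rw [← h2, vec_rot]⟩
    | true =>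
      simp only [run] at hrun
      split at hrun
      · rename_i c e hc he
        split at hrun
        · simp at hrun
        · rename_i g' hr
          simp only [Option.some.injEq, Prod.mk.injEq] at hrun
          obtain ⟨rfl, rfl⟩ := hrun
          obtain ⟨hc', he', h'⟩ := h.refl hω hL hc he
          obtain ⟨w', a', b', d', h1, h2⟩ := ih hr h'
          refine ⟨a :: w', a', b', d', h1, fun x => ?_⟩
          rw [← h2, linWord, LinearMap.comp_apply, reflLin_vec h, hc', he']
      · simp at hrun

end Exp3

theorem matWord_append {r : ℕ} (q : Fin r → Fin r → ℂˣ) (w w' : List (Fin r)) :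
    matWord q (w ++ w') = matWord (matWord q w) w' := by
  induction w generalizing q with
  | nil => rfl
  | cons i w ih => exact ih _

theorem linWord_append {r : ℕ} (q : Fin r → Fin r → ℂˣ) (w w' : List (Fin r)) (v : Fin r → ℤ) :
    linWord q (w ++ w') v = linWord (matWord q w) w' (linWord q w v) := by
  induction w generalizing q v with
  | nil => rfl
  | cons i w ih => exact ih _ _

theorem BoundedGroupoid.matWord {r : ℕ} {q : Fin r → Fin r → ℂˣ} (h : BoundedGroupoid q)
    (w : List (Fin r)) : BoundedGroupoid (matWord q w) := by
  induction w generalizing q with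
  | nil => exact h
  | cons i w ih => exact ih (h.reflect i)

namespace Exp3

variable {r : ℕ} {ω : ℂ} {L : ℕ} {T : Exp3} {q : Fin r → Fin r → ℂˣ} {a b d : Fin r}

theorem pairInf_sound (hω : IsPrimitiveRoot ω L) (hL : 0 < L) (h : Models ω T q a b d)
    (hq : BoundedGroupoid q) : pairInf L T = false := by
  have key : ∀ {a b : Fin r} {x y z : ℕ}, a ≠ b → (q a a : ℂ) = ω ^ x → qtil q a b = ω ^ y →
      (q b b : ℂ) = ω ^ z → infExp L (x, y, z) = false := by
    intro a b x y z hab hx hy hz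
    have := hq.fin2 hab
    rw [diagOf, hx, hy, hz] at this
    exact infExp_sound (t := (x, y, z)) hω hL this
  simp only [pairInf, Bool.or_eq_false_iff]
  exact ⟨⟨⟨⟨⟨key h.ab h.u h.uv h.v, key h.ab.symm h.v (by rw [qtil_comm]; exact h.uv) h.u⟩,
    key h.ad h.u h.uw h.w⟩, key h.ad.symm h.w (by rw [qtil_comm]; exact h.uw) h.u⟩,
    key h.bd h.v h.vw h.w⟩, key h.bd.symm h.w (by rw [qtil_comm]; exact h.vw) h.v⟩

theorem wordInf_sound (hω : IsPrimitiveRoot ω L) (hL : 0 < L) (h : Models ω T q a b d)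
    (hq : BoundedGroupoid q) (w : List Bool) : wordInf L T w = false := by
  rw [wordInf]
  split
  · rfl
  · rename_i hr
    obtain ⟨w', a', b', d', h', -⟩ := run_sound hω hL hr h
    exact pairInf_sound hω hL h' (hq.matWord w')

theorem loopInf_sound (hω : IsPrimitiveRoot ω L) (hL : 0 < L) (h : Models ω T q a b d)
    (hq : BoundedGroupoid q) (w : List Bool) (x : ℤ × ℤ × ℤ) : loopInf L T w x = false := by
  rw [loopInf]
  split
  · rfl
  · rename_i T' g hr
    rw [decide_eq_false_iff_not]
    rintro ⟨rfl, h0, h1⟩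
    set y := g x - x with hy
    have key : ∀ n : ℕ, ∃ w' a' b' d', Models ω T' (matWord q w') a' b' d' ∧
        linWord q w' (vec a b d x) = vec a' b' d' (x + n • y) := by
      intro n
      induction n with
      | zero => exact ⟨[], a, b, d, h, by simp [linWord]⟩
      | succ n ih =>
        obtain ⟨w₁, a₁, b₁, d₁, h2, h3⟩ := ih
        obtain ⟨w₂, a₂, b₂, d₂, h4, h5⟩ := run_sound hω hL hr h2
        refine ⟨w₁ ++ w₂, a₂, b₂, d₂, by rwa [matWord_append], ?_⟩
        have h6 : ∀ n : ℕ, linWord (matWord q w₁) w₂ (vec a₁ b₁ d₁ (n • y)) =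
            vec a₂ b₂ d₂ (n • y) := by
          intro n
          induction n with
          | zero => simp [vec]
          | succ n ih => rw [succ_nsmul, vec_add, map_add, ih, h5, h1, ← vec_add]
        rw [linWord_append, h3, vec_add, map_add, h6, h5, ← vec_add, succ_nsmul]
        congr 1
        rw [hy]
        abel
    obtain ⟨M, hM⟩ := hq.bdd (vec a b d x)
    have hb : ∀ n : ℕ, |x.1 + n * y.1| ≤ M ∧ |x.2.1 + n * y.2.1| ≤ M ∧ |x.2.2 + n * y.2.2| ≤ M := by
      intro n
      obtain ⟨w', a', b', d', h2, h3⟩ := key n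
      have ha := hM w' a'
      have hb := hM w' b'
      have hd := hM w' d'
      rw [h3] at ha hb hd
      simp [vec, h2.ab, h2.ad, h2.ab.symm, h2.bd, h2.ad.symm, h2.bd.symm] at ha hb hd
      exact ⟨ha, hb, hd⟩
    have hlin : ∀ s t : ℤ, (∀ n : ℕ, |s + n * t| ≤ M) → t = 0 := by
      intro s t hst
      by_contra ht
      have e1 := hst 0
      have e2 := hst (2 * M.toNat + 1)
      have e3 : |((2 * M.toNat + 1 : ℕ) : ℤ) * t| ≤ 2 * M := by
        calc _ = |(s + (2 * M.toNat + 1 : ℕ) * t) - (s + (0 : ℕ) * t)| := by congr 1; push_cast; ring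
          _ ≤ _ := abs_sub _ _
          _ ≤ 2 * M := by linarith
      rw [abs_mul, Nat.abs_cast] at e3
      have e4 : 1 ≤ |t| := Int.one_le_abs ht
      have e5 := mul_le_mul_of_nonneg_left e4 (Int.natCast_nonneg (2 * M.toNat + 1))
      push_cast at e5 e3
      omega
    exact h0 (Prod.ext (hlin _ _ fun n => (hb n).1)
      (Prod.ext (hlin _ _ fun n => (hb n).2.1) (hlin _ _ fun n => (hb n).2.2)))

theorem infCert_sound (hω : IsPrimitiveRoot ω L) (hL : 0 < L) (h : Models ω T q a b d)
    (hq : BoundedGroupoid q) : infCert L T = false := by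
  simp only [infCert, wordInf_sound hω hL h hq, loopInf_sound hω hL h hq, Bool.or_self]

end Exp3

/-- The triangle formed by two vertices `i`, `j` with Cartan number `A` and by a primitive element of
degree `(A + 1) α_i + α_j`, when `q_{ii}^A q̃_{ij} = 1`. -/
def serreTriangle (L A q p : ℕ) : Exp3 :=
  ⟨q, p, ((A + 1) * q + p) % L, negExp L (A * q), (A + 2) * q % L,
    (2 * p + negExp L (A * (A + 1) * q)) % L⟩

/-- The triangle formed by two vertices `i`, `j` and by a primitive element of degree
`N α_i + α_j`, when `q_{ii}` has order `N`. -/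
def powerTriangle (L N q a p : ℕ) : Exp3 :=
  ⟨q, p, (N * a + p) % L, a, a, (N * a + 2 * p) % L⟩

/-- All triangles containing the given rank two diagram are infinite. -/
def diagCheck (L : ℕ) (t : ℕ × ℕ × ℕ) : Bool :=
  ((List.range L).all fun A =>
      A == 0 || !((A * t.1 + t.2.1) % L == 0) || (A + 1) * t.1 % L == 0 ||
        Exp3.infCert L (serreTriangle L A t.1 t.2.2)) &&
  (L / Nat.gcd L t.1 * t.2.1 % L == 0 ||
    (Exp3.infCert L (powerTriangle L (L / Nat.gcd L t.1) t.1 t.2.1 t.2.2) &&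
        Exp3.infCert L (powerTriangle L (L / Nat.gcd L t.1) t.1 t.2.1
          ((t.2.2 + negExp L (L / Nat.gcd L t.1 * t.2.1)) % L))))

/-- The first terms of the orbit of a rank two diagram. -/
def orbitExp (L : ℕ) (t₀ : ℕ × ℕ × ℕ) : ℕ → ℕ × ℕ × ℕ → List (ℕ × ℕ × ℕ)
  | 0, _ => []
  | fuel + 1, t =>
    match stepExp L t with
    | none => []
    | some (_, t') => if t' = t₀ then [t] else t :: orbitExp L t₀ fuel t'

/-- `diagCheck` holds along an orbit. -/
def orbitCheck (L : ℕ) (l : List (ℕ × ℕ × ℕ)) : Bool :=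
  l.all fun t => diagCheck L (t.2.2, t.2.1, t.1) &&
    match stepExp L t with
    | none => false
    | some (_, t') => l.contains t'

/-- The given diagram is infinite, or `orbitCheck` holds for its orbit. -/
def startCheck (L : ℕ) (t : ℕ × ℕ × ℕ) : Bool :=
  infExp L t || (orbitExp L t 60 t).contains t && orbitCheck L (orbitExp L t 60 t)

/-- `diagCheck` holds along the orbits of all sporadic diagrams. -/
def sporadicCheck : Bool :=
  Diag2.sporadicList.all fun s => decide (0 < s.1) && (s.2.2.1 % s.1 == 0 ||
    (startCheck s.1 s.2 && startCheck s.1 (s.2.2.2, s.2.2.1, s.2.1)))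

set_option maxRecDepth 100000 in
theorem sporadicCheck_eq_true : sporadicCheck = true := by decide +kernel

/-- Exponent version of `Diag2.Fam0`. -/
def famBase (L : ℕ) (u e v : ℕ) : Bool :=
  ((!(v % L == 0) && 2 * v % L == 0) || (v + e) % L == 0) &&
    ((!(u % L == 0) && 2 * u % L == 0) || (u + e) % L == 0 || (2 * u + e) % L == 0 ||
      ((v + e) % L == 0 && ((3 * u + e) % L == 0 || (!(u % L == 0) && 3 * u % L == 0))))

/-- Exponent version of `Diag2.Fam`. -/
def famExp (L : ℕ) (u e v : ℕ) : Bool := famBase L u e v || famBase L v e u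

/-- Triangles of Serre type all of whose relevant subdiagrams lie in the infinite families. -/
def serreFamCheck : Bool :=
  [3, 4, 5, 6, 7, 8].all fun N => [1, 2, 3].all fun A => (List.range (6 * N)).all fun k =>
    !(6 * N / Nat.gcd (6 * N) k == N) || decide (N < A + 2) || (List.range (6 * N)).all fun l =>
      !(famExp (6 * N) k (negExp (6 * N) (A * k)) l) ||
      !(N == A + 2 || famExp (6 * N) k ((A + 2) * k % (6 * N)) (((A + 1) * k + l) % (6 * N))) ||
      (N == 3 && A == 1 && l == k) || Exp3.infCert (6 * N) (serreTriangle (6 * N) A k l)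

set_option maxRecDepth 100000 in
theorem serreFamCheck_eq_true : serreFamCheck = true := by decide +kernel

/-- Triangles of power type all of whose relevant subdiagrams lie in the infinite families. -/
def powerFamCheck : Bool :=
  [6, 10, 8].all fun L => (List.range L).all fun a => (List.range L).all fun p =>
    2 * a % L == 0 || !(famExp L (L / 2) a p) || !(famExp L (L / 2) a ((2 * a + p) % L)) ||
      Exp3.infCert L (powerTriangle L 2 (L / 2) a p)

set_option maxRecDepth 100000 in
theorem powerFamCheck_eq_true : powerFamCheck = true := by decide +kernel

/-- The labels of the diagram are powers of a root of unity whose exponents satisfy `diagCheck`. -/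
def Diag2.Checked (D : Diag2) : Prop :=
  ∃ (L : ℕ) (ω : ℂ) (t : ℕ × ℕ × ℕ), 0 < L ∧ IsPrimitiveRoot ω L ∧ diagCheck L t = true ∧
    D = Diag2.ofExp ω t

theorem startCheck_sound {ω : ℂ} {L : ℕ} (hω : IsPrimitiveRoot ω L) (hL : 0 < L) {t : ℕ × ℕ × ℕ}
    (h : startCheck L t = true) (hD : (Diag2.ofExp ω t).Fin2) (n : ℕ) :
    (Diag2.step^[n] (Diag2.ofExp ω t)).sw.Checked := by
  rw [startCheck, infExp_sound hω hL hD, Bool.false_or, Bool.and_eq_true, List.contains_iff_mem]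
    at h
  obtain ⟨h0, hall⟩ := h
  generalize orbitExp L t 60 t = l at h0 hall
  rw [orbitCheck, List.all_eq_true] at hall
  have key : ∃ t' ∈ l, Diag2.step^[n] (Diag2.ofExp ω t) = Diag2.ofExp ω t' := by
    induction n with
    | zero => exact ⟨t, h0, rfl⟩
    | succ n ih =>
      obtain ⟨t', ht', he⟩ := ih
      have h1 := (Bool.and_eq_true _ _ ▸ hall t' ht').2
      split at h1
      · simp at h1
      · rename_i c t'' hs
        refine ⟨t'', List.contains_iff_mem.1 h1, ?_⟩
        rw [Function.iterate_succ_apply', he, (stepExp_sound hω hL hs).2]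
  obtain ⟨t', ht', he⟩ := key
  exact ⟨L, ω, _, hL, hω, (Bool.and_eq_true _ _ ▸ hall t' ht').1, by rw [he]; rfl⟩

theorem BoundedGroupoid.fam_or_checked {r : ℕ} {q : Fin r → Fin r → ℂˣ} (hq : BoundedGroupoid q)
    {a b : Fin r} (hab : a ≠ b) (he : qtil q a b ≠ 1) :
    (diagOf q a b).Fam ∨ (diagOf q a b).Checked := by
  refine ((hq.fin2 hab).fam_or_sporadic (diagOf_swap q a b ▸ hq.fin2 hab.symm) he).imp_right ?_
  rintro ⟨E, hE, hsp, hEe, n, hn⟩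
  rw [hn]
  have hspor := List.all_eq_true.1 sporadicCheck_eq_true
  rcases hsp with ⟨L, ω, t, hω, hmem, rfl⟩ | ⟨L, ω, t, hω, hmem, hEt⟩
  · obtain ⟨hL, h⟩ := Bool.and_eq_true _ _ ▸ hspor _ hmem
    have hL : 0 < L := by simpa using hL
    have he' : (t.2.1 % L == 0) = false := by
      rw [beq_eq_false_iff_ne]
      exact fun h => hEe ((pow_eq_one_iff_mod hω _).2 h)
    simp only [he', Bool.false_or, Bool.and_eq_true] at h
    exact startCheck_sound hω hL h.1 hE n
  · obtain ⟨hL, h⟩ := Bool.and_eq_true _ _ ▸ hspor _ hmem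
    have hL : 0 < L := by simpa using hL
    have hE' : E = Diag2.ofExp ω (t.2.2, t.2.1, t.1) := by
      have := congrArg Diag2.sw hEt
      exact this
    subst hE'
    have he' : (t.2.1 % L == 0) = false := by
      rw [beq_eq_false_iff_ne]
      exact fun h => hEe ((pow_eq_one_iff_mod hω _).2 h)
    simp only [he', Bool.false_or, Bool.and_eq_true] at h
    exact startCheck_sound hω hL h.2 hE n

theorem famBase_of_fam0 {ω : ℂ} {L u e v : ℕ} (hω : IsPrimitiveRoot ω L)
    (h : (Diag2.ofExp ω (u, e, v)).Fam0) : famBase L u e v = true := by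
  have h2 : ∀ x : ℕ, ω ^ x = -1 → x % L ≠ 0 ∧ 2 * x % L = 0 := by
    intro x hx
    rw [← pow_eq_one_iff_mod hω, Ne, ← pow_eq_one_iff_mod hω, mul_comm, pow_mul, hx]
    norm_num
  have h3 : ∀ x : ℕ, (ω ^ x) ^ 2 + ω ^ x + 1 = 0 → x % L ≠ 0 ∧ 3 * x % L = 0 := by
    intro x hx
    rw [← pow_eq_one_iff_mod hω, Ne, ← pow_eq_one_iff_mod hω, mul_comm, pow_mul]
    exact ⟨Diag2.ne_one_of_cyclotomic_three hx, Diag2.pow_three_of_cyclotomic_three hx⟩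
  have hk : ∀ k x : ℕ, (ω ^ x) ^ k * ω ^ e = 1 → (k * x + e) % L = 0 := by
    intro k x hx
    rwa [← pow_mul, ← pow_add, pow_eq_one_iff_mod hω, mul_comm x] at hx
  have hk1 : ∀ x : ℕ, ω ^ x * ω ^ e = 1 → (x + e) % L = 0 := by
    intro x hx
    rwa [← pow_add, pow_eq_one_iff_mod hω] at hx
  simp only [Diag2.Fam0, Diag2.ofExp] at h
  simp only [famBase, Bool.and_eq_true, Bool.or_eq_true, Bool.not_eq_true', beq_eq_false_iff_ne,
    beq_iff_eq]
  refine ⟨h.1.imp (h2 v) (hk1 v), ?_⟩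
  rcases h.2 with h | h | h | ⟨h, h' | h'⟩
  · exact .inl (.inl (.inl (h2 _ h)))
  · exact .inl (.inl (.inr (hk1 _ h)))
  · exact .inl (.inr (hk 2 _ h))
  · exact .inr ⟨hk1 _ h, .inl (hk 3 _ h')⟩
  · exact .inr ⟨hk1 _ h, .inr (h3 _ h')⟩

theorem famExp_of_fam {ω : ℂ} {L u e v : ℕ} (hω : IsPrimitiveRoot ω L)
    (h : (Diag2.ofExp ω (u, e, v)).Fam) : famExp L u e v = true := by
  rw [famExp, Bool.or_eq_true]
  exact h.2.imp (famBase_of_fam0 hω) (famBase_of_fam0 (u := v) (v := u) hω)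

variable {r : ℕ}

/-- The labels at the vertices `a`, `b`, `d` when `d` has the degree `(A + 1) α_a + α_b` of a quantum
Serre element which vanishes because of `q_{aa}^A q̃_{ab} = 1`. -/
structure SerreTri (q : Fin r → Fin r → ℂˣ) (a b d : Fin r) (A : ℕ) : Prop where
  ab : a ≠ b
  ad : a ≠ d
  bd : b ≠ d
  lt_order : A + 2 ≤ orderOf (q a a : ℂ)
  serre : (q a a : ℂ) ^ A * qtil q a b = 1
  label : (q d d : ℂ) = (q a a : ℂ) ^ (A + 1) * q b b
  edge_ad : qtil q a d = (q a a : ℂ) ^ (A + 2)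
  edge_bd : qtil q b d * (q a a : ℂ) ^ (A * (A + 1)) = (q b b : ℂ) ^ 2

namespace SerreTri

variable {q : Fin r → Fin r → ℂˣ} {a b d : Fin r} {A : ℕ}

theorem symm (h : SerreTri q a b d A) :
    SerreTri q a d b (orderOf (q a a : ℂ) - 2 - A) := by
  obtain ⟨B, hB⟩ : ∃ B, orderOf (q a a : ℂ) = A + 2 + B := ⟨_, (Nat.add_sub_cancel' h.lt_order).symm⟩
  have hN : (q a a : ℂ) ^ (A + 2 + B) = 1 := hB ▸ pow_orderOf_eq_one _
  have h0 : (q a a : ℂ) ≠ 0 := (q a a).ne_zero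
  rw [show orderOf (q a a : ℂ) - 2 - A = B by omega]
  refine ⟨h.ad, h.ab, h.bd.symm, by omega, ?_, ?_, ?_, ?_⟩
  · rw [h.edge_ad, ← pow_add, add_comm B, hN]
  · rw [h.label, ← mul_assoc, ← pow_add, show B + 1 + (A + 1) = A + 2 + B by ring, hN, one_mul]
  · refine mul_left_cancel₀ (pow_ne_zero A h0) ?_
    rw [h.serre, ← pow_add, ← hN]
    ring
  · refine mul_left_cancel₀ (pow_ne_zero (A * (A + 1)) h0) ?_
    have h1 : ((q a a : ℂ) ^ (A + 2 + B)) ^ B = 1 := by rw [hN, one_pow]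
    have h2 : ((q a a : ℂ) ^ (A + 2 + B)) ^ (A + 1) = 1 := by rw [hN, one_pow]
    rw [qtil_comm, h.label]
    calc (q a a : ℂ) ^ (A * (A + 1)) * (qtil q b d * (q a a : ℂ) ^ (B * (B + 1)))
        = (qtil q b d * (q a a : ℂ) ^ (A * (A + 1))) * (q a a : ℂ) ^ (B * (B + 1)) := by ring
      _ = (q b b : ℂ) ^ 2 * (q a a : ℂ) ^ (B * (B + 1)) * ((q a a : ℂ) ^ (A + 2 + B)) ^ (A + 1) := by
          rw [h.edge_bd, h2, mul_one]
      _ = (q a a : ℂ) ^ (A * (A + 1)) * ((q a a : ℂ) ^ (A + 1) * q b b) ^ 2 *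
            ((q a a : ℂ) ^ (A + 2 + B)) ^ B := by ring
      _ = _ := by rw [h1, mul_one]

theorem pow_ne_one (h : SerreTri q a b d A) : (q a a : ℂ) ^ (A + 1) ≠ 1 := by
  intro h1
  have := Nat.le_of_dvd (Nat.succ_pos A) (orderOf_dvd_of_pow_eq_one h1)
  have := h.lt_order
  omega

theorem models (h : SerreTri q a b d A) {ω : ℂ} {L k l : ℕ} (hω : IsPrimitiveRoot ω L)
    (hL : 0 < L) (hk : (q a a : ℂ) = ω ^ k) (hl : (q b b : ℂ) = ω ^ l) :
    Exp3.Models ω (serreTriangle L A k l) q a b d := by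
  have hω0 : ω ≠ 0 := hω.ne_zero hL.ne'
  refine ⟨h.ab, h.ad, h.bd, hk, hl, ?_, ?_, ?_, ?_⟩
  · simp only [serreTriangle, Diag2.primitiveRoot_pow_mod hω]
    rw [h.label, hk, hl]; ring
  · simp only [serreTriangle, pow_negExp hω hL]
    rw [← (eq_inv_of_mul_eq_one_right h.serre).symm, hk]
    congr 1
    ring
  · simp only [serreTriangle, Diag2.primitiveRoot_pow_mod hω]
    rw [h.edge_ad, hk]; ring
  · simp only [serreTriangle, Diag2.primitiveRoot_pow_mod hω]
    rw [pow_add, pow_negExp hω hL, eq_mul_inv_iff_mul_eq₀ (pow_ne_zero _ hω0), mul_comm 2 l,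
      pow_mul ω l, ← hl, ← h.edge_bd, hk]
    ring

theorem not_checked (h : SerreTri q a b d A) (hA : A ≠ 0) (hq : BoundedGroupoid q) :
    ¬ (diagOf q a b).Checked := by
  rintro ⟨L, ω, t, hL, hω, hc, ht⟩
  have hk : (q a a : ℂ) = ω ^ t.1 := congrArg Diag2.u ht
  have he : qtil q a b = ω ^ t.2.1 := congrArg Diag2.e ht
  have hl : (q b b : ℂ) = ω ^ t.2.2 := congrArg Diag2.v ht
  have hAL : A < L := by
    have := Nat.le_of_dvd hL (orderOf_dvd_of_pow_eq_one (x := (q a a : ℂ)) (n := L)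
      (by rw [hk, ← pow_mul, mul_comm, pow_mul, hω.pow_eq_one, one_pow]))
    have := h.lt_order
    omega
  rw [diagCheck, Bool.and_eq_true, List.all_eq_true] at hc
  have h1 := hc.1 A (List.mem_range.2 hAL)
  have h2 : (A * t.1 + t.2.1) % L = 0 := by
    rw [← pow_eq_one_iff_mod hω, pow_add, mul_comm A, pow_mul, ← hk, ← he, h.serre]
  have h3 : (A + 1) * t.1 % L ≠ 0 := by
    rw [Ne, ← pow_eq_one_iff_mod hω, mul_comm, pow_mul, ← hk]
    exact h.pow_ne_one
  simp [hA, h2, h3, Exp3.infCert_sound hω hL (h.models hω hL hk hl) hq] at h1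

theorem fam_bound (h : SerreTri q a b d A) (hF : (diagOf q a b).Fam) :
    A ≤ 3 ∧ (q b b : ℂ) ^ (6 * orderOf (q a a : ℂ)) = 1 := by
  have hlt := h.lt_order
  have hser := h.serre
  obtain ⟨he, hF⟩ := hF
  simp only [Diag2.Fam0, Diag2.sw, diagOf] at hF he
  generalize (q a a : ℂ) = Q at *
  generalize qtil q a b = e at *
  generalize (q b b : ℂ) = p at *
  have hQN := pow_orderOf_eq_one Q
  have hmin : ∀ k, Q ^ k = 1 → k = 0 ∨ A + 2 ≤ k := fun k hk => by
    rcases Nat.eq_zero_or_pos k with h0 | h0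
    · exact .inl h0
    · exact .inr (hlt.trans (Nat.le_of_dvd h0 (orderOf_dvd_of_pow_eq_one hk)))
  have heN : e ^ orderOf Q = 1 := by
    have := congrArg (· ^ orderOf Q) hser
    simp only [mul_pow, one_pow] at this
    rwa [← pow_mul, mul_comm A, pow_mul, hQN, one_pow, one_mul] at this
  generalize orderOf Q = N at *
  have hk : ∀ k, Q ^ k * e = 1 → A ≤ k := by
    intro k hk
    by_contra! hlt
    have h0 : Q ^ k * e ≠ 0 := by rw [hk]; exact one_ne_zero
    have : Q ^ (A - k) = 1 := by
      refine mul_right_cancel₀ h0 ?_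
      rw [← mul_assoc, ← pow_add, Nat.sub_add_cancel hlt.le, hser, hk, one_mul]
    rcases hmin _ this with h | h <;> omega
  have hk1 : Q * e = 1 → A ≤ 1 := fun h => hk 1 (by rwa [pow_one])
  have hm1 : Q ≠ -1 := by
    rintro rfl
    rcases hmin 2 (by norm_num) with h | h
    · omega
    · have : A = 0 := by omega
      subst this
      exact he (by simpa using hser)
  have hp1 : p = -1 → p ^ (6 * N) = 1 := by
    rintro rfl
    rw [pow_mul]; norm_num
  have hpk : ∀ k, p ^ k * e = 1 → p ^ (k * N) = 1 := by
    intro k hk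
    have := congrArg (· ^ N) hk
    simpa only [mul_pow, one_pow, ← pow_mul, heN, mul_one] using this
  have hpk' : ∀ k m, p ^ (k * N) = 1 → m * k = 6 → p ^ (6 * N) = 1 := by
    intro k m hk hm
    rw [← hm, mul_assoc, mul_comm, pow_mul, hk, one_pow]
  have hpe : p * e = 1 → p ^ (6 * N) = 1 := fun h =>
    hpk' 1 6 (hpk 1 (by rwa [pow_one])) rfl
  have hc3 : p ^ 2 + p + 1 = 0 → p ^ (6 * N) = 1 := fun h => by
    rw [show 6 * N = 3 * (2 * N) by ring, pow_mul, Diag2.pow_three_of_cyclotomic_three h, one_pow]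
  rcases hF with ⟨hv, hu⟩ | ⟨hv, hu⟩
  · refine ⟨?_, hv.elim hp1 hpe⟩
    rcases hu with hu | hu | hu | ⟨-, hu | hu⟩
    · exact absurd hu hm1
    · exact (hk1 hu).trans (by norm_num)
    · exact (hk 2 hu).trans (by norm_num)
    · exact hk 3 hu
    · rcases hmin 3 (Diag2.pow_three_of_cyclotomic_three hu) with h | h <;> omega
  · refine ⟨(hk1 (hv.resolve_left hm1)).trans (by norm_num), ?_⟩
    rcases hu with hu | hu | hu | ⟨-, hu | hu⟩
    · exact hp1 hu
    · exact hpe hu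
    · exact hpk' 2 3 (hpk 2 hu) rfl
    · exact hpk' 3 2 (hpk 3 hu) rfl
    · exact hc3 hu

theorem exceptional (h : SerreTri q a b d A) (hA : A ≠ 0) (hq : BoundedGroupoid q) :
    orderOf (q a a : ℂ) = 3 ∧ A = 1 ∧ (q b b : ℂ) = q a a := by
  have hlt := h.lt_order
  have he1 : qtil q a b ≠ 1 := by
    intro he
    have := h.serre
    rw [he, mul_one] at this
    have := Nat.le_of_dvd (Nat.pos_of_ne_zero hA) (orderOf_dvd_of_pow_eq_one this)
    omega
  have hX := (hq.fam_or_checked h.ab he1).resolve_right (h.not_checked hA hq)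
  have hY : orderOf (q a a : ℂ) ≠ A + 2 → (diagOf q a d).Fam := by
    intro hN
    refine (hq.fam_or_checked h.ad ?_).resolve_right (h.symm.not_checked (by omega) hq)
    rw [h.edge_ad]
    intro h1
    have := Nat.le_of_dvd (Nat.succ_pos _) (orderOf_dvd_of_pow_eq_one h1)
    omega
  obtain ⟨hA3, hp⟩ := h.fam_bound hX
  have hN8 : orderOf (q a a : ℂ) ≤ 8 := by
    by_contra! hN
    have := (h.symm.fam_bound (hY (by omega))).1
    omega
  set N := orderOf (q a a : ℂ) with hN
  have hL : 0 < 6 * N := by omega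
  have hω := Complex.isPrimitiveRoot_exp (6 * N) hL.ne'
  set ω := Complex.exp (2 * Real.pi * Complex.I / (6 * N : ℕ))
  obtain ⟨k, hkL, hk⟩ := Diag2.exists_exp (x := (q a a : ℂ)) hω hL
    (by rw [mul_comm, pow_mul, hN, pow_orderOf_eq_one, one_pow])
  obtain ⟨l, hlL, hl⟩ := Diag2.exists_exp (x := (q b b : ℂ)) hω hL hp
  have hm := h.models hω hL hk hl
  have hgcd : 6 * N / Nat.gcd (6 * N) k = N := by
    conv_rhs => rw [hN, hk, (isOfFinOrder_iff_pow_eq_one.2 ⟨_, hL, hω.pow_eq_one⟩).orderOf_pow,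
      ← hω.eq_orderOf]
  have h1 := List.all_eq_true.1 serreFamCheck_eq_true N (by
    simp only [List.mem_cons, List.not_mem_nil, or_false]; omega)
  have h2 := List.all_eq_true.1 h1 A (by
    simp only [List.mem_cons, List.not_mem_nil, or_false]; omega)
  have h3 := List.all_eq_true.1 h2 k (List.mem_range.2 hkL)
  simp only [hgcd, beq_self_eq_true, Bool.not_true, Bool.false_or, Bool.or_eq_true,
    decide_eq_true_eq] at h3
  have h4 := List.all_eq_true.1 (h3.resolve_left (by omega)) l (List.mem_range.2 hlL)
  have hfX : famExp (6 * N) k (negExp (6 * N) (A * k)) l = true := by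
    refine famExp_of_fam hω ?_
    convert hX using 1
    ext
    exacts [hm.u.symm, hm.uv.symm, hm.v.symm]
  have hfY : (N == A + 2 ||
      famExp (6 * N) k ((A + 2) * k % (6 * N)) (((A + 1) * k + l) % (6 * N))) = true := by
    rw [Bool.or_eq_true, beq_iff_eq]
    by_cases hNA : N = A + 2
    · exact .inl hNA
    · refine .inr (famExp_of_fam hω ?_)
      convert hY hNA using 1
      ext
      exacts [hm.u.symm, hm.uw.symm, hm.w.symm]
  rw [hfX, hfY, Exp3.infCert_sound hω hL hm hq] at h4
  simp only [Bool.not_true, Bool.false_or, Bool.or_false, Bool.and_eq_true, beq_iff_eq] at h4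
  exact ⟨h4.1.1, h4.1.2, by rw [hk, hl, h4.2]⟩

end SerreTri

variable {r : ℕ}

/-- The labels at the vertices `a`, `b`, `d` when `d` has degree `N α_a + α_b`, where `N` is the order
of `q_{aa}`, and `q̃_{ab}^N ≠ 1`. -/
structure PowerTri (q : Fin r → Fin r → ℂˣ) (a b d : Fin r) : Prop where
  ab : a ≠ b
  ad : a ≠ d
  bd : b ≠ d
  edge_pow : qtil q a b ^ orderOf (q a a : ℂ) ≠ 1
  label : (q d d : ℂ) = qtil q a b ^ orderOf (q a a : ℂ) * q b b
  edge_ad : qtil q a d = qtil q a b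
  edge_bd : qtil q b d = qtil q a b ^ orderOf (q a a : ℂ) * (q b b : ℂ) ^ 2

namespace PowerTri

variable {q : Fin r → Fin r → ℂˣ} {a b d : Fin r}

theorem models (h : PowerTri q a b d) {ω : ℂ} {L k e l : ℕ} (hω : IsPrimitiveRoot ω L)
    (hk : (q a a : ℂ) = ω ^ k) (he : qtil q a b = ω ^ e) (hl : (q b b : ℂ) = ω ^ l) :
    Exp3.Models ω (powerTriangle L (orderOf (q a a : ℂ)) k e l) q a b d := by
  refine ⟨h.ab, h.ad, h.bd, hk, hl, ?_, he, h.edge_ad.trans he, ?_⟩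
  · simp only [powerTriangle, Diag2.primitiveRoot_pow_mod hω]
    rw [h.label, he, hl]; ring
  · simp only [powerTriangle, Diag2.primitiveRoot_pow_mod hω]
    rw [h.edge_bd, he, hl]; ring

theorem check_pow {ω : ℂ} {L k : ℕ} (hω : IsPrimitiveRoot ω L) (hL : 0 < L) :
    L / Nat.gcd L k = orderOf (ω ^ k) := by
  rw [(isOfFinOrder_iff_pow_eq_one.2 ⟨_, hL, hω.pow_eq_one⟩).orderOf_pow, ← hω.eq_orderOf]

theorem edge_check (h : PowerTri q a b d) {ω : ℂ} {L e : ℕ} (hω : IsPrimitiveRoot ω L)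
    (he : qtil q a b = ω ^ e) : (orderOf (q a a : ℂ) * e % L == 0) = false := by
  rw [beq_eq_false_iff_ne, Ne, ← pow_eq_one_iff_mod hω, mul_comm, pow_mul, ← he]
  exact h.edge_pow

theorem not_checked (h : PowerTri q a b d) (hq : BoundedGroupoid q) :
    ¬ (diagOf q a b).Checked := by
  rintro ⟨L, ω, t, hL, hω, hc, ht⟩
  have hk : (q a a : ℂ) = ω ^ t.1 := congrArg Diag2.u ht
  have he : qtil q a b = ω ^ t.2.1 := congrArg Diag2.e ht
  have hl : (q b b : ℂ) = ω ^ t.2.2 := congrArg Diag2.v ht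
  rw [diagCheck, check_pow hω hL, ← hk, h.edge_check hω he,
    Exp3.infCert_sound hω hL (h.models hω hk he hl) hq] at hc
  simp at hc

theorem not_checked_right (h : PowerTri q a b d) (hq : BoundedGroupoid q) :
    ¬ (diagOf q a d).Checked := by
  rintro ⟨L, ω, t, hL, hω, hc, ht⟩
  have hk : (q a a : ℂ) = ω ^ t.1 := congrArg Diag2.u ht
  have he : qtil q a b = ω ^ t.2.1 := h.edge_ad ▸ congrArg Diag2.e ht
  have hl' : (q d d : ℂ) = ω ^ t.2.2 := congrArg Diag2.v ht
  have hl : (q b b : ℂ) = ω ^ ((t.2.2 + negExp L (orderOf (q a a : ℂ) * t.2.1)) % L) := by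
    rw [Diag2.primitiveRoot_pow_mod hω, pow_add, pow_negExp hω hL, ← hl', h.label,
      mul_comm _ t.2.1, pow_mul, ← he, mul_comm]
    have h0 : qtil q a b ≠ 0 := mul_ne_zero (q a b).ne_zero (q b a).ne_zero
    exact (inv_mul_cancel_left₀ (pow_ne_zero _ h0) _).symm
  rw [diagCheck, check_pow hω hL, ← hk, h.edge_check hω he,
    Exp3.infCert_sound hω hL (h.models hω hk he hl) hq] at hc
  simp at hc

theorem fam_cases {Q e p : ℂ} (h : (Diag2.mk Q e p).Fam) (heN : e ^ orderOf Q ≠ 1) :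
    (Q = -1 ∧ (p = -1 ∨ p * e = 1 ∨ p ^ 2 * e = 1)) ∨ (Q ^ 2 + Q + 1 = 0 ∧ p * e = 1) := by
  have hk : ∀ k, Q ^ k * e ≠ 1 := by
    intro k hk
    have := congrArg (· ^ orderOf Q) hk
    simp only [mul_pow, one_pow] at this
    rw [← pow_mul, mul_comm k, pow_mul, pow_orderOf_eq_one, one_pow, one_mul] at this
    exact heN this
  have hk1 : Q * e ≠ 1 := by simpa using hk 1
  obtain ⟨-, h⟩ := h
  simp only [Diag2.Fam0, Diag2.sw] at h
  have := hk 2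
  have := hk 3
  tauto

theorem not_boundedGroupoid (h : PowerTri q a b d) : ¬ BoundedGroupoid q := by
  intro hq
  have he1 : qtil q a b ≠ 1 := fun he => h.edge_pow (by rw [he, one_pow])
  have hX := (hq.fam_or_checked h.ab he1).resolve_right (h.not_checked hq)
  have hY := (hq.fam_or_checked h.ad (h.edge_ad ▸ he1)).resolve_right (h.not_checked_right hq)
  have key : ∀ L : ℕ, L = 6 ∨ L = 10 ∨ L = 8 → (q a a : ℂ) = -1 → qtil q a b ^ L = 1 →
      (q b b : ℂ) ^ L = 1 → False := by
    intro L hLmem hQ heL hpL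
    have hL : 0 < L := by omega
    have hL2 : L = 2 * (L / 2) := by omega
    have hω := Complex.isPrimitiveRoot_exp L hL.ne'
    set ω := Complex.exp (2 * Real.pi * Complex.I / L)
    have hk : (q a a : ℂ) = ω ^ (L / 2) := by
      rw [hQ, Diag2.primitiveRoot_half (hL2 ▸ hω) (by omega)]
    obtain ⟨e, heL, he⟩ := Diag2.exists_exp hω hL heL
    obtain ⟨l, hlL, hl⟩ := Diag2.exists_exp hω hL hpL
    have hord : orderOf (q a a : ℂ) = 2 := by rw [hQ]; simp
    have hm := h.models hω hk he hl
    rw [hord] at hm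
    have h1 := List.all_eq_true.1 powerFamCheck_eq_true L (by simpa using hLmem)
    have h2 := List.all_eq_true.1 (List.all_eq_true.1 h1 e (List.mem_range.2 heL)) l
      (List.mem_range.2 hlL)
    have hfX : famExp L (L / 2) e l = true := by
      refine famExp_of_fam hω ?_
      convert hX using 1
      ext
      exacts [hm.u.symm, hm.uv.symm, hm.v.symm]
    have hfY : famExp L (L / 2) e ((2 * e + l) % L) = true := by
      refine famExp_of_fam hω ?_
      convert hY using 1
      ext
      exacts [hm.u.symm, hm.uw.symm, hm.w.symm]
    rw [hfX, hfY, ← hord, h.edge_check hω he, hord, Exp3.infCert_sound hω hL hm hq] at h2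
    simp at h2
  have hX' := fam_cases hX h.edge_pow
  have hY' := fam_cases hY (h.edge_ad ▸ h.edge_pow)
  rw [h.label, h.edge_ad] at hY'
  have hN := h.edge_pow
  have hord : (q a a : ℂ) = -1 → orderOf (q a a : ℂ) = 2 := fun hQ => by rw [hQ]; simp
  have h0 : (q b b : ℂ) ≠ 0 := (q b b).ne_zero
  clear hX hY
  generalize qtil q a b = e at *
  generalize (q b b : ℂ) = p at *
  rcases hX' with ⟨hQ, hX'⟩ | ⟨hQ, hX'⟩
  · rcases hY' with ⟨-, hY'⟩ | ⟨hQ', -⟩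
    · rw [hord hQ] at hY' hN
      rcases hX' with hX' | hX' | hX'
      · subst hX'
        rcases hY' with hY' | hY' | hY'
        · exact hN (by linear_combination -hY')
        · exact key 6 (.inl rfl) hQ (by linear_combination (e ^ 3 - 1) * -hY') (by norm_num)
        · exact key 10 (.inr (.inl rfl)) hQ (by linear_combination (e ^ 5 + 1) * hY') (by norm_num)
      · have hp : e ^ 2 * p = e := by linear_combination e * hX'
        rw [hp] at hY'
        rcases hY' with hY' | hY' | hY'
        · exact hN (by rw [hY']; norm_num)
        · exact hN (by linear_combination hY')
        · have he : e ^ 6 = 1 := by linear_combination (e ^ 3 + 1) * hY'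
          refine key 6 (.inl rfl) hQ he ?_
          have : (p * e) ^ 6 = 1 := by rw [hX', one_pow]
          rwa [mul_pow, he, mul_one] at this
      · have hL : ∀ L, L = 6 ∨ L = 10 ∨ L = 8 → p ^ L ≠ 1 := by
          intro L hL hp
          refine key L hL hQ ?_ hp
          have : (p ^ 2 * e) ^ L = 1 := by rw [hX', one_pow]
          rwa [mul_pow, ← pow_mul, mul_comm 2, pow_mul, hp, one_pow, one_mul] at this
        have h2 : (p ^ 2 * e) ^ 2 = 1 := by rw [hX', one_pow]
        have h3 : (p ^ 2 * e) ^ 3 = 1 := by rw [hX', one_pow]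
        have h5 : (p ^ 2 * e) ^ 5 = 1 := by rw [hX', one_pow]
        rcases hY' with hY' | hY' | hY'
        · have hp : p ^ 3 = -1 := mul_left_cancel₀ h0 (by linear_combination p ^ 4 * hY' - p * h2)
          exact hL 6 (.inl rfl) (by linear_combination (p ^ 3 - 1) * hp)
        · have hp : p ^ 5 = 1 := mul_left_cancel₀ h0 (by linear_combination p * h3 - p ^ 6 * hY')
          exact hL 10 (.inr (.inl rfl)) (by linear_combination (p ^ 5 + 1) * hp)
        · have hp : p ^ 8 = 1 := mul_left_cancel₀ (pow_ne_zero 2 h0)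
            (by linear_combination p ^ 2 * h5 - p ^ 10 * hY')
          exact hL 8 (.inr (.inr rfl)) hp
    · rw [hQ] at hQ'
      norm_num at hQ'
  · rcases hY' with ⟨hQ', -⟩ | ⟨-, hY'⟩
    · rw [hQ'] at hQ
      norm_num at hQ
    · exact hN (by rw [mul_assoc, hX', mul_one] at hY'; exact hY')

end PowerTri

section Degrees
variable {θ : ℕ}

theorem degW_nil : degW θ [] = 0 := by
  funext k; simp [degW]

theorem degW_append (v w : List (Fin θ)) : degW θ (v ++ w) = degW θ v + degW θ w := by
  funext k; simp [degW]

theorem degW_singleton (i : Fin θ) : degW θ [i] = δ θ i := by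
  funext k
  by_cases h : k = i
  · simp [degW, δ, h]
  · simp [degW, δ, h, Ne.symm h]

theorem degW_cons (i : Fin θ) (w : List (Fin θ)) : degW θ (i :: w) = δ θ i + degW θ w := by
  rw [← List.singleton_append, degW_append, degW_singleton]

theorem sum_degW (w : List (Fin θ)) : ∑ k, degW θ w k = w.length := by
  induction w with
  | nil => simp [degW_nil]
  | cons i w ih => simp [degW_cons, Finset.sum_add_distrib, ih, δ, add_comm]

variable (q : Fin θ → Fin θ → ℂˣ)

theorem qf_ne_zero (a b : Fin θ → ℕ) : qf q a b ≠ 0 :=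
  Finset.prod_ne_zero_iff.2 fun i _ => Finset.prod_ne_zero_iff.2 fun j _ =>
    pow_ne_zero _ (q i j).ne_zero

theorem qf_zero_left (b : Fin θ → ℕ) : qf q 0 b = 1 := by simp [qf]

theorem qf_zero_right (a : Fin θ → ℕ) : qf q a 0 = 1 := by simp [qf]

theorem qf_add_left (a b c : Fin θ → ℕ) : qf q (a + b) c = qf q a c * qf q b c := by
  simp [qf, add_mul, pow_add, Finset.prod_mul_distrib]

theorem qf_add_right (a b c : Fin θ → ℕ) : qf q a (b + c) = qf q a b * qf q a c := by
  simp [qf, mul_add, pow_add, Finset.prod_mul_distrib]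

theorem qf_delta (i j : Fin θ) : qf q (δ θ i) (δ θ j) = q i j := by
  rw [qf, Finset.prod_eq_single i, Finset.prod_eq_single j] <;> simp_all [δ]

theorem qf_smul_left (n : ℕ) (a b : Fin θ → ℕ) : qf q (n • a) b = qf q a b ^ n := by
  induction n with
  | zero => simp [qf_zero_left]
  | succ n ih => rw [succ_nsmul, qf_add_left, ih, pow_succ]

theorem qf_smul_right (n : ℕ) (a b : Fin θ → ℕ) : qf q a (n • b) = qf q a b ^ n := by
  induction n with
  | zero => simp [qf_zero_right]
  | succ n ih => rw [succ_nsmul, qf_add_right, ih, pow_succ]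

end Degrees

section Words
variable {θ : ℕ}

@[simp] theorem wordElem_nil : wordElem θ [] = 1 := rfl

theorem wordElem_cons (i : Fin θ) (w : List (Fin θ)) :
    wordElem θ (i :: w) = gen θ i * wordElem θ w := by simp [wordElem]

theorem wordElem_append (v w : List (Fin θ)) :
    wordElem θ (v ++ w) = wordElem θ v * wordElem θ w := by simp [wordElem]

theorem wordElem_singleton (i : Fin θ) : wordElem θ [i] = gen θ i := by simp [wordElem]

variable (θ) in
/-- The basis of `T(V)` formed by the words. -/
def wordBasis : Module.Basis (List (Fin θ)) ℂ (TV θ) :=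
  (FreeAlgebra.basisFreeMonoid ℂ (Fin θ)).reindex FreeMonoid.toList

theorem wordBasis_apply (w : List (Fin θ)) : wordBasis θ w = wordElem θ w := by
  have h : ∀ w : List (Fin θ), FreeAlgebra.equivMonoidAlgebraFreeMonoid (R := ℂ) (wordElem θ w)
      = MonoidAlgebra.of ℂ _ (FreeMonoid.ofList w) := by
    intro w
    induction w with
    | nil => simp [MonoidAlgebra.one_def]
    | cons i w ih =>
      rw [wordElem_cons, map_mul, ih, FreeMonoid.ofList_cons, map_mul]
      congr 1
      simp [gen, FreeAlgebra.equivMonoidAlgebraFreeMonoid]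
  have h' := h w
  rw [← AlgEquiv.eq_symm_apply] at h'
  rw [h', wordBasis, FreeAlgebra.basisFreeMonoid]
  simp

theorem TV.word_induction {P : TV θ → Prop} (word : ∀ w, P (wordElem θ w))
    (add : ∀ u v, P u → P v → P (u + v)) (smul : ∀ (c : ℂ) u, P u → P (c • u)) (u : TV θ) :
    P u := by
  have hu : u ∈ Submodule.span ℂ (Set.range (wordBasis θ)) := (wordBasis θ).mem_span u
  induction hu using Submodule.span_induction with
  | mem x hx => obtain ⟨w, rfl⟩ := hx; rw [wordBasis_apply]; exact word w
  | zero => simpa using smul 0 _ (word [])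
  | add x y _ _ hx hy => exact add _ _ hx hy
  | smul c x _ hx => exact smul _ _ hx

theorem TV.tensor_induction {P : TV θ ⊗[ℂ] TV θ → Prop}
    (word : ∀ v w, P (wordElem θ v ⊗ₜ wordElem θ w))
    (add : ∀ s t, P s → P t → P (s + t)) (smul : ∀ (c : ℂ) t, P t → P (c • t))
    (t : TV θ ⊗[ℂ] TV θ) : P t := by
  induction t using TensorProduct.induction_on with
  | zero => simpa using smul 0 _ (word [] [])
  | add x y hx hy => exact add _ _ hx hy
  | tmul u v =>
    induction u using TV.word_induction with
    | add u u' h h' => rw [TensorProduct.add_tmul]; exact add _ _ h h'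
    | smul c u h => rw [← TensorProduct.smul_tmul']; exact smul _ _ h
    | word w =>
      induction v using TV.word_induction with
      | add u u' h h' => rw [TensorProduct.tmul_add]; exact add _ _ h h'
      | smul c u h => rw [TensorProduct.tmul_smul]; exact smul _ _ h
      | word v => exact word w v

end Words

section Existence
variable {θ : ℕ} (q : Fin θ → Fin θ → ℂˣ)

/-- The multiplication of the braided tensor product `T(V) ⊗ T(V)`. -/
def braidedMul : TV θ ⊗[ℂ] TV θ →ₗ[ℂ] TV θ ⊗[ℂ] TV θ →ₗ[ℂ] TV θ ⊗[ℂ] TV θ :=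
  ((wordBasis θ).tensorProduct (wordBasis θ)).constr ℂ fun p =>
    ((wordBasis θ).tensorProduct (wordBasis θ)).constr ℂ fun p' =>
      qf q (degW θ p.2) (degW θ p'.1) •
        ((wordElem θ (p.1 ++ p'.1)) ⊗ₜ[ℂ] (wordElem θ (p.2 ++ p'.2)))

theorem braidedMul_word (a b c d : List (Fin θ)) :
    braidedMul q (wordElem θ a ⊗ₜ wordElem θ b) (wordElem θ c ⊗ₜ wordElem θ d)
      = qf q (degW θ b) (degW θ c) • (wordElem θ (a ++ c) ⊗ₜ[ℂ] wordElem θ (b ++ d)) := by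
  have h : ∀ v w : List (Fin θ), wordElem θ v ⊗ₜ[ℂ] wordElem θ w
      = ((wordBasis θ).tensorProduct (wordBasis θ)) (v, w) := by
    intro v w; simp [Module.Basis.tensorProduct_apply, wordBasis_apply]
  rw [h a b, h c d, braidedMul, Module.Basis.constr_basis, Module.Basis.constr_basis]

theorem braidedMul_assoc (r s t : TV θ ⊗[ℂ] TV θ) :
    braidedMul q (braidedMul q r s) t = braidedMul q r (braidedMul q s t) := by
  induction r using TV.tensor_induction with
  | add x y hx hy => simp only [map_add, LinearMap.add_apply, hx, hy]
  | smul c x hx => simp only [map_smul, LinearMap.smul_apply, hx]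
  | word a b =>
  induction s using TV.tensor_induction with
  | add x y hx hy => simp only [map_add, LinearMap.add_apply, hx, hy]
  | smul c x hx => simp only [map_smul, LinearMap.smul_apply, hx]
  | word a' b' =>
  induction t using TV.tensor_induction with
  | add x y hx hy => simp only [map_add, hx, hy]
  | smul c x hx => simp only [map_smul, hx]
  | word a'' b'' =>
    simp only [braidedMul_word, map_smul, LinearMap.smul_apply, smul_smul, degW_append,
      qf_add_left, qf_add_right, List.append_assoc]
    congr 1
    ring

theorem braidedMul_one_left (t : TV θ ⊗[ℂ] TV θ) : braidedMul q (1 ⊗ₜ 1) t = t := by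
  induction t using TV.tensor_induction with
  | add x y hx hy => simp only [map_add, hx, hy]
  | smul c x hx => simp only [map_smul, hx]
  | word a b =>
    have := braidedMul_word q [] [] a b
    simpa [degW_nil, qf_zero_left] using this

theorem braidedMul_one_right (t : TV θ ⊗[ℂ] TV θ) : braidedMul q t (1 ⊗ₜ 1) = t := by
  induction t using TV.tensor_induction with
  | add x y hx hy => simp only [map_add, LinearMap.add_apply, hx, hy]
  | smul c x hx => simp only [map_smul, LinearMap.smul_apply, hx]
  | word a b =>
    have := braidedMul_word q a b [] []
    simpa [degW_nil, qf_zero_right] using this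

/-- Left multiplication by coproducts, as a representation of `T(V)`. -/
def coprodRep : TV θ →ₐ[ℂ] Module.End ℂ (TV θ ⊗[ℂ] TV θ) :=
  FreeAlgebra.lift ℂ fun i => braidedMul q (gen θ i ⊗ₜ 1 + 1 ⊗ₜ gen θ i)

theorem coprodRep_braidedMul (u : TV θ) (s t : TV θ ⊗[ℂ] TV θ) :
    coprodRep q u (braidedMul q s t) = braidedMul q (coprodRep q u s) t := by
  induction u using FreeAlgebra.induction generalizing s with
  | grade0 c => simp [Module.algebraMap_end_apply]
  | grade1 i => simp [coprodRep, braidedMul_assoc]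
  | mul a b ha hb => simp [Module.End.mul_apply, ha, hb]
  | add a b ha hb => simp [ha, hb]

/-- The braided bialgebra structure of `T(V)` exists for every braiding matrix. -/
def braidedStr : BraidedStr θ q where
  Δ := (LinearMap.applyₗ (1 ⊗ₜ[ℂ] 1 : TV θ ⊗[ℂ] TV θ)).comp (coprodRep q).toLinearMap
  mulB := braidedMul q
  mulB_spec a d wb wc := by
    induction a using TV.word_induction with
    | add x y hx hy =>
      simp only [TensorProduct.add_tmul, map_add, LinearMap.add_apply, hx, hy, add_mul, smul_add]
    | smul c x hx =>
      simp only [← TensorProduct.smul_tmul', map_smul, LinearMap.smul_apply, hx, smul_mul_assoc]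
      rw [smul_comm]
    | word a =>
    induction d using TV.word_induction with
    | add x y hx hy => simp only [TensorProduct.tmul_add, map_add, hx, hy, mul_add, smul_add]
    | smul c x hx =>
      simp only [TensorProduct.tmul_smul, map_smul, hx, mul_smul_comm]
      rw [smul_comm]
    | word d => rw [braidedMul_word, wordElem_append, wordElem_append]
  Δ_one := by simp
  Δ_gen i := by
    have := braidedMul_one_right q (gen θ i ⊗ₜ 1 + 1 ⊗ₜ gen θ i)
    simpa [coprodRep, gen] using this
  Δ_mul u v := by
    simp only [LinearMap.comp_apply, LinearMap.applyₗ_apply_apply, AlgHom.toLinearMap_apply,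
      map_mul, Module.End.mul_apply]
    rw [← coprodRep_braidedMul, braidedMul_one_left]

end Existence

section Scaling
variable {θ : ℕ}

/-- The algebra endomorphism `x_l ↦ q(d, α_l) x_l`. -/
def scL (q : Fin θ → Fin θ → ℂˣ) (d : Fin θ → ℕ) : TV θ →ₐ[ℂ] TV θ :=
  FreeAlgebra.lift ℂ fun l => qf q d (δ θ l) • gen θ l

/-- The algebra endomorphism `x_l ↦ q(α_l, d) x_l`. -/
def scR (q : Fin θ → Fin θ → ℂˣ) (d : Fin θ → ℕ) : TV θ →ₐ[ℂ] TV θ :=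
  FreeAlgebra.lift ℂ fun l => qf q (δ θ l) d • gen θ l

variable (q : Fin θ → Fin θ → ℂˣ)

theorem scL_gen (d : Fin θ → ℕ) (l : Fin θ) : scL q d (gen θ l) = qf q d (δ θ l) • gen θ l := by
  simp [scL, gen]

theorem scR_gen (d : Fin θ → ℕ) (l : Fin θ) : scR q d (gen θ l) = qf q (δ θ l) d • gen θ l := by
  simp [scR, gen]

theorem scL_word (d : Fin θ → ℕ) (w : List (Fin θ)) :
    scL q d (wordElem θ w) = qf q d (degW θ w) • wordElem θ w := by
  induction w with
  | nil => simp [degW_nil, qf_zero_right]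
  | cons i w ih =>
    rw [wordElem_cons, map_mul, ih, scL_gen, degW_cons, qf_add_right, smul_mul_smul_comm]

theorem scR_word (d : Fin θ → ℕ) (w : List (Fin θ)) :
    scR q d (wordElem θ w) = qf q (degW θ w) d • wordElem θ w := by
  induction w with
  | nil => simp [degW_nil, qf_zero_left]
  | cons i w ih =>
    rw [wordElem_cons, map_mul, ih, scR_gen, degW_cons, qf_add_left, smul_mul_smul_comm]

theorem scL_homogD {d e : Fin θ → ℕ} {u : TV θ} (hu : u ∈ homogD θ e) :
    scL q d u = qf q d e • u := by
  induction hu using Submodule.span_induction with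
  | mem x hx => obtain ⟨w, rfl, rfl⟩ := hx; rw [scL_word]
  | zero => simp
  | add x y _ _ hx hy => rw [map_add, hx, hy, smul_add]
  | smul c x _ hx => rw [map_smul, hx, smul_comm]

theorem scL_zero (u : TV θ) : scL q 0 u = u := by
  induction u using TV.word_induction with
  | word w => simp [scL_word, qf_zero_left]
  | add u v hu hv => rw [map_add, hu, hv]
  | smul c u hu => rw [map_smul, hu]

theorem scR_zero (u : TV θ) : scR q 0 u = u := by
  induction u using TV.word_induction with
  | word w => simp [scR_word, qf_zero_right]
  | add u v hu hv => rw [map_add, hu, hv]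
  | smul c u hu => rw [map_smul, hu]

theorem scL_add (d e : Fin θ → ℕ) (u : TV θ) : scL q (d + e) u = scL q d (scL q e u) := by
  induction u using TV.word_induction with
  | word w => simp only [scL_word, map_smul, smul_smul, qf_add_left, mul_comm]
  | add u v hu hv => simp only [map_add, hu, hv]
  | smul c u hu => simp only [map_smul, hu]

theorem scR_add (d e : Fin θ → ℕ) (u : TV θ) : scR q (d + e) u = scR q d (scR q e u) := by
  induction u using TV.word_induction with
  | word w => simp only [scR_word, map_smul, smul_smul, qf_add_right, mul_comm]
  | add u v hu hv => simp only [map_add, hu, hv]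
  | smul c u hu => simp only [map_smul, hu]

end Scaling

section Coefficients
variable {θ : ℕ}

/-- The coefficient of a word. -/
def coef (w : List (Fin θ)) : TV θ →ₗ[ℂ] ℂ := (wordBasis θ).coord w

theorem coef_word (v w : List (Fin θ)) : coef v (wordElem θ w) = if w = v then 1 else 0 := by
  rw [coef, ← wordBasis_apply, Module.Basis.coord_apply, Module.Basis.repr_self,
    Finsupp.single_apply]

theorem coef_nil_mul (u v : TV θ) : coef [] (u * v) = coef [] u * coef [] v := by
  induction u using TV.word_induction with
  | add x y hx hy => simp only [add_mul, map_add, hx, hy]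
  | smul c x hx => simp only [smul_mul_assoc, map_smul, smul_eq_mul, hx, mul_assoc]
  | word a =>
  induction v using TV.word_induction with
  | add x y hx hy => simp only [mul_add, map_add, hx, hy]
  | smul c x hx => simp only [mul_smul_comm, map_smul, smul_eq_mul, hx]; ring
  | word b =>
    rw [← wordElem_append, coef_word, coef_word, coef_word]
    by_cases ha : a = [] <;> by_cases hb : b = [] <;> simp [ha, hb]

theorem coef_singleton_mul (k : Fin θ) (u v : TV θ) :
    coef [k] (u * v) = coef [k] u * coef [] v + coef [] u * coef [k] v := by
  induction u using TV.word_induction with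
  | add x y hx hy => simp only [add_mul, map_add, hx, hy]; ring
  | smul c x hx => simp only [smul_mul_assoc, map_smul, smul_eq_mul, hx]; ring
  | word a =>
  induction v using TV.word_induction with
  | add x y hx hy => simp only [mul_add, map_add, hx, hy]; ring
  | smul c x hx => simp only [mul_smul_comm, map_smul, smul_eq_mul, hx]; ring
  | word b =>
    rw [← wordElem_append, coef_word, coef_word, coef_word, coef_word, coef_word]
    rcases a with _ | ⟨a, a'⟩
    · simp
    · rcases b with _ | ⟨b, b'⟩ <;> simp

/-- Evaluation of a functional on the left tensor factor. -/
def conL (f : TV θ →ₗ[ℂ] ℂ) : TV θ ⊗[ℂ] TV θ →ₗ[ℂ] TV θ :=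
  (TensorProduct.lid ℂ (TV θ)).toLinearMap ∘ₗ f.rTensor (TV θ)

/-- Evaluation of a functional on the right tensor factor. -/
def conR (f : TV θ →ₗ[ℂ] ℂ) : TV θ ⊗[ℂ] TV θ →ₗ[ℂ] TV θ :=
  (TensorProduct.rid ℂ (TV θ)).toLinearMap ∘ₗ f.lTensor (TV θ)

@[simp] theorem conL_tmul (f : TV θ →ₗ[ℂ] ℂ) (a b : TV θ) : conL f (a ⊗ₜ b) = f a • b := by
  simp [conL]

@[simp] theorem conR_tmul (f : TV θ →ₗ[ℂ] ℂ) (a b : TV θ) : conR f (a ⊗ₜ b) = f b • a := by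
  simp [conR]

end Coefficients

section Product
variable {θ : ℕ} {q : Fin θ → Fin θ → ℂˣ} (S : BraidedStr θ q)

theorem BraidedStr.mulB_tmul_word (a b d : TV θ) (w : List (Fin θ)) :
    S.mulB (a ⊗ₜ b) (wordElem θ w ⊗ₜ d)
      = (a * wordElem θ w) ⊗ₜ (scR q (degW θ w) b * d) := by
  induction b using TV.word_induction with
  | add x y hx hy =>
    simp only [TensorProduct.tmul_add, map_add, LinearMap.add_apply, hx, hy, add_mul]
  | smul c x hx =>
    simp only [TensorProduct.tmul_smul, map_smul, LinearMap.smul_apply, hx, smul_mul_assoc]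
  | word b => rw [S.mulB_spec, scR_word, smul_mul_assoc, TensorProduct.tmul_smul]

theorem BraidedStr.mulB_word_tmul (a c d : TV θ) (w : List (Fin θ)) :
    S.mulB (a ⊗ₜ wordElem θ w) (c ⊗ₜ d)
      = (a * scL q (degW θ w) c) ⊗ₜ (wordElem θ w * d) := by
  induction c using TV.word_induction with
  | add x y hx hy => simp only [TensorProduct.add_tmul, map_add, hx, hy, mul_add]
  | smul c x hx => simp only [← TensorProduct.smul_tmul', map_smul, hx, mul_smul_comm]
  | word b => rw [S.mulB_spec, scL_word, mul_smul_comm, TensorProduct.smul_tmul']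

theorem BraidedStr.mulB_homogD_tmul {d : Fin θ → ℕ} {b : TV θ} (hb : b ∈ homogD θ d)
    (a c e : TV θ) : S.mulB (a ⊗ₜ b) (c ⊗ₜ e) = (a * scL q d c) ⊗ₜ (b * e) := by
  induction hb using Submodule.span_induction with
  | mem x hx => obtain ⟨w, rfl, rfl⟩ := hx; exact S.mulB_word_tmul a c e w
  | zero => simp
  | add x y _ _ hx hy =>
    simp only [TensorProduct.tmul_add, map_add, LinearMap.add_apply, hx, hy, add_mul]
  | smul c x _ hx =>
    simp only [TensorProduct.tmul_smul, map_smul, LinearMap.smul_apply, hx, smul_mul_assoc]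

theorem BraidedStr.mulB_one_tmul (a c e : TV θ) :
    S.mulB (a ⊗ₜ 1) (c ⊗ₜ e) = (a * c) ⊗ₜ e := by
  have := S.mulB_word_tmul a c e []
  simpa [degW_nil, scL_zero] using this

theorem BraidedStr.mulB_tmul_one (a b e : TV θ) :
    S.mulB (a ⊗ₜ b) (1 ⊗ₜ e) = a ⊗ₜ (b * e) := by
  have := S.mulB_tmul_word a b e []
  simpa [degW_nil, scR_zero] using this

theorem BraidedStr.mulB_induction {P : TV θ ⊗[ℂ] TV θ → TV θ ⊗[ℂ] TV θ → Prop}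
    (word : ∀ a b c d, P (wordElem θ a ⊗ₜ wordElem θ b) (wordElem θ c ⊗ₜ wordElem θ d))
    (add_left : ∀ s s' t, P s t → P s' t → P (s + s') t)
    (add_right : ∀ s t t', P s t → P s t' → P s (t + t'))
    (smul_left : ∀ (c : ℂ) s t, P s t → P (c • s) t)
    (smul_right : ∀ (c : ℂ) s t, P s t → P s (c • t)) (s t) : P s t := by
  induction s using TV.tensor_induction with
  | add x y hx hy => exact add_left _ _ _ hx hy
  | smul c x hx => exact smul_left _ _ _ hx
  | word a b =>
  induction t using TV.tensor_induction with
  | add x y hx hy => exact add_right _ _ _ hx hy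
  | smul c x hx => exact smul_right _ _ _ hx
  | word c d => exact word a b c d

theorem conL_coef_nil_mulB (s t : TV θ ⊗[ℂ] TV θ) :
    conL (coef []) (S.mulB s t) = conL (coef []) s * conL (coef []) t := by
  induction s, t using BraidedStr.mulB_induction with
  | word a b c d =>
    rw [S.mulB_tmul_word, conL_tmul, conL_tmul, conL_tmul, coef_nil_mul, smul_mul_smul_comm,
      coef_word [] c]
    split_ifs with h
    · simp [h, degW_nil, scR_zero]
    · simp
  | add_left s s' t h h' => simp only [map_add, LinearMap.add_apply, h, h', add_mul]
  | add_right s t t' h h' => simp only [map_add, h, h', mul_add]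
  | smul_left c s t h => simp only [map_smul, LinearMap.smul_apply, h, smul_mul_assoc]
  | smul_right c s t h => simp only [map_smul, h, mul_smul_comm]

theorem conR_coef_nil_mulB (s t : TV θ ⊗[ℂ] TV θ) :
    conR (coef []) (S.mulB s t) = conR (coef []) s * conR (coef []) t := by
  induction s, t using BraidedStr.mulB_induction with
  | word a b c d =>
    rw [S.mulB_word_tmul, conR_tmul, conR_tmul, conR_tmul, coef_nil_mul, smul_mul_smul_comm,
      coef_word [] b]
    split_ifs with h
    · simp [h, degW_nil, scL_zero]
    · simp
  | add_left s s' t h h' => simp only [map_add, LinearMap.add_apply, h, h', add_mul]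
  | add_right s t t' h h' => simp only [map_add, h, h', mul_add]
  | smul_left c s t h => simp only [map_smul, LinearMap.smul_apply, h, smul_mul_assoc]
  | smul_right c s t h => simp only [map_smul, h, mul_smul_comm]

theorem conL_coef_singleton_mulB (k : Fin θ) (s t : TV θ ⊗[ℂ] TV θ) :
    conL (coef [k]) (S.mulB s t) = conL (coef [k]) s * conL (coef []) t
      + scR q (δ θ k) (conL (coef []) s) * conL (coef [k]) t := by
  induction s, t using BraidedStr.mulB_induction with
  | word a b c d =>
    rw [S.mulB_tmul_word]
    simp only [conL_tmul, coef_singleton_mul, add_smul, map_smul, smul_mul_smul_comm]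
    rw [coef_word [] c, coef_word [k] c]
    congr 1
    · split_ifs with h
      · simp [h, degW_nil, scR_zero]
      · simp
    · split_ifs with h
      · simp [h, degW_singleton]
      · simp
  | add_left s s' t h h' => simp only [map_add, LinearMap.add_apply, h, h', add_mul]; abel
  | add_right s t t' h h' => simp only [map_add, h, h', mul_add]; abel
  | smul_left c s t h =>
    simp only [map_smul, LinearMap.smul_apply, h, smul_mul_assoc, smul_add]
  | smul_right c s t h => simp only [map_smul, h, mul_smul_comm, smul_add]

theorem conR_coef_singleton_mulB (k : Fin θ) (s t : TV θ ⊗[ℂ] TV θ) :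
    conR (coef [k]) (S.mulB s t) = conR (coef [k]) s * scL q (δ θ k) (conR (coef []) t)
      + conR (coef []) s * conR (coef [k]) t := by
  induction s, t using BraidedStr.mulB_induction with
  | word a b c d =>
    rw [S.mulB_word_tmul]
    simp only [conR_tmul, coef_singleton_mul, add_smul, map_smul, smul_mul_smul_comm]
    rw [coef_word [] b, coef_word [k] b]
    congr 1
    · split_ifs with h
      · simp [h, degW_singleton]
      · simp
    · split_ifs with h
      · simp [h, degW_nil, scL_zero]
      · simp
  | add_left s s' t h h' => simp only [map_add, LinearMap.add_apply, h, h', add_mul]; abel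
  | add_right s t t' h h' => simp only [map_add, h, h', mul_add]; abel
  | smul_left c s t h =>
    simp only [map_smul, LinearMap.smul_apply, h, smul_mul_assoc, smul_add]
  | smul_right c s t h => simp only [map_smul, h, mul_smul_comm, smul_add]

end Product

section Derivations
variable {θ : ℕ} {q : Fin θ → Fin θ → ℂˣ} (S : BraidedStr θ q)

theorem coef_one (w : List (Fin θ)) : coef w (1 : TV θ) = if [] = w then 1 else 0 := by
  rw [← wordElem_nil, coef_word]

theorem coef_gen (w : List (Fin θ)) (i : Fin θ) :
    coef w (gen θ i) = if [i] = w then 1 else 0 := by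
  rw [← wordElem_singleton, coef_word]

theorem BraidedStr.conL_counit (u : TV θ) : conL (coef []) (S.Δ u) = u := by
  induction u using TV.word_induction with
  | add x y hx hy => simp only [map_add, hx, hy]
  | smul c x hx => simp only [map_smul, hx]
  | word w =>
    induction w with
    | nil => simp [S.Δ_one, coef_one]
    | cons i w ih =>
      rw [wordElem_cons, S.Δ_mul, conL_coef_nil_mulB, ih, S.Δ_gen]
      simp [coef_one, coef_gen]

theorem BraidedStr.conR_counit (u : TV θ) : conR (coef []) (S.Δ u) = u := by
  induction u using TV.word_induction with
  | add x y hx hy => simp only [map_add, hx, hy]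
  | smul c x hx => simp only [map_smul, hx]
  | word w =>
    induction w with
    | nil => simp [S.Δ_one, coef_one]
    | cons i w ih =>
      rw [wordElem_cons, S.Δ_mul, conR_coef_nil_mulB, ih, S.Δ_gen]
      simp [coef_one, coef_gen]

/-- The skew derivation `∂_k`, which picks the terms `x_k ⊗ -` of the coproduct. -/
def BraidedStr.der (k : Fin θ) : TV θ →ₗ[ℂ] TV θ := conL (coef [k]) ∘ₗ S.Δ

/-- The skew derivation which picks the terms `- ⊗ x_k` of the coproduct. -/
def BraidedStr.derR (k : Fin θ) : TV θ →ₗ[ℂ] TV θ := conR (coef [k]) ∘ₗ S.Δ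

theorem BraidedStr.der_mul (k : Fin θ) (u v : TV θ) :
    S.der k (u * v) = S.der k u * v + scR q (δ θ k) u * S.der k v := by
  simp only [BraidedStr.der, LinearMap.comp_apply, S.Δ_mul, conL_coef_singleton_mulB,
    S.conL_counit]

theorem BraidedStr.derR_mul (k : Fin θ) (u v : TV θ) :
    S.derR k (u * v) = S.derR k u * scL q (δ θ k) v + u * S.derR k v := by
  simp only [BraidedStr.derR, LinearMap.comp_apply, S.Δ_mul, conR_coef_singleton_mulB,
    S.conR_counit]

theorem BraidedStr.der_gen (k i : Fin θ) : S.der k (gen θ i) = if i = k then 1 else 0 := by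
  simp [BraidedStr.der, S.Δ_gen, coef_one, coef_gen]

theorem BraidedStr.derR_gen (k i : Fin θ) : S.derR k (gen θ i) = if i = k then 1 else 0 := by
  simp [BraidedStr.derR, S.Δ_gen, coef_one, coef_gen]

theorem BraidedStr.der_one (k : Fin θ) : S.der k 1 = 0 := by
  simp [BraidedStr.der, S.Δ_one, coef_one]

end Derivations

section Homogeneous
variable {θ : ℕ}

theorem coef_homogTot {n : ℕ} {u : TV θ} (hu : u ∈ homogTot θ n) {w : List (Fin θ)}
    (hw : w.length ≠ n) : coef w u = 0 := by
  induction hu using Submodule.span_induction with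
  | mem x hx =>
    obtain ⟨v, rfl, rfl⟩ := hx
    rw [coef_word, if_neg (by rintro rfl; exact hw rfl)]
  | zero => simp
  | add x y _ _ hx hy => rw [map_add, hx, hy, add_zero]
  | smul c x _ hx => rw [map_smul, hx, smul_zero]

/-- The projection onto the component of total degree `m`. -/
def prTot (m : ℕ) : TV θ →ₗ[ℂ] TV θ :=
  (wordBasis θ).constr ℂ fun w => if w.length = m then wordElem θ w else 0

theorem prTot_word (m : ℕ) (w : List (Fin θ)) :
    prTot m (wordElem θ w) = if w.length = m then wordElem θ w else 0 := by
  rw [prTot, ← wordBasis_apply, Module.Basis.constr_basis, wordBasis_apply]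

theorem prTot_homogTot {n : ℕ} {u : TV θ} (hu : u ∈ homogTot θ n) (m : ℕ) :
    prTot m u = if n = m then u else 0 := by
  induction hu using Submodule.span_induction with
  | mem x hx => obtain ⟨v, rfl, rfl⟩ := hx; rw [prTot_word]
  | zero => simp
  | add x y _ _ hx hy => rw [map_add, hx, hy]; split_ifs <;> simp
  | smul c x _ hx => rw [map_smul, hx]; split_ifs <;> simp

theorem homogD_le_homogTot (d : Fin θ → ℕ) : homogD θ d ≤ homogTot θ (∑ k, d k) := by
  refine Submodule.span_mono ?_
  rintro x ⟨w, rfl, rfl⟩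
  exact ⟨w, (sum_degW w).symm, rfl⟩

theorem gen_mem_homogD (i : Fin θ) : gen θ i ∈ homogD θ (δ θ i) :=
  Submodule.subset_span ⟨[i], degW_singleton i, (wordElem_singleton i).symm⟩

theorem one_mem_homogD : (1 : TV θ) ∈ homogD θ 0 :=
  Submodule.subset_span ⟨[], degW_nil, rfl⟩

theorem mul_mem_homogD {d e : Fin θ → ℕ} {u v : TV θ} (hu : u ∈ homogD θ d)
    (hv : v ∈ homogD θ e) : u * v ∈ homogD θ (d + e) := by
  have h := Submodule.mul_mem_mul hu hv
  rw [homogD, homogD, Submodule.span_mul_span] at h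
  refine Submodule.span_mono ?_ h
  rintro _ ⟨_, ⟨v, rfl, rfl⟩, _, ⟨w, rfl, rfl⟩, rfl⟩
  exact ⟨v ++ w, degW_append v w, (wordElem_append v w).symm⟩

end Homogeneous

section Ideals
variable {θ : ℕ} {q : Fin θ → Fin θ → ℂˣ} {S : BraidedStr θ q} {I : Submodule ℂ (TV θ)}

theorem tmul_mem_mixedSub_left {a : TV θ} (ha : a ∈ I) (b : TV θ) : a ⊗ₜ b ∈ mixedSub I :=
  Submodule.subset_span (Or.inl ⟨a, b, ha, rfl⟩)

theorem tmul_mem_mixedSub_right {b : TV θ} (hb : b ∈ I) (a : TV θ) : a ⊗ₜ b ∈ mixedSub I :=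
  Submodule.subset_span (Or.inr ⟨a, b, hb, rfl⟩)

theorem conL_mem_of_mixedSub {f : TV θ →ₗ[ℂ] ℂ} (hf : ∀ u ∈ I, f u = 0) {t : TV θ ⊗[ℂ] TV θ}
    (ht : t ∈ mixedSub I) : conL f t ∈ I := by
  induction ht using Submodule.span_induction with
  | mem x hx =>
    rcases hx with ⟨a, b, ha, rfl⟩ | ⟨a, b, hb, rfl⟩
    · simp [hf a ha]
    · simpa using I.smul_mem _ hb
  | zero => simp
  | add x y _ _ hx hy => rw [map_add]; exact I.add_mem hx hy
  | smul c x _ hx => rw [map_smul]; exact I.smul_mem _ hx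

theorem conR_mem_of_mixedSub {f : TV θ →ₗ[ℂ] ℂ} (hf : ∀ u ∈ I, f u = 0) {t : TV θ ⊗[ℂ] TV θ}
    (ht : t ∈ mixedSub I) : conR f t ∈ I := by
  induction ht using Submodule.span_induction with
  | mem x hx =>
    rcases hx with ⟨a, b, ha, rfl⟩ | ⟨a, b, hb, rfl⟩
    · simpa using I.smul_mem _ ha
    · simp [hf b hb]
  | zero => simp
  | add x y _ _ hx hy => rw [map_add]; exact I.add_mem hx hy
  | smul c x _ hx => rw [map_smul]; exact I.smul_mem _ hx

namespace IsPreNicholsIdeal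

theorem induction (hI : IsPreNicholsIdeal S I) {P : TV θ → Prop} (zero : P 0)
    (homog : ∀ u ∈ I, ∀ n, 2 ≤ n → u ∈ homogTot θ n → P u)
    (add : ∀ u v, P u → P v → P (u + v)) (smul : ∀ (c : ℂ) u, P u → P (c • u)) {u : TV θ}
    (hu : u ∈ I) : P u := by
  rw [hI.homog_ge2] at hu
  induction hu using Submodule.span_induction with
  | mem x hx => obtain ⟨hx, n, hn, hxn⟩ := hx; exact homog x hx n hn hxn
  | zero => exact zero
  | add x y _ _ hx hy => exact add _ _ hx hy
  | smul c x _ hx => exact smul _ _ hx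

theorem coef_eq_zero (hI : IsPreNicholsIdeal S I) {w : List (Fin θ)} (hw : w.length < 2)
    {u : TV θ} (hu : u ∈ I) : coef w u = 0 := by
  refine hI.induction (P := fun u => coef w u = 0) (by simp)
    (fun u _ n hn h => coef_homogTot h (by omega)) (fun u v hu hv => ?_) (fun c u hu => ?_) hu
  · rw [map_add, hu, hv, add_zero]
  · rw [map_smul, hu, smul_zero]

theorem prTot_mem (hI : IsPreNicholsIdeal S I) (m : ℕ) {u : TV θ} (hu : u ∈ I) : prTot m u ∈ I := by
  refine hI.induction (P := fun u => prTot m u ∈ I) (by simp)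
    (fun u hu n hn h => ?_) (fun u v hu hv => ?_) (fun c u hu => ?_) hu
  · rw [prTot_homogTot h]
    split_ifs
    exacts [hu, I.zero_mem]
  · rw [map_add]; exact I.add_mem hu hv
  · rw [map_smul]; exact I.smul_mem _ hu

theorem der_mem (hI : IsPreNicholsIdeal S I) (k : Fin θ) {u : TV θ} (hu : u ∈ I) : S.der k u ∈ I :=
  conL_mem_of_mixedSub (fun _ h => hI.coef_eq_zero (by simp) h) (hI.coideal u hu)

theorem derR_mem (hI : IsPreNicholsIdeal S I) (k : Fin θ) {u : TV θ} (hu : u ∈ I) :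
    S.derR k u ∈ I :=
  conR_mem_of_mixedSub (fun _ h => hI.coef_eq_zero (by simp) h) (hI.coideal u hu)

theorem scR_mem (hI : IsPreNicholsIdeal S I) (w : List (Fin θ)) {u : TV θ} (hu : u ∈ I) :
    scR q (degW θ w) u ∈ I := by
  induction w with
  | nil => rwa [degW_nil, scR_zero]
  | cons k w ih =>
    have h := hI.der_mem k (hI.mul_right (gen θ k) _ ih)
    rw [S.der_mul, S.der_gen, if_pos rfl, mul_one] at h
    rw [degW_cons, scR_add]
    exact (I.add_mem_iff_right (hI.mul_right _ _ (hI.der_mem k ih))).1 h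

theorem scL_mem (hI : IsPreNicholsIdeal S I) (w : List (Fin θ)) {u : TV θ} (hu : u ∈ I) :
    scL q (degW θ w) u ∈ I := by
  induction w with
  | nil => rwa [degW_nil, scL_zero]
  | cons k w ih =>
    have h := hI.derR_mem k (hI.mul_left (gen θ k) _ ih)
    rw [S.derR_mul, S.derR_gen, if_pos rfl, one_mul] at h
    rw [degW_cons, scL_add]
    exact (I.add_mem_iff_left (hI.mul_left _ _ (hI.derR_mem k ih))).1 h

theorem mulB_mem_left (hI : IsPreNicholsIdeal S I) {s : TV θ ⊗[ℂ] TV θ} (hs : s ∈ mixedSub I)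
    (t : TV θ ⊗[ℂ] TV θ) :
    S.mulB s t ∈ mixedSub I := by
  induction t using TV.tensor_induction with
  | add x y hx hy => rw [map_add]; exact Submodule.add_mem _ hx hy
  | smul c x hx => rw [map_smul]; exact Submodule.smul_mem _ _ hx
  | word c d =>
  induction hs using Submodule.span_induction with
  | mem x hx =>
    rcases hx with ⟨a, b, ha, rfl⟩ | ⟨a, b, hb, rfl⟩ <;> rw [S.mulB_tmul_word]
    · exact tmul_mem_mixedSub_left (hI.mul_right _ _ ha) _
    · exact tmul_mem_mixedSub_right (hI.mul_right _ _ (hI.scR_mem _ hb)) _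
  | zero => simp
  | add x y _ _ hx hy => rw [map_add, LinearMap.add_apply]; exact Submodule.add_mem _ hx hy
  | smul c x _ hx => rw [map_smul, LinearMap.smul_apply]; exact Submodule.smul_mem _ _ hx

theorem mulB_mem_right (hI : IsPreNicholsIdeal S I) {s : TV θ ⊗[ℂ] TV θ} (hs : s ∈ mixedSub I)
    (t : TV θ ⊗[ℂ] TV θ) :
    S.mulB t s ∈ mixedSub I := by
  induction t using TV.tensor_induction with
  | add x y hx hy => rw [map_add, LinearMap.add_apply]; exact Submodule.add_mem _ hx hy
  | smul c x hx => rw [map_smul, LinearMap.smul_apply]; exact Submodule.smul_mem _ _ hx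
  | word a b =>
  induction hs using Submodule.span_induction with
  | mem x hx =>
    rcases hx with ⟨c, d, hc, rfl⟩ | ⟨c, d, hd, rfl⟩ <;> rw [S.mulB_word_tmul]
    · exact tmul_mem_mixedSub_left (hI.mul_left _ _ (hI.scL_mem _ hc)) _
    · exact tmul_mem_mixedSub_right (hI.mul_left _ _ hd) _
  | zero => simp
  | add x y _ _ hx hy => rw [map_add]; exact Submodule.add_mem _ hx hy
  | smul c x _ hx => rw [map_smul]; exact Submodule.smul_mem _ _ hx

end IsPreNicholsIdeal

end Ideals

section IteratedDerivations
variable {θ : ℕ} {q : Fin θ → Fin θ → ℂˣ} (S : BraidedStr θ q)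

theorem gen_mul_mem_homogTot (i : Fin θ) {n : ℕ} {u : TV θ} (hu : u ∈ homogTot θ n) :
    gen θ i * u ∈ homogTot θ (n + 1) := by
  induction hu using Submodule.span_induction with
  | mem x hx =>
    obtain ⟨w, rfl, rfl⟩ := hx
    exact Submodule.subset_span ⟨i :: w, rfl, (wordElem_cons i w).symm⟩
  | zero => simp
  | add x y _ _ hx hy => rw [mul_add]; exact Submodule.add_mem _ hx hy
  | smul c x _ hx => rw [mul_smul_comm]; exact Submodule.smul_mem _ _ hx

theorem wordElem_mem_homogTot (w : List (Fin θ)) : wordElem θ w ∈ homogTot θ w.length :=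
  Submodule.subset_span ⟨w, rfl, rfl⟩

theorem BraidedStr.der_gen_mul (k i : Fin θ) (u : TV θ) :
    S.der k (gen θ i * u) = (if i = k then u else 0) + (q i k : ℂ) • (gen θ i * S.der k u) := by
  rw [S.der_mul, S.der_gen, scR_gen, qf_delta, ite_mul, one_mul, zero_mul, smul_mul_assoc]

theorem BraidedStr.der_word_mem (k : Fin θ) (w : List (Fin θ)) :
    S.der k (wordElem θ w) ∈ homogTot θ (w.length - 1) := by
  induction w with
  | nil => simp [S.der_one]
  | cons i w ih =>
    rw [wordElem_cons, S.der_gen_mul]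
    refine Submodule.add_mem _ ?_ (Submodule.smul_mem _ _ ?_)
    · split_ifs
      exacts [wordElem_mem_homogTot w, Submodule.zero_mem _]
    · rcases w with _ | ⟨l, w⟩
      · simp [S.der_one]
      · exact gen_mul_mem_homogTot i ih

theorem BraidedStr.der_mem_homogTot (k : Fin θ) {n : ℕ} {u : TV θ} (hu : u ∈ homogTot θ n) :
    S.der k u ∈ homogTot θ (n - 1) := by
  induction hu using Submodule.span_induction with
  | mem x hx => obtain ⟨w, rfl, rfl⟩ := hx; exact S.der_word_mem k w
  | zero => simp
  | add x y _ _ hx hy => rw [map_add]; exact Submodule.add_mem _ hx hy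
  | smul c x _ hx => rw [map_smul]; exact Submodule.smul_mem _ _ hx

theorem BraidedStr.der_scR (k : Fin θ) (d : Fin θ → ℕ) (u : TV θ) :
    S.der k (scR q d u) = qf q (δ θ k) d • scR q d (S.der k u) := by
  induction u using TV.word_induction with
  | add x y hx hy => simp only [map_add, hx, hy, smul_add]
  | smul c x hx => simp only [map_smul, hx]; rw [smul_comm]
  | word w =>
    induction w with
    | nil => simp [S.der_one]
    | cons i w ih =>
      rw [wordElem_cons, map_mul, scR_gen, smul_mul_assoc, map_smul, S.der_gen_mul, S.der_gen_mul,
        ih, map_add, map_smul, map_mul, scR_gen]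
      split_ifs with h
      · subst h; simp only [smul_add, smul_smul, mul_smul_comm, smul_mul_assoc]
      · simp only [map_zero, zero_add, smul_smul, mul_smul_comm, smul_mul_assoc]
        congr 1; ring

theorem BraidedStr.der_scL (k : Fin θ) (d : Fin θ → ℕ) (u : TV θ) :
    S.der k (scL q d u) = qf q d (δ θ k) • scL q d (S.der k u) := by
  induction u using TV.word_induction with
  | add x y hx hy => simp only [map_add, hx, hy, smul_add]
  | smul c x hx => simp only [map_smul, hx]; rw [smul_comm]
  | word w =>
    induction w with
    | nil => simp [S.der_one]
    | cons i w ih =>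
      rw [wordElem_cons, map_mul, scL_gen, smul_mul_assoc, map_smul, S.der_gen_mul, S.der_gen_mul,
        ih, map_add, map_smul, map_mul, scL_gen]
      split_ifs with h
      · subst h; simp only [smul_add, smul_smul, mul_smul_comm, smul_mul_assoc]
      · simp only [map_zero, zero_add, smul_smul, mul_smul_comm, smul_mul_assoc]
        congr 1; ring

/-- The functional `ε ∂_{k_n} ⋯ ∂_{k_1}` attached to a word `k_1 ⋯ k_n`. -/
def BraidedStr.derWord : List (Fin θ) → TV θ →ₗ[ℂ] ℂ
  | [] => coef []
  | k :: w => derWord w ∘ₗ S.der k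

theorem BraidedStr.derWord_homogTot {w : List (Fin θ)} {n : ℕ} {u : TV θ}
    (hu : u ∈ homogTot θ n) (hn : w.length ≠ n) : S.derWord w u = 0 := by
  induction w generalizing u n with
  | nil => exact coef_homogTot hu hn
  | cons k w ih =>
    rcases n with _ | n
    · have h : S.der k u = 0 := by
        induction hu using Submodule.span_induction with
        | mem x hx =>
          obtain ⟨v, hv, rfl⟩ := hx
          rw [List.length_eq_zero_iff.1 hv, wordElem_nil, S.der_one]
        | zero => simp
        | add x y _ _ hx hy => rw [map_add, hx, hy, add_zero]
        | smul c x _ hx => rw [map_smul, hx, smul_zero]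
      rw [BraidedStr.derWord, LinearMap.comp_apply, h, map_zero]
    · exact ih (S.der_mem_homogTot k hu) (by simp at hn ⊢; exact hn)

theorem coef_nil_conL (f : TV θ →ₗ[ℂ] ℂ) (t : TV θ ⊗[ℂ] TV θ) :
    coef [] (conL f t) = f (conR (coef []) t) := by
  induction t using TensorProduct.induction_on with
  | zero => simp
  | add x y hx hy => simp only [map_add, hx, hy]
  | tmul a b => simp [mul_comm]

theorem BraidedStr.derWord_singleton (k : Fin θ) (u : TV θ) : S.derWord [k] u = coef [k] u := by
  rw [BraidedStr.derWord, LinearMap.comp_apply, BraidedStr.derWord, BraidedStr.der,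
    LinearMap.comp_apply, coef_nil_conL, S.conR_counit]

/-- The common kernel of the iterated skew derivations. -/
def BraidedStr.derKer : Submodule ℂ (TV θ) := ⨅ w, LinearMap.ker (S.derWord w)

variable {S}

theorem mem_derKer {u : TV θ} : u ∈ S.derKer ↔ ∀ w, S.derWord w u = 0 := by
  simp [BraidedStr.derKer]

theorem der_mem_derKer {u : TV θ} (hu : u ∈ S.derKer) (k : Fin θ) : S.der k u ∈ S.derKer :=
  mem_derKer.2 fun w => mem_derKer.1 hu (k :: w)

theorem coef_nil_scR (d : Fin θ → ℕ) (u : TV θ) : coef [] (scR q d u) = coef [] u := by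
  induction u using TV.word_induction with
  | add x y hx hy => simp only [map_add, hx, hy]
  | smul c x hx => simp only [map_smul, hx]
  | word w =>
    rw [scR_word, map_smul, coef_word]
    split_ifs with h
    · simp [h, degW_nil, qf_zero_left]
    · simp

theorem scR_mem_derKer {u : TV θ} (hu : u ∈ S.derKer) (d : Fin θ → ℕ) :
    scR q d u ∈ S.derKer := by
  refine mem_derKer.2 fun w => ?_
  induction w generalizing u with
  | nil =>
    rw [BraidedStr.derWord, coef_nil_scR]
    exact mem_derKer.1 hu []
  | cons k w ih =>
    rw [BraidedStr.derWord, LinearMap.comp_apply, S.der_scR, map_smul,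
      ih (der_mem_derKer hu k), smul_zero]

theorem mul_right_mem_derKer (v : TV θ) {u : TV θ} (hu : u ∈ S.derKer) : u * v ∈ S.derKer := by
  refine mem_derKer.2 fun w => ?_
  induction w generalizing u v with
  | nil =>
    have h : coef [] u = 0 := mem_derKer.1 hu []
    rw [BraidedStr.derWord, coef_nil_mul, h, zero_mul]
  | cons k w ih =>
    rw [BraidedStr.derWord, LinearMap.comp_apply, S.der_mul, map_add,
      ih _ (der_mem_derKer hu k), ih _ (scR_mem_derKer hu _), add_zero]

theorem mul_left_mem_derKer (v : TV θ) {u : TV θ} (hu : u ∈ S.derKer) : v * u ∈ S.derKer := by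
  refine mem_derKer.2 fun w => ?_
  induction w generalizing u v with
  | nil =>
    have h : coef [] u = 0 := mem_derKer.1 hu []
    rw [BraidedStr.derWord, coef_nil_mul, h, mul_zero]
  | cons k w ih =>
    rw [BraidedStr.derWord, LinearMap.comp_apply, S.der_mul, map_add,
      ih _ hu, ih _ (der_mem_derKer hu k), add_zero]

theorem exists_sum_prTot (u : TV θ) : ∃ N, ∀ n, N ≤ n → ∑ m ∈ Finset.range n, prTot m u = u := by
  induction u using TV.word_induction with
  | word w =>
    refine ⟨w.length + 1, fun n hn => ?_⟩
    simp only [prTot_word]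
    rw [Finset.sum_ite_eq, if_pos (Finset.mem_range.2 hn)]
  | add u v hu hv =>
    obtain ⟨M, hM⟩ := hu
    obtain ⟨N, hN⟩ := hv
    refine ⟨max M N, fun n hn => ?_⟩
    simp only [map_add, Finset.sum_add_distrib]
    rw [hM n (le_trans (le_max_left _ _) hn), hN n (le_trans (le_max_right _ _) hn)]
  | smul c u hu =>
    obtain ⟨M, hM⟩ := hu
    refine ⟨M, fun n hn => ?_⟩
    simp only [map_smul, ← Finset.smul_sum]
    rw [hM n hn]

theorem prTot_mem_homogTot (m : ℕ) (u : TV θ) : prTot m u ∈ homogTot θ m := by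
  induction u using TV.word_induction with
  | word w =>
    rw [prTot_word]
    split_ifs with h
    · rw [← h]; exact wordElem_mem_homogTot w
    · exact Submodule.zero_mem _
  | add u v hu hv => rw [map_add]; exact Submodule.add_mem _ hu hv
  | smul c u hu => rw [map_smul]; exact Submodule.smul_mem _ _ hu

theorem derWord_prTot (w : List (Fin θ)) (m : ℕ) (u : TV θ) :
    S.derWord w (prTot m u) = if w.length = m then S.derWord w u else 0 := by
  induction u using TV.word_induction with
  | word v =>
    rw [prTot_word]
    by_cases hw : w.length = v.length
    · rw [hw]; split_ifs <;> simp
    · rw [S.derWord_homogTot (wordElem_mem_homogTot v) hw, ite_self]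
      split_ifs
      · exact S.derWord_homogTot (wordElem_mem_homogTot v) hw
      · simp
  | add u v hu hv => rw [map_add, map_add, map_add, hu, hv]; split_ifs <;> simp
  | smul c u hu => rw [map_smul, map_smul, map_smul, hu]; split_ifs <;> simp

theorem prTot_mem_derKer (m : ℕ) {u : TV θ} (hu : u ∈ S.derKer) : prTot m u ∈ S.derKer :=
  mem_derKer.2 fun w => by rw [derWord_prTot, mem_derKer.1 hu, ite_self]

theorem eq_zero_of_mem_derKer {m : ℕ} (hm : m < 2) {u : TV θ} (hu : u ∈ S.derKer)
    (h : u ∈ homogTot θ m) : u = 0 := by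
  refine (wordBasis θ).ext_elem fun w => ?_
  change coef w u = coef w 0
  rw [map_zero]
  by_cases hw : w.length = m
  · rcases w with _ | ⟨k, _ | ⟨l, w⟩⟩
    · exact mem_derKer.1 hu []
    · rw [← S.derWord_singleton]; exact mem_derKer.1 hu [k]
    · simp at hw; omega
  · exact coef_homogTot h hw

theorem derKer_eq_span :
    S.derKer = Submodule.span ℂ {x | x ∈ S.derKer ∧ ∃ n, 2 ≤ n ∧ x ∈ homogTot θ n} := by
  refine le_antisymm (fun u hu => ?_) (Submodule.span_le.2 fun x hx => hx.1)
  obtain ⟨N, hN⟩ := exists_sum_prTot u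
  rw [← hN N le_rfl]
  refine Submodule.sum_mem _ fun m _ => ?_
  by_cases hm : m < 2
  · rw [eq_zero_of_mem_derKer hm (prTot_mem_derKer m hu) (prTot_mem_homogTot m u)]
    exact Submodule.zero_mem _
  · exact Submodule.subset_span
      ⟨prTot_mem_derKer m hu, m, not_lt.1 hm, prTot_mem_homogTot m u⟩

variable (S) in
theorem BraidedStr.mulB_Δ_gen (i : Fin θ) (c d : TV θ) :
    S.mulB (S.Δ (gen θ i)) (c ⊗ₜ d)
      = (gen θ i * c) ⊗ₜ d + scL q (δ θ i) c ⊗ₜ (gen θ i * d) := by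
  rw [S.Δ_gen, map_add, LinearMap.add_apply, S.mulB_one_tmul,
    S.mulB_homogD_tmul (gen_mem_homogD i), one_mul]

theorem rTensor_der_mulB (k i : Fin θ) (t : TV θ ⊗[ℂ] TV θ) :
    (S.der k).rTensor (TV θ) (S.mulB (S.Δ (gen θ i)) t)
      = (if i = k then t else 0)
        + (q i k : ℂ) • S.mulB (S.Δ (gen θ i)) ((S.der k).rTensor (TV θ) t) := by
  induction t using TensorProduct.induction_on with
  | zero => simp
  | add x y hx hy =>
    simp only [map_add, hx, hy, smul_add]
    split_ifs
    · abel
    · simp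
  | tmul c d =>
    simp only [S.mulB_Δ_gen, map_add, LinearMap.rTensor_tmul, S.der_gen_mul, S.der_scL, qf_delta,
      TensorProduct.add_tmul, ← TensorProduct.smul_tmul', smul_add]
    split_ifs
    · abel
    · simp

theorem rTensor_der_Δ (k : Fin θ) (u : TV θ) :
    (S.der k).rTensor (TV θ) (S.Δ u) = S.Δ (S.der k u) := by
  induction u using TV.word_induction with
  | add x y hx hy => simp only [map_add, hx, hy]
  | smul c x hx => simp only [map_smul, hx]
  | word w =>
    induction w with
    | nil => simp [S.der_one, S.Δ_one]
    | cons i w ih =>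
      rw [wordElem_cons, S.Δ_mul, rTensor_der_mulB, ih, S.der_gen_mul, map_add, map_smul, S.Δ_mul,
        apply_ite S.Δ, map_zero]

/-- The value of a pair of functionals on a tensor. -/
def pairTensor {M N : Type*} [AddCommGroup M] [Module ℂ M] [AddCommGroup N] [Module ℂ N]
    (f : M →ₗ[ℂ] ℂ) (g : N →ₗ[ℂ] ℂ) : M ⊗[ℂ] N →ₗ[ℂ] ℂ :=
  LinearMap.mul' ℂ ℂ ∘ₗ TensorProduct.map f g

@[simp] theorem pairTensor_tmul {M N : Type*} [AddCommGroup M] [Module ℂ M] [AddCommGroup N]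
    [Module ℂ N] (f : M →ₗ[ℂ] ℂ) (g : N →ₗ[ℂ] ℂ) (a : M) (b : N) :
    pairTensor f g (a ⊗ₜ b) = f a * g b := by simp [pairTensor]

theorem pairTensor_derWord (v w : List (Fin θ)) (u : TV θ) :
    pairTensor (S.derWord v) (S.derWord w) (S.Δ u) = S.derWord (v ++ w) u := by
  induction v generalizing u with
  | nil =>
    have h : ∀ t : TV θ ⊗[ℂ] TV θ, pairTensor (S.derWord []) (S.derWord w) t
        = S.derWord w (conL (coef []) t) := by
      intro t
      induction t using TensorProduct.induction_on with
      | zero => simp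
      | add x y hx hy => simp only [map_add, hx, hy]
      | tmul a b => simp [BraidedStr.derWord]
    rw [h, S.conL_counit, List.nil_append]
  | cons k v ih =>
    have h : ∀ t : TV θ ⊗[ℂ] TV θ, pairTensor (S.derWord (k :: v)) (S.derWord w) t
        = pairTensor (S.derWord v) (S.derWord w) ((S.der k).rTensor (TV θ) t) := by
      intro t
      induction t using TensorProduct.induction_on with
      | zero => simp
      | add x y hx hy => simp only [map_add, hx, hy]
      | tmul a b => simp [BraidedStr.derWord]
    rw [h, rTensor_der_Δ, ih, List.cons_append, BraidedStr.derWord, LinearMap.comp_apply]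

end IteratedDerivations

section Separation

/-- Separating families of functionals separate tensors. -/
theorem eq_zero_of_pairTensor {M N ι κ : Type*} [AddCommGroup M] [Module ℂ M] [AddCommGroup N]
    [Module ℂ N] {f : ι → M →ₗ[ℂ] ℂ} {g : κ → N →ₗ[ℂ] ℂ} (hf : ∀ a, (∀ i, f i a = 0) → a = 0)
    (hg : ∀ b, (∀ i, g i b = 0) → b = 0) {t : M ⊗[ℂ] N}
    (ht : ∀ i j, pairTensor (f i) (g j) t = 0) : t = 0 := by
  have hfg : ∀ i j (t : M ⊗[ℂ] N), pairTensor (f i) (g j) t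
      = g j (TensorProduct.lid ℂ N ((f i).rTensor N t)) := by
    intro i j t
    induction t using TensorProduct.induction_on with
    | zero => simp
    | add x y hx hy => simp only [map_add, hx, hy]
    | tmul a b => simp
  classical
  let B := Module.Basis.ofVectorSpace ℂ N
  have hB : ∀ i (t : M ⊗[ℂ] N) k, B.repr (TensorProduct.lid ℂ N ((f i).rTensor N t)) k
      = f i (TensorProduct.equivFinsuppOfBasisRight B t k) := by
    intro i t k
    induction t using TensorProduct.induction_on with
    | zero => simp
    | add x y hx hy => simp only [map_add, Finsupp.add_apply, hx, hy]
    | tmul a b => simp [mul_comm]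
  apply (TensorProduct.equivFinsuppOfBasisRight (M := M) B).injective
  rw [map_zero]
  ext k
  refine hf _ fun i => ?_
  rw [← hB, hg _ fun j => (hfg i j t).symm.trans (ht i j)]
  simp

variable {θ : ℕ} {q : Fin θ → Fin θ → ℂˣ} {S : BraidedStr θ q}

theorem mem_mixedSub_of_map_mkQ {I : Submodule ℂ (TV θ)} {t : TV θ ⊗[ℂ] TV θ}
    (ht : TensorProduct.map I.mkQ I.mkQ t = 0) : t ∈ mixedSub I := by
  have h : t ∈ LinearMap.ker (TensorProduct.map I.mkQ I.mkQ) := ht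
  rw [TensorProduct.map_ker (f := I.subtype) (f' := I.subtype) (LinearMap.exact_subtype_mkQ I)
    I.mkQ_surjective (LinearMap.exact_subtype_mkQ I) I.mkQ_surjective] at h
  refine (sup_le ?_ ?_ : _ ≤ mixedSub I) h
  · rintro _ ⟨s, rfl⟩
    induction s using TensorProduct.induction_on with
    | zero => simp
    | add x y hx hy => rw [map_add]; exact Submodule.add_mem _ hx hy
    | tmul a b => exact tmul_mem_mixedSub_right b.2 a
  · rintro _ ⟨s, rfl⟩
    induction s using TensorProduct.induction_on with
    | zero => simp
    | add x y hx hy => rw [map_add]; exact Submodule.add_mem _ hx hy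
    | tmul a b => exact tmul_mem_mixedSub_left a.2 b

theorem Δ_mem_mixedSub_derKer {u : TV θ} (hu : u ∈ S.derKer) : S.Δ u ∈ mixedSub S.derKer := by
  apply mem_mixedSub_of_map_mkQ
  have hle : ∀ w, S.derKer ≤ LinearMap.ker (S.derWord w) := fun w => iInf_le _ w
  have hsep : ∀ a : TV θ ⧸ S.derKer, (∀ w, S.derKer.liftQ (S.derWord w) (hle w) a = 0) → a = 0 := by
    intro a ha
    obtain ⟨a, rfl⟩ := S.derKer.mkQ_surjective a
    simp only [Submodule.mkQ_apply, Submodule.liftQ_apply] at ha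
    simpa using mem_derKer.2 ha
  refine eq_zero_of_pairTensor hsep hsep fun v w => ?_
  rw [pairTensor, ← LinearMap.comp_apply, LinearMap.comp_assoc, ← TensorProduct.map_comp,
    Submodule.liftQ_mkQ, Submodule.liftQ_mkQ]
  exact (pairTensor_derWord v w u).trans (mem_derKer.1 hu _)

theorem isPreNicholsIdeal_derKer : IsPreNicholsIdeal S S.derKer where
  mul_left a _ hx := mul_left_mem_derKer a hx
  mul_right a _ hx := mul_right_mem_derKer a hx
  homog_ge2 := derKer_eq_span
  coideal _ hx := Δ_mem_mixedSub_derKer hx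

theorem derKer_le_Jq : S.derKer ≤ Jq S := le_sSup isPreNicholsIdeal_derKer

end Separation

section Filtration
variable {θ : ℕ} {q : Fin θ → Fin θ → ℂˣ} (S : BraidedStr θ q)

theorem wordElem_mem_Wfil {w : List (Fin θ)} {n : ℕ} (hw : w.length ≤ n) :
    wordElem θ w ∈ Wfil θ n := Submodule.subset_span ⟨w, hw, rfl⟩

theorem homogTot_le_Wfil (n : ℕ) : homogTot θ n ≤ Wfil θ n :=
  Submodule.span_mono fun _ ⟨w, hw, hx⟩ => ⟨w, hw.le, hx⟩

theorem Wfil_mono {m n : ℕ} (h : m ≤ n) : Wfil θ m ≤ Wfil θ n :=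
  Submodule.span_mono fun _ ⟨w, hw, hx⟩ => ⟨w, hw.trans h, hx⟩

theorem mul_mem_Wfil {m n : ℕ} {u v : TV θ} (hu : u ∈ Wfil θ m) (hv : v ∈ Wfil θ n) :
    u * v ∈ Wfil θ (m + n) := by
  have h := Submodule.mul_mem_mul hu hv
  rw [Wfil, Wfil, Submodule.span_mul_span] at h
  refine Submodule.span_mono ?_ h
  rintro _ ⟨_, ⟨v, hv, rfl⟩, _, ⟨w, hw, rfl⟩, rfl⟩
  exact ⟨v ++ w, by simp; omega, (wordElem_append v w).symm⟩

instance (n : ℕ) : FiniteDimensional ℂ (Wfil θ n) := by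
  refine FiniteDimensional.span_of_finite ℂ
    (((List.finite_length_le (Fin θ) n).image (wordElem θ)).subset ?_)
  rintro x ⟨w, hw, rfl⟩
  exact ⟨w, hw, rfl⟩

instance (n : ℕ) : FiniteDimensional ℂ (homogTot θ n) :=
  Submodule.finiteDimensional_of_le (homogTot_le_Wfil n)

theorem Wfil_zero_le : Wfil θ 0 ≤ homogTot θ 0 :=
  Submodule.span_mono fun _ ⟨w, hw, hx⟩ => ⟨w, Nat.le_zero.1 hw, hx⟩

theorem Wfil_succ_le (n : ℕ) : Wfil θ (n + 1) ≤ Wfil θ n ⊔ homogTot θ (n + 1) := by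
  refine Submodule.span_le.2 ?_
  rintro x ⟨w, hw, rfl⟩
  rcases Nat.lt_or_ge w.length (n + 1) with h | h
  · exact Submodule.mem_sup_left (wordElem_mem_Wfil (by omega))
  · refine Submodule.mem_sup_right ?_
    rw [← le_antisymm hw h]
    exact wordElem_mem_homogTot w

/-- The tensors of total degree `n`. -/
def homogTensor (θ n : ℕ) : Submodule ℂ (TV θ ⊗[ℂ] TV θ) :=
  Submodule.span ℂ {t | ∃ a b : List (Fin θ), a.length + b.length = n ∧
    t = wordElem θ a ⊗ₜ[ℂ] wordElem θ b}

theorem BraidedStr.mulB_Δ_gen_mem (i : Fin θ) {n : ℕ} {t : TV θ ⊗[ℂ] TV θ}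
    (ht : t ∈ homogTensor θ n) : S.mulB (S.Δ (gen θ i)) t ∈ homogTensor θ (n + 1) := by
  induction ht using Submodule.span_induction with
  | mem x hx =>
    obtain ⟨a, b, hab, rfl⟩ := hx
    rw [S.mulB_Δ_gen, scL_word, ← TensorProduct.smul_tmul', ← wordElem_cons, ← wordElem_cons]
    refine Submodule.add_mem _ (Submodule.subset_span ⟨_, _, ?_, rfl⟩)
      (Submodule.smul_mem _ _ (Submodule.subset_span ⟨_, _, ?_, rfl⟩)) <;>
    · simp; omega
  | zero => simp
  | add x y _ _ hx hy => rw [map_add]; exact Submodule.add_mem _ hx hy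
  | smul c x _ hx => rw [map_smul]; exact Submodule.smul_mem _ _ hx

theorem BraidedStr.Δ_word_mem (w : List (Fin θ)) :
    S.Δ (wordElem θ w) ∈ homogTensor θ w.length := by
  induction w with
  | nil => rw [wordElem_nil, S.Δ_one]; exact Submodule.subset_span ⟨[], [], rfl, rfl⟩
  | cons i w ih => rw [wordElem_cons, S.Δ_mul]; exact S.mulB_Δ_gen_mem i ih

theorem conL_homogTensor {f : TV θ →ₗ[ℂ] ℂ} {m : ℕ}
    (hf : ∀ w : List (Fin θ), w.length < m → f (wordElem θ w) = 0) {W : Submodule ℂ (TV θ)} {n : ℕ}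
    (hW : ∀ w : List (Fin θ), w.length + m ≤ n → wordElem θ w ∈ W) {t : TV θ ⊗[ℂ] TV θ}
    (ht : t ∈ homogTensor θ n) : conL f t ∈ W := by
  induction ht using Submodule.span_induction with
  | mem x hx =>
    obtain ⟨a, b, hab, rfl⟩ := hx
    rw [conL_tmul]
    rcases Nat.lt_or_ge a.length m with h | h
    · rw [hf a h, zero_smul]; exact W.zero_mem
    · exact W.smul_mem _ (hW b (by omega))
  | zero => simp
  | add x y _ _ hx hy => rw [map_add]; exact Submodule.add_mem _ hx hy
  | smul c x _ hx => rw [map_smul]; exact Submodule.smul_mem _ _ hx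

theorem BraidedStr.conL_Δ_mem {f : TV θ →ₗ[ℂ] ℂ} {m : ℕ}
    (hf : ∀ w : List (Fin θ), w.length < m → f (wordElem θ w) = 0) {W : Submodule ℂ (TV θ)} {n : ℕ}
    (hW : ∀ w : List (Fin θ), w.length + m ≤ n → wordElem θ w ∈ W) {u : TV θ}
    (hu : u ∈ Wfil θ n) : conL f (S.Δ u) ∈ W := by
  induction hu using Submodule.span_induction with
  | mem x hx =>
    obtain ⟨w, hw, rfl⟩ := hx
    exact conL_homogTensor hf (fun v hv => hW v (hv.trans hw)) (S.Δ_word_mem w)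
  | zero => simp
  | add x y _ _ hx hy => rw [map_add, map_add]; exact Submodule.add_mem _ hx hy
  | smul c x _ hx => rw [map_smul, map_smul]; exact Submodule.smul_mem _ _ hx

end Filtration

section PrimitiveFamilies

/-- A family of homogeneous elements of `T(V)` whose classes in `T(V)/I` are primitive, together
with functionals on the quotient dual to it. -/
structure PrimFamily {θ : ℕ} {q : Fin θ → Fin θ → ℂˣ} (S : BraidedStr θ q)
    (I : Submodule ℂ (TV θ)) {r : ℕ} (d : Fin r → Fin θ → ℕ) (y : Fin r → TV θ)
    (f : Fin r → TV θ →ₗ[ℂ] ℂ) : Prop where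
  homog : ∀ a, y a ∈ homogD θ (d a)
  prim : ∀ a, S.Δ (y a) - (y a ⊗ₜ 1 + 1 ⊗ₜ y a) ∈ mixedSub I
  map_ideal : ∀ a, ∀ u ∈ I, f a u = 0
  map_one : ∀ a, f a 1 = 0
  dual : ∀ a b, f a (y b) = if b = a then 1 else 0

variable {θ r : ℕ} {q : Fin θ → Fin θ → ℂˣ}

/-- The braiding matrix of a family of homogeneous elements of the given degrees. -/
def famMatrix (q : Fin θ → Fin θ → ℂˣ) (d : Fin r → Fin θ → ℕ) : Fin r → Fin r → ℂˣ :=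
  fun a b => Units.mk0 (qf q (d a) (d b)) (qf_ne_zero q _ _)

/-- The algebra map from the tensor algebra of the span of a family. -/
def famMap (y : Fin r → TV θ) : TV r →ₐ[ℂ] TV θ := FreeAlgebra.lift ℂ y

theorem famMap_gen (y : Fin r → TV θ) (a : Fin r) : famMap y (gen r a) = y a := by
  simp [famMap, gen]

namespace PrimFamily
variable {S : BraidedStr θ q} {I : Submodule ℂ (TV θ)} {d : Fin r → Fin θ → ℕ}
  {y : Fin r → TV θ} {f : Fin r → TV θ →ₗ[ℂ] ℂ}

theorem scL_famMap (h : PrimFamily S I d y f) (a : Fin r) (u : TV r) :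
    scL q (d a) (famMap y u) = famMap y (scL (famMatrix q d) (δ r a) u) := by
  have : (scL q (d a)).comp (famMap y) = (famMap y).comp (scL (famMatrix q d) (δ r a)) := by
    refine FreeAlgebra.hom_ext (funext fun b => ?_)
    change scL q (d a) (famMap y (gen r b)) = famMap y (scL (famMatrix q d) (δ r a) (gen r b))
    rw [scL_gen, map_smul, famMap_gen, scL_homogD q (h.homog b), qf_delta]
    rfl
  exact DFunLike.congr_fun this u

variable (y) in
/-- The map induced by `famMap` on tensor squares. -/
def map₂ : TV r ⊗[ℂ] TV r →ₗ[ℂ] TV θ ⊗[ℂ] TV θ :=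
  TensorProduct.map (famMap y).toLinearMap (famMap y).toLinearMap

theorem map₂_mulB (h : PrimFamily S I d y f) (S' : BraidedStr r (famMatrix q d)) (a : Fin r)
    (t : TV r ⊗[ℂ] TV r) :
    map₂ y (S'.mulB (S'.Δ (gen r a)) t) = S.mulB (y a ⊗ₜ 1 + 1 ⊗ₜ y a) (map₂ y t) := by
  induction t using TensorProduct.induction_on with
  | zero => simp
  | add s t hs ht => simp only [map_add, hs, ht]
  | tmul c e =>
    rw [S'.mulB_Δ_gen]
    simp only [map₂, map_add, TensorProduct.map_tmul, AlgHom.toLinearMap_apply,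
      LinearMap.add_apply, S.mulB_one_tmul, S.mulB_homogD_tmul (h.homog a), map_mul, famMap_gen,
      h.scL_famMap, one_mul]

theorem Δ_famMap (hI : IsPreNicholsIdeal S I) (h : PrimFamily S I d y f)
    (S' : BraidedStr r (famMatrix q d)) (u : TV r) :
    S.Δ (famMap y u) - map₂ y (S'.Δ u) ∈ mixedSub I := by
  induction u using TV.word_induction with
  | add u v hu hv =>
    simp only [map_add, add_sub_add_comm]
    exact Submodule.add_mem _ hu hv
  | smul c u hu =>
    have := Submodule.smul_mem _ c hu
    rw [smul_sub] at this
    simpa only [map_smul] using this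
  | word w =>
    induction w with
    | nil => simp [S.Δ_one, S'.Δ_one, map₂]
    | cons a w ih =>
      rw [wordElem_cons, map_mul, famMap_gen, S.Δ_mul, S'.Δ_mul, h.map₂_mulB]
      have h₁ := hI.mulB_mem_left (h.prim a) (S.Δ (famMap y (wordElem r w)))
      have h₂ := hI.mulB_mem_right ih (y a ⊗ₜ 1 + 1 ⊗ₜ y a)
      rw [map_sub, LinearMap.sub_apply] at h₁
      rw [map_sub] at h₂
      simpa using Submodule.add_mem _ h₁ h₂

theorem famMap_conL_mem (hI : IsPreNicholsIdeal S I) (h : PrimFamily S I d y f)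
    (S' : BraidedStr r (famMatrix q d)) (k : Fin r) {u : TV r} (hu : famMap y u ∈ I) :
    famMap y (conL (f k ∘ₗ (famMap y).toLinearMap) (S'.Δ u)) ∈ I := by
  have h' : ∀ t, famMap y (conL (f k ∘ₗ (famMap y).toLinearMap) t) = conL (f k) (map₂ y t) := by
    intro t
    induction t using TensorProduct.induction_on with
    | zero => simp
    | add s t hs ht => simp only [map_add, hs, ht]
    | tmul c e => simp [map₂]
  rw [h']
  have h₁ := conL_mem_of_mixedSub (h.map_ideal k) (hI.coideal _ hu)
  have h₂ := conL_mem_of_mixedSub (h.map_ideal k) (h.Δ_famMap hI S' u)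
  rw [map_sub] at h₂
  simpa using I.sub_mem h₁ h₂

theorem derWord_eq_zero (hI : IsPreNicholsIdeal S I) (h : PrimFamily S I d y f)
    (S' : BraidedStr r (famMatrix q d)) (w : List (Fin r)) {u : TV r} (hu : u ∈ Wfil r w.length)
    (huI : famMap y u ∈ I) : S'.derWord w u = 0 := by
  induction w generalizing u with
  | nil =>
    have h₀ : coef [] (famMap y u) = coef [] u := by
      clear huI
      induction hu using Submodule.span_induction with
      | mem x hx =>
        obtain ⟨w, hw, rfl⟩ := hx
        rw [List.length_eq_zero_iff.1 (Nat.le_zero.1 hw)]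
        simp [coef_one]
      | zero => simp
      | add x y _ _ hx hy => simp only [map_add, hx, hy]
      | smul c x _ hx => simp only [map_smul, hx]
    exact h₀.symm.trans (hI.coef_eq_zero (by simp) huI)
  | cons k w ih =>
    have hf₁ : ∀ v : List (Fin r), v.length < 1 → (f k ∘ₗ (famMap y).toLinearMap) (wordElem r v)
        = 0 := by
      intro v hv
      rw [List.length_eq_zero_iff.1 (Nat.lt_one_iff.1 hv)]
      simp [h.map_one]
    have hf₂ : ∀ v : List (Fin r), v.length < 2 →
        (f k ∘ₗ (famMap y).toLinearMap - coef [k]) (wordElem r v) = 0 := by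
      intro v hv
      rcases v with _ | ⟨a, _ | ⟨b, v⟩⟩
      · simp [h.map_one, coef_one]
      · rw [wordElem_singleton]
        simp [famMap_gen, h.dual, coef_gen]
      · simp at hv
    have h₁ := ih (S'.conL_Δ_mem hf₁ (W := Wfil r w.length) (n := w.length + 1)
      (fun v hv => wordElem_mem_Wfil (by omega)) hu) (h.famMap_conL_mem hI S' k huI)
    have h₂ := S'.conL_Δ_mem hf₂ (W := LinearMap.ker (S'.derWord w)) (n := w.length + 1)
      (fun v hv => S'.derWord_homogTot (wordElem_mem_homogTot v) (by omega)) hu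
    have h₃ : conL (f k ∘ₗ (famMap y).toLinearMap - coef [k]) (S'.Δ u)
        = conL (f k ∘ₗ (famMap y).toLinearMap) (S'.Δ u) - S'.der k u := by
      rw [BraidedStr.der, LinearMap.comp_apply]
      generalize S'.Δ u = t
      induction t using TensorProduct.induction_on with
      | zero => simp
      | add s t hs ht => simp only [map_add, hs, ht]; abel
      | tmul c e => simp [sub_smul]
    rw [LinearMap.mem_ker, h₃, map_sub, h₁, zero_sub, neg_eq_zero] at h₂
    exact h₂

theorem mem_Jq (hI : IsPreNicholsIdeal S I) (h : PrimFamily S I d y f)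
    (S' : BraidedStr r (famMatrix q d)) {n : ℕ} {u : TV r} (hu : u ∈ homogTot r n)
    (huI : famMap y u ∈ I) : u ∈ Jq S' := by
  refine derKer_le_Jq (mem_derKer.2 fun w => ?_)
  by_cases hw : w.length = n
  · refine h.derWord_eq_zero hI S' w ?_ huI
    rw [hw]
    exact homogTot_le_Wfil n hu
  · exact S'.derWord_homogTot hu hw

theorem famMap_mem_Wfil {D : ℕ} (hD : ∀ a, y a ∈ Wfil θ D) {n : ℕ} {u : TV r}
    (hu : u ∈ homogTot r n) : famMap y u ∈ Wfil θ (D * n) := by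
  induction hu using Submodule.span_induction with
  | mem x hx =>
    obtain ⟨w, rfl, rfl⟩ := hx
    induction w with
    | nil => simpa using wordElem_mem_Wfil (w := []) (Nat.zero_le _)
    | cons a w ih =>
      rw [wordElem_cons, map_mul, famMap_gen, List.length_cons, Nat.mul_succ, add_comm]
      exact mul_mem_Wfil (hD a) ih
  | zero => simp
  | add x y _ _ hx hy => rw [map_add]; exact Submodule.add_mem _ hx hy
  | smul c x _ hx => rw [map_smul]; exact Submodule.smul_mem _ _ hx

end PrimFamily

theorem finrank_map_mkQ_le {M N : Type*} [AddCommGroup M] [Module ℂ M] [AddCommGroup N]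
    [Module ℂ N] (φ : M →ₗ[ℂ] N) {U K : Submodule ℂ M} {U' I : Submodule ℂ N}
    [FiniteDimensional ℂ U] [FiniteDimensional ℂ U'] (hU : ∀ u ∈ U, φ u ∈ U')
    (hK : ∀ u ∈ U, φ u ∈ I → u ∈ K) :
    Module.finrank ℂ (U.map K.mkQ) ≤ Module.finrank ℂ (U'.map I.mkQ) := by
  have h₁ := (K.mkQ ∘ₗ U.subtype).finrank_range_add_finrank_ker
  have h₂ := (I.mkQ ∘ₗ φ ∘ₗ U.subtype).finrank_range_add_finrank_ker
  have hker : LinearMap.ker (I.mkQ ∘ₗ φ ∘ₗ U.subtype) ≤ LinearMap.ker (K.mkQ ∘ₗ U.subtype) := by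
    intro u hu
    simp only [LinearMap.mem_ker, LinearMap.comp_apply, Submodule.mkQ_apply,
      Submodule.Quotient.mk_eq_zero] at hu ⊢
    exact hK u u.2 hu
  have hrange : LinearMap.range (I.mkQ ∘ₗ φ ∘ₗ U.subtype) ≤ U'.map I.mkQ := by
    rintro _ ⟨u, rfl⟩
    exact ⟨φ u, hU u u.2, rfl⟩
  have h₃ := Submodule.finrank_mono hker
  have h₄ := Submodule.finrank_mono hrange
  rw [LinearMap.range_comp, Submodule.range_subtype] at h₁
  omega

theorem finrank_Wfil_map_le (K : Submodule ℂ (TV θ)) (n : ℕ) :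
    Module.finrank ℂ ((Wfil θ n).map K.mkQ)
      ≤ ∑ m ∈ Finset.range (n + 1), Module.finrank ℂ ((homogTot θ m).map K.mkQ) := by
  induction n with
  | zero => simpa using Submodule.finrank_mono (Submodule.map_mono Wfil_zero_le)
  | succ n ih =>
    rw [Finset.sum_range_succ]
    have h := Submodule.finrank_mono (Submodule.map_mono (f := K.mkQ) (Wfil_succ_le (θ := θ) n))
    rw [Submodule.map_sup] at h
    exact h.trans ((Submodule.finrank_add_le_finrank_add_finrank _ _).trans (by omega))

theorem PrimFamily.finGK {S : BraidedStr θ q} {I : Submodule ℂ (TV θ)} {d : Fin r → Fin θ → ℕ}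
    {y : Fin r → TV θ} {f : Fin r → TV θ →ₗ[ℂ] ℂ} (hI : IsPreNicholsIdeal S I) (hGK : FinGK I)
    (h : PrimFamily S I d y f) (S' : BraidedStr r (famMatrix q d)) : FinGK (Jq S') := by
  obtain ⟨C, e, hC⟩ := hGK
  set D := ∑ a, ∑ k, d a k
  have hD : ∀ a, y a ∈ Wfil θ D := fun a =>
    Wfil_mono (Finset.single_le_sum (f := fun a => ∑ k, d a k) (fun _ _ => Nat.zero_le _)
      (Finset.mem_univ a)) (homogTot_le_Wfil _ (homogD_le_homogTot _ (h.homog a)))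
  refine ⟨C * (D + 1) ^ e, e + 1, fun n => ?_⟩
  refine (finrank_Wfil_map_le _ n).trans ?_
  have hm : ∀ m ∈ Finset.range (n + 1), Module.finrank ℂ ((homogTot r m).map (Jq S').mkQ)
      ≤ C * ((D + 1) * (n + 1)) ^ e := by
    intro m hm
    refine (finrank_map_mkQ_le (famMap y).toLinearMap (U' := Wfil θ (D * m)) (I := I)
      (fun u hu => PrimFamily.famMap_mem_Wfil hD hu) (fun u hu => h.mem_Jq hI S' hu)).trans ?_
    refine (hC _).trans (Nat.mul_le_mul_left _ (Nat.pow_le_pow_left ?_ _))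
    have : m ≤ n := by simpa [Nat.lt_succ_iff] using hm
    nlinarith
  refine (Finset.sum_le_sum hm).trans (le_of_eq ?_)
  rw [Finset.sum_const, Finset.card_range, smul_eq_mul, mul_pow]
  ring

theorem PrimFamily.boundedGroupoid {S : BraidedStr θ q} {I : Submodule ℂ (TV θ)}
    {d : Fin r → Fin θ → ℕ} {y : Fin r → TV θ} {f : Fin r → TV θ →ₗ[ℂ] ℂ} (hAAH : AAH)
    (hI : IsPreNicholsIdeal S I) (hGK : FinGK I) (h : PrimFamily S I d y f) :
    BoundedGroupoid (famMatrix q d) :=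
  (hAAH r _ (braidedStr _) (h.finGK hI hGK _)).boundedGroupoid

end PrimitiveFamilies

section GaussBinomials

/-- The Gaussian binomial coefficient `(k + m choose k)`. -/
def gaussBinom (Q : ℂ) : ℕ → ℕ → ℂ
  | 0, _ => 1
  | _ + 1, 0 => 1
  | k + 1, m + 1 => Q ^ (k + 1) * gaussBinom Q (k + 1) m + gaussBinom Q k (m + 1)

variable (Q : ℂ)

theorem gaussBinom_zero_left (m : ℕ) : gaussBinom Q 0 m = 1 := by rw [gaussBinom]

theorem gaussBinom_zero_right (k : ℕ) : gaussBinom Q k 0 = 1 := by cases k <;> rw [gaussBinom]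

theorem gaussBinom_succ_succ (k m : ℕ) : gaussBinom Q (k + 1) (m + 1)
    = Q ^ (k + 1) * gaussBinom Q (k + 1) m + gaussBinom Q k (m + 1) := by rw [gaussBinom]

theorem gaussBinom_succ_succ' (k m : ℕ) : gaussBinom Q (k + 1) (m + 1)
    = gaussBinom Q (k + 1) m + Q ^ (m + 1) * gaussBinom Q k (m + 1) := by
  induction k generalizing m with
  | zero =>
    induction m with
    | zero => simp [gaussBinom_succ_succ, gaussBinom_zero_left, gaussBinom_zero_right, add_comm]
    | succ m ih =>
      rw [gaussBinom_succ_succ, ih, gaussBinom_zero_left, gaussBinom_zero_left]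
      rw [gaussBinom_succ_succ, gaussBinom_zero_left] at ih
      linear_combination ih
  | succ k ihk =>
    induction m with
    | zero =>
      have h := ihk 0
      rw [gaussBinom_succ_succ, gaussBinom_zero_right] at h ⊢
      rw [gaussBinom_succ_succ, gaussBinom_zero_right]
      linear_combination h
    | succ m ihm =>
      rw [gaussBinom_succ_succ Q (k + 1) (m + 1)]
      have h₁ := gaussBinom_succ_succ Q (k + 1) m
      have h₂ := gaussBinom_succ_succ Q k (m + 1)
      have h₃ := ihk (m + 1)
      linear_combination Q ^ (k + 2) * ihm - h₁ + h₃ - Q ^ (m + 2) * h₂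

theorem gaussBinom_shift (k m : ℕ) : (1 - Q ^ (k + 1)) * gaussBinom Q (k + 1) m
    = (1 - Q ^ (m + 1)) * gaussBinom Q k (m + 1) := by
  linear_combination gaussBinom_succ_succ Q k m - gaussBinom_succ_succ' Q k m

theorem gaussBinom_orderOf {k m : ℕ} (hm : m ≠ 0) (hQ : orderOf Q = k + 1 + m) :
    gaussBinom Q (k + 1) m = 0 := by
  have hne : ∀ l, l ≠ 0 → l < orderOf Q → (1 - Q ^ l) ≠ 0 := fun l hl hlt h =>
    pow_ne_one_of_lt_orderOf hl hlt (sub_eq_zero.1 h).symm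
  induction k generalizing m with
  | zero =>
    have h := gaussBinom_shift Q 0 m
    have hpow : Q ^ (m + 1) = 1 := by
      rw [show m + 1 = orderOf Q by omega]
      exact pow_orderOf_eq_one Q
    rw [hpow, sub_self, zero_mul] at h
    exact (mul_eq_zero.1 h).resolve_left (hne _ (by omega) (by omega))
  | succ k ih =>
    have h := gaussBinom_shift Q (k + 1) m
    rw [ih (m := m + 1) (by omega) (by omega), mul_zero] at h
    exact (mul_eq_zero.1 h).resolve_left (hne _ (by omega) (by omega))

open Finset in
theorem sum_antidiagonal_pascal {M : Type*} [AddCommGroup M] [Module ℂ M] {A B G : ℕ → ℕ → ℂ}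
    (hl : ∀ m, G 0 (m + 1) = B 0 m) (hr : ∀ k, G (k + 1) 0 = A k 0)
    (h : ∀ k m, G (k + 1) (m + 1) = A k (m + 1) + B (k + 1) m) (T : ℕ → ℕ → M) (n : ℕ) :
    ∑ p ∈ antidiagonal n, (A p.1 p.2 • T (p.1 + 1) p.2 + B p.1 p.2 • T p.1 (p.2 + 1))
      = ∑ p ∈ antidiagonal (n + 1), G p.1 p.2 • T p.1 p.2 := by
  let A' : ℕ × ℕ → ℂ := fun p => Nat.casesOn p.1 0 fun k => A k p.2
  let B' : ℕ × ℕ → ℂ := fun p => Nat.casesOn p.2 0 fun m => B p.1 m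
  have hG : ∀ p ∈ antidiagonal (n + 1), G p.1 p.2 • T p.1 p.2
      = A' p • T p.1 p.2 + B' p • T p.1 p.2 := by
    rintro ⟨k, m⟩ hp
    rw [← add_smul]
    congr 1
    rcases k with _ | k <;> rcases m with _ | m
    · simp at hp
    · simp [A', B', hl]
    · simp [A', B', hr]
    · simp [A', B', h]
  rw [sum_congr rfl hG, sum_add_distrib, sum_add_distrib]
  congr 1
  · rw [Nat.sum_antidiagonal_succ]; simp [A']
  · rw [Nat.sum_antidiagonal_succ']; simp [B']

end GaussBinomials

section Coproducts
variable {θ : ℕ} {q : Fin θ → Fin θ → ℂˣ} (S : BraidedStr θ q)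

theorem pow_mem_homogD (i : Fin θ) (k : ℕ) : gen θ i ^ k ∈ homogD θ (k • δ θ i) := by
  induction k with
  | zero => simpa using one_mem_homogD
  | succ k ih => rw [pow_succ, succ_nsmul]; exact mul_mem_homogD ih (gen_mem_homogD i)

theorem adpow_succ (i j : Fin θ) (m : ℕ) : adpow q i j (m + 1)
    = gen θ i * adpow q i j m - qf q (δ θ i) (m • δ θ i + δ θ j) • (adpow q i j m * gen θ i) := by
  rw [adpow, ad1, brk]
  rfl

theorem adpow_mem_homogD (i j : Fin θ) (m : ℕ) :
    adpow q i j m ∈ homogD θ (m • δ θ i + δ θ j) := by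
  induction m with
  | zero => simpa [adpow] using gen_mem_homogD j
  | succ m ih =>
    rw [adpow_succ]
    refine Submodule.sub_mem _ ?_ (Submodule.smul_mem _ _ ?_)
    · convert mul_mem_homogD (gen_mem_homogD i) ih using 1
      rw [succ_nsmul]; abel_nf
    · convert mul_mem_homogD ih (gen_mem_homogD i) using 1
      rw [succ_nsmul]; abel_nf

theorem qf_adpow_right (i j : Fin θ) (m : ℕ) :
    qf q (δ θ i) (m • δ θ i + δ θ j) = (q i i : ℂ) ^ m * q i j := by
  rw [qf_add_right, qf_smul_right, qf_delta, qf_delta]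

theorem qf_adpow_left (i j : Fin θ) (m : ℕ) :
    qf q (m • δ θ i + δ θ j) (δ θ i) = (q i i : ℂ) ^ m * q j i := by
  rw [qf_add_left, qf_smul_left, qf_delta, qf_delta]

theorem BraidedStr.Δ_pow (i : Fin θ) (n : ℕ) :
    S.Δ (gen θ i ^ n) = ∑ p ∈ Finset.HasAntidiagonal.antidiagonal n,
      gaussBinom (q i i) p.1 p.2 • (gen θ i ^ p.1) ⊗ₜ[ℂ] (gen θ i ^ p.2) := by
  induction n with
  | zero => simp [S.Δ_one, gaussBinom_zero_left]
  | succ n ih =>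
    rw [← sum_antidiagonal_pascal (A := fun k m => gaussBinom (q i i) k m)
      (B := fun k m => (q i i : ℂ) ^ k * gaussBinom (q i i) k m)
      (fun m => by simp [gaussBinom_zero_left]) (fun k => by simp [gaussBinom_zero_right])
      (fun k m => by rw [gaussBinom_succ_succ, add_comm])
      (fun k m => (gen θ i ^ k) ⊗ₜ[ℂ] (gen θ i ^ m)), pow_succ', S.Δ_mul, ih, map_sum]
    refine Finset.sum_congr rfl fun p _ => ?_
    rw [map_smul, S.mulB_Δ_gen, scL_homogD q (pow_mem_homogD i p.1), qf_smul_right, qf_delta,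
      smul_add, ← TensorProduct.smul_tmul', smul_smul, pow_succ', pow_succ',
      mul_comm (gaussBinom _ _ _)]

/-- The coefficients of the coproduct of `(ad_c x_i)^n x_j`. -/
def adCoef (Q a : ℂ) (k m : ℕ) : ℂ :=
  gaussBinom Q k m * ∏ t ∈ Finset.range k, (1 - Q ^ (m + t) * a)

theorem adCoef_zero_left (Q a : ℂ) (m : ℕ) : adCoef Q a 0 m = 1 := by
  simp [adCoef, gaussBinom_zero_left]

theorem adCoef_succ_zero (Q a : ℂ) (k : ℕ) :
    adCoef Q a (k + 1) 0 = (1 - Q ^ k * a) * adCoef Q a k 0 := by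
  simp [adCoef, gaussBinom_zero_right, Finset.prod_range_succ, mul_comm]

theorem adCoef_succ_succ (Q a : ℂ) (k m : ℕ) : adCoef Q a (k + 1) (m + 1)
    = (1 - Q ^ (k + 2 * (m + 1)) * a) * adCoef Q a k (m + 1)
      + Q ^ (k + 1) * adCoef Q a (k + 1) m := by
  have h : ∏ t ∈ Finset.range (k + 1), (1 - Q ^ (m + t) * a)
      = (1 - Q ^ m * a) * ∏ t ∈ Finset.range k, (1 - Q ^ (m + 1 + t) * a) := by
    rw [Finset.prod_range_succ', mul_comm]
    simp [add_assoc, add_comm 1]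
  rw [adCoef, adCoef, adCoef, h, Finset.prod_range_succ]
  generalize ∏ t ∈ Finset.range k, (1 - Q ^ (m + 1 + t) * a) = P
  have h₁ := gaussBinom_succ_succ Q k m
  have h₂ := gaussBinom_succ_succ' Q k m
  linear_combination P * h₁ - P * Q ^ (m + 1 + k) * a * h₂

theorem BraidedStr.Δ_adpow (i j : Fin θ) (n : ℕ) :
    S.Δ (adpow q i j n) = adpow q i j n ⊗ₜ[ℂ] 1 + ∑ p ∈ Finset.HasAntidiagonal.antidiagonal n,
      adCoef (q i i) (qtil q i j) p.1 p.2 • (gen θ i ^ p.1) ⊗ₜ[ℂ] (adpow q i j p.2) := by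
  induction n with
  | zero => simp [adpow, S.Δ_gen, adCoef_zero_left]
  | succ n ih =>
    rw [← sum_antidiagonal_pascal
      (A := fun k m => (1 - (q i i : ℂ) ^ (k + 2 * m) * qtil q i j)
        * adCoef (q i i) (qtil q i j) k m)
      (B := fun k m => (q i i : ℂ) ^ k * adCoef (q i i) (qtil q i j) k m)
      (fun m => by simp [adCoef_zero_left]) (fun k => by rw [adCoef_succ_zero]; simp)
      (fun k m => adCoef_succ_succ _ _ k m)
      (fun k m => (gen θ i ^ k) ⊗ₜ[ℂ] (adpow q i j m))]
    have hleft : S.Δ (gen θ i * adpow q i j n) = (gen θ i * adpow q i j n) ⊗ₜ[ℂ] 1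
        + ((q i i : ℂ) ^ n * q i j) • adpow q i j n ⊗ₜ[ℂ] gen θ i
        + ∑ p ∈ Finset.HasAntidiagonal.antidiagonal n, adCoef (q i i) (qtil q i j) p.1 p.2 •
          ((gen θ i ^ (p.1 + 1)) ⊗ₜ[ℂ] (adpow q i j p.2)
            + (q i i : ℂ) ^ p.1 • (gen θ i ^ p.1) ⊗ₜ[ℂ] (gen θ i * adpow q i j p.2)) := by
      rw [S.Δ_mul, ih, map_add, map_sum, S.mulB_Δ_gen, scL_homogD q (adpow_mem_homogD i j n),
        qf_adpow_right, ← TensorProduct.smul_tmul', mul_one]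
      congr 1
      refine Finset.sum_congr rfl fun p _ => ?_
      rw [map_smul, S.mulB_Δ_gen, scL_homogD q (pow_mem_homogD i p.1), qf_smul_right, qf_delta,
        ← TensorProduct.smul_tmul', pow_succ']
    have hright : S.Δ (adpow q i j n * gen θ i) = (adpow q i j n * gen θ i) ⊗ₜ[ℂ] 1
        + adpow q i j n ⊗ₜ[ℂ] gen θ i
        + ∑ p ∈ Finset.HasAntidiagonal.antidiagonal n, adCoef (q i i) (qtil q i j) p.1 p.2 •
          (((q i i : ℂ) ^ p.2 * q j i) • (gen θ i ^ (p.1 + 1)) ⊗ₜ[ℂ] (adpow q i j p.2)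
            + (gen θ i ^ p.1) ⊗ₜ[ℂ] (adpow q i j p.2 * gen θ i)) := by
      rw [S.Δ_mul, ih, S.Δ_gen, map_add S.mulB, LinearMap.add_apply, map_add, S.mulB_one_tmul,
        S.mulB_one_tmul, mul_one, map_sum, LinearMap.sum_apply]
      congr 1
      refine Finset.sum_congr rfl fun p _ => ?_
      rw [map_smul, LinearMap.smul_apply, map_add, S.mulB_tmul_one,
        S.mulB_homogD_tmul (adpow_mem_homogD i j p.2), scL_gen, qf_adpow_left, mul_one,
        mul_smul_comm, ← TensorProduct.smul_tmul', pow_succ]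
    rw [adpow_succ, map_sub, map_smul, hleft, hright, qf_adpow_right]
    have hsum : ∀ p ∈ Finset.HasAntidiagonal.antidiagonal n,
        ((1 - (q i i : ℂ) ^ (p.1 + 2 * p.2) * qtil q i j) * adCoef (q i i) (qtil q i j) p.1 p.2) •
            (gen θ i ^ (p.1 + 1)) ⊗ₜ[ℂ] (adpow q i j p.2)
          + ((q i i : ℂ) ^ p.1 * adCoef (q i i) (qtil q i j) p.1 p.2) •
            (gen θ i ^ p.1) ⊗ₜ[ℂ] (adpow q i j (p.2 + 1))
        = adCoef (q i i) (qtil q i j) p.1 p.2 •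
          ((gen θ i ^ (p.1 + 1)) ⊗ₜ[ℂ] (adpow q i j p.2)
            + (q i i : ℂ) ^ p.1 • (gen θ i ^ p.1) ⊗ₜ[ℂ] (gen θ i * adpow q i j p.2))
          - ((q i i : ℂ) ^ n * q i j) • (adCoef (q i i) (qtil q i j) p.1 p.2 •
          (((q i i : ℂ) ^ p.2 * q j i) • (gen θ i ^ (p.1 + 1)) ⊗ₜ[ℂ] (adpow q i j p.2)
            + (gen θ i ^ p.1) ⊗ₜ[ℂ] (adpow q i j p.2 * gen θ i))) := by
      intro p hp
      rw [adpow_succ, TensorProduct.tmul_sub, TensorProduct.tmul_smul, qf_adpow_right,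
        ← Finset.HasAntidiagonal.mem_antidiagonal.1 hp, qtil]
      module
    rw [Finset.sum_congr rfl hsum, Finset.sum_sub_distrib, ← Finset.smul_sum,
      TensorProduct.sub_tmul, ← TensorProduct.smul_tmul']
    module

theorem BraidedStr.isPrimitiveIn_pow (i : Fin θ) {n : ℕ} (hn : n ≠ 0)
    (hQ : orderOf (q i i : ℂ) = n) : IsPrimitiveIn S (gen θ i ^ n) := by
  obtain ⟨n, rfl⟩ := Nat.exists_eq_succ_of_ne_zero hn
  rw [IsPrimitiveIn, S.Δ_pow, Finset.Nat.sum_antidiagonal_succ, add_comm]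
  congr 1
  · rw [Finset.sum_eq_single (n, 0)]
    · simp [gaussBinom_zero_right]
    · rintro ⟨k, m⟩ hp hne
      rw [Finset.HasAntidiagonal.mem_antidiagonal] at hp
      have hm : m ≠ 0 := by rintro rfl; simp_all
      simp only at hp
      rw [gaussBinom_orderOf _ hm (by omega), zero_smul]
    · simp
  · simp [gaussBinom_zero_left]

theorem BraidedStr.isPrimitiveIn_adpow (i j : Fin θ) {n : ℕ}
    (hQ : (q i i : ℂ) ^ n * qtil q i j = 1) : IsPrimitiveIn S (adpow q i j (n + 1)) := by
  rw [IsPrimitiveIn, S.Δ_adpow, Finset.Nat.sum_antidiagonal_succ, Finset.sum_eq_zero]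
  · simp [adCoef_zero_left]
  · rintro ⟨k, m⟩ hp
    rw [Finset.HasAntidiagonal.mem_antidiagonal] at hp
    simp only at hp
    rw [adCoef, Finset.prod_eq_zero (i := k) (by simp), mul_zero, zero_smul]
    rw [show m + k = n by omega, hQ, sub_self]

theorem BraidedStr.Δ_adpow_orderOf (i j : Fin θ) {n : ℕ} (hQ : orderOf (q i i : ℂ) = n + 1) :
    S.Δ (adpow q i j (n + 1)) = adpow q i j (n + 1) ⊗ₜ[ℂ] 1 + 1 ⊗ₜ[ℂ] adpow q i j (n + 1)
      + adCoef (q i i) (qtil q i j) (n + 1) 0 • (gen θ i ^ (n + 1)) ⊗ₜ[ℂ] gen θ j := by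
  rw [S.Δ_adpow, Finset.Nat.sum_antidiagonal_succ, add_assoc]
  congr 2
  · simp [adCoef_zero_left]
  · rw [Finset.sum_eq_single (n, 0)]
    · simp [adpow]
    · rintro ⟨k, m⟩ hp hne
      rw [Finset.HasAntidiagonal.mem_antidiagonal] at hp
      have hm : m ≠ 0 := by rintro rfl; simp_all
      simp only at hp
      rw [adCoef, gaussBinom_orderOf _ hm (by omega), zero_mul, zero_smul]
    · simp

end Coproducts

section SerreRelation
variable {θ : ℕ} {q : Fin θ → Fin θ → ℂˣ} {S : BraidedStr θ q} {I : Submodule ℂ (TV θ)}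

theorem IsPreNicholsIdeal.exists_dualFunctional (hI : IsPreNicholsIdeal S I) {m : ℕ} {z : TV θ}
    (hz : z ∈ homogTot θ m) (hzI : z ∉ I) : ∃ f : TV θ →ₗ[ℂ] ℂ, (∀ u ∈ I, f u = 0) ∧ f z = 1 ∧
      ∀ n, n ≠ m → ∀ u ∈ homogTot θ n, f u = 0 := by
  obtain ⟨g, hgz, hg⟩ := Submodule.exists_le_ker_of_notMem hzI
  refine ⟨(g z)⁻¹ • g ∘ₗ prTot m, fun u hu => ?_, ?_, fun n hn u hu => ?_⟩
  · have h : g (prTot m u) = 0 := hg (hI.prTot_mem m hu)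
    simp [h]
  · simp [prTot_homogTot hz, hgz]
  · simp [prTot_homogTot hu, hn]

theorem gen_mem_homogTot (i : Fin θ) : gen θ i ∈ homogTot θ 1 :=
  Submodule.subset_span ⟨[i], rfl, (wordElem_singleton i).symm⟩

theorem one_mem_homogTot : (1 : TV θ) ∈ homogTot θ 0 :=
  Submodule.subset_span ⟨[], rfl, rfl⟩

/-- A primitive element of degree at least two together with some of the generators. -/
theorem IsPreNicholsIdeal.exists_primFamily (hI : IsPreNicholsIdeal S I) {s : ℕ}
    {g : Fin s → Fin θ} (hg : Function.Injective g) {d : Fin θ → ℕ} (hd : 2 ≤ ∑ k, d k) {z : TV θ}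
    (hz : z ∈ homogD θ d) (hzI : z ∉ I) (hprim : S.Δ z - (z ⊗ₜ 1 + 1 ⊗ₜ z) ∈ mixedSub I) :
    ∃ f, PrimFamily S I (Matrix.vecCons d fun a => δ θ (g a))
      (Matrix.vecCons z fun a => gen θ (g a)) f := by
  have hzT := homogD_le_homogTot d hz
  obtain ⟨f, hf, hfz, hf0⟩ := hI.exists_dualFunctional hzT hzI
  refine ⟨Matrix.vecCons f fun a => coef [g a], ?_, ?_, ?_, ?_, ?_⟩
  · intro a
    cases a using Fin.cases with
    | zero => exact hz
    | succ a => exact gen_mem_homogD _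
  · intro a
    cases a using Fin.cases with
    | zero => exact hprim
    | succ a => simp [S.Δ_gen]
  · intro a u hu
    cases a using Fin.cases with
    | zero => exact hf u hu
    | succ a => exact hI.coef_eq_zero (by simp) hu
  · intro a
    cases a using Fin.cases with
    | zero => exact hf0 0 (by omega) _ one_mem_homogTot
    | succ a => simp [coef_one]
  · intro a b
    cases a using Fin.cases with
    | zero =>
      cases b using Fin.cases with
      | zero => simpa using hfz
      | succ b => simpa using hf0 1 (by omega) _ (gen_mem_homogTot _)
    | succ a =>
      cases b using Fin.cases with
      | zero =>
        rw [if_neg (Fin.succ_ne_zero a).symm]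
        exact coef_homogTot hzT (by simp; omega)
      | succ b => simp [coef_gen, hg.eq_iff]

theorem sum_delta (i : Fin θ) : ∑ k, δ θ i k = 1 := by simp [δ]

theorem sum_smul_delta (n : ℕ) (i : Fin θ) : ∑ k, (n • δ θ i) k = n := by
  simp [← Finset.mul_sum, sum_delta]

theorem sum_smul_delta_add (n : ℕ) (i j : Fin θ) : ∑ k, (n • δ θ i + δ θ j) k = n + 1 := by
  simp [Finset.sum_add_distrib, ← Finset.mul_sum, sum_delta]

variable (q)

theorem qf_adpow_self (i j : Fin θ) (m : ℕ) : qf q (m • δ θ i + δ θ j) (m • δ θ i + δ θ j)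
    = (q i i : ℂ) ^ (m * m) * qtil q i j ^ m * q j j := by
  simp only [qf_add_left, qf_add_right, qf_smul_left, qf_smul_right, qf_delta, qtil]
  ring

theorem qf_adpow_edge_left (i j : Fin θ) (m : ℕ) :
    qf q (δ θ i) (m • δ θ i + δ θ j) * qf q (m • δ θ i + δ θ j) (δ θ i)
      = (q i i : ℂ) ^ (2 * m) * qtil q i j := by
  rw [qf_adpow_right, qf_adpow_left, qtil]
  ring

theorem qf_adpow_edge_right (i j : Fin θ) (m : ℕ) :
    qf q (δ θ j) (m • δ θ i + δ θ j) * qf q (m • δ θ i + δ θ j) (δ θ j)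
      = qtil q i j ^ m * (q j j : ℂ) ^ 2 := by
  simp only [qf_add_left, qf_add_right, qf_smul_left, qf_smul_right, qf_delta, qtil]
  ring

variable {q}

/-- A primitive element with label `1` is not connected to any generator. -/
theorem qf_edge_eq_one_of_label_one (hAAH : AAH) (hI : IsPreNicholsIdeal S I) (hGK : FinGK I)
    {d : Fin θ → ℕ} (hd : 2 ≤ ∑ k, d k) {z : TV θ} (hz : z ∈ homogD θ d) (hzI : z ∉ I)
    (hprim : IsPrimitiveIn S z) (hlabel : qf q d d = 1) (k : Fin θ) :
    qf q d (δ θ k) * qf q (δ θ k) d = 1 := by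
  obtain ⟨f, hf⟩ := hI.exists_primFamily (g := ![k]) (Function.injective_of_subsingleton _) hd hz
    hzI (by rw [hprim, sub_self]; exact Submodule.zero_mem _)
  obtain ⟨n, hn⟩ := (hf.boundedGroupoid hAAH hI hGK).refl [] 0 1 (by decide)
  change n ∈ cartanSet (qf q d d) (qf q d (δ θ k) * qf q (δ θ k) d) at hn
  simpa [mem_cartanSet, hlabel] using hn

theorem boundedGroupoid_adpow (hAAH : AAH) (hI : IsPreNicholsIdeal S I) (hGK : FinGK I)
    {i j : Fin θ} (hij : i ≠ j) {n : ℕ} (hzI : adpow q i j (n + 1) ∉ I)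
    (hprim : S.Δ (adpow q i j (n + 1)) - (adpow q i j (n + 1) ⊗ₜ 1 + 1 ⊗ₜ adpow q i j (n + 1))
      ∈ mixedSub I) :
    BoundedGroupoid (famMatrix q
      (Matrix.vecCons ((n + 1) • δ θ i + δ θ j) fun a => δ θ (![i, j] a))) := by
  have hg : Function.Injective ![i, j] := by
    intro a b
    fin_cases a <;> fin_cases b <;> simp [hij, hij.symm]
  obtain ⟨f, hf⟩ := hI.exists_primFamily hg (by rw [sum_smul_delta_add]; omega)
    (adpow_mem_homogD i j (n + 1)) hzI hprim
  exact hf.boundedGroupoid hAAH hI hGK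

/-- At a Cartan vertex, the quantum Serre relation can only fail in one exceptional case. -/
theorem adpow_notMem_exceptional (hAAH : AAH) (hI : IsPreNicholsIdeal S I) (hGK : FinGK I)
    {i j : Fin θ} (hij : i ≠ j) {A : ℕ} (hA : A ≠ 0) (hmin : ∀ n ∈ cSet q i j, A ≤ n)
    (hserre : (q i i : ℂ) ^ A * qtil q i j = 1) (hQ : (q i i : ℂ) ^ (A + 1) ≠ 1)
    (hzI : adpow q i j (A + 1) ∉ I) :
    orderOf (q i i : ℂ) = 3 ∧ A = 1 ∧ (q j j : ℂ) = q i i := by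
  have hbd := boundedGroupoid_adpow hAAH hI hGK hij hzI
    (by rw [S.isPrimitiveIn_adpow i j hserre, sub_self]; exact Submodule.zero_mem _)
  set M := famMatrix q (Matrix.vecCons ((A + 1) • δ θ i + δ θ j) fun a => δ θ (![i, j] a))
  have h₁₁ : (M 1 1 : ℂ) = q i i := qf_delta q i i
  have h₂₂ : (M 2 2 : ℂ) = q j j := qf_delta q j j
  have h₁₂ : qtil M 1 2 = qtil q i j := congrArg₂ (· * ·) (qf_delta q i j) (qf_delta q j i)
  have h₀₀ : (M 0 0 : ℂ) = _ := qf_adpow_self q i j (A + 1)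
  have h₁₀ : qtil M 1 0 = _ := qf_adpow_edge_left q i j (A + 1)
  have h₂₀ : qtil M 2 0 = _ := qf_adpow_edge_right q i j (A + 1)
  have h₁₀' : qtil M 1 0 = (q i i : ℂ) ^ (A + 2) := by
    rw [h₁₀]
    linear_combination (q i i : ℂ) ^ (A + 2) * hserre
  have hpow : (q i i : ℂ) ^ (A * (A + 1)) * qtil q i j ^ (A + 1) = 1 := by
    rw [pow_mul, ← mul_pow, hserre, one_pow]
  have hQ1 : (q i i : ℂ) ≠ 1 := fun h => hQ (by rw [h, one_pow])
  have hpos : 0 < orderOf (q i i : ℂ) := by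
    obtain ⟨n, hn⟩ := hbd.refl [] 1 0 (by decide)
    change n ∈ cartanSet (M 1 1) (qtil M 1 0) at hn
    rw [mem_cartanSet, h₁₁, h₁₀', ← pow_add] at hn
    rcases hn with ⟨-, hn⟩ | hn
    · exact orderOf_pos_iff.2 (isOfFinOrder_iff_pow_eq_one.2 ⟨_, by omega, hn⟩)
    · exact orderOf_pos_iff.2 (isOfFinOrder_iff_pow_eq_one.2 ⟨_, by omega, hn⟩)
  have hone : orderOf (q i i : ℂ) ≠ 1 := fun h => hQ1 (orderOf_eq_one_iff.1 h)
  have hle : A ≤ orderOf (q i i : ℂ) - 1 := hmin _ <| mem_cartanSet.2 <| Or.inl ⟨hQ1, by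
    rw [Nat.sub_add_cancel hpos]; exact pow_orderOf_eq_one _⟩
  have hne : orderOf (q i i : ℂ) ≠ A + 1 := fun h => hQ (h ▸ pow_orderOf_eq_one _)
  have hT : SerreTri M 1 2 0 A :=
    { ab := by decide
      ad := by decide
      bd := by decide
      lt_order := by rw [h₁₁]; omega
      serre := by rw [h₁₁, h₁₂, hserre]
      label := by
        rw [h₁₁, h₂₂, h₀₀]
        linear_combination (q i i : ℂ) ^ (A + 1) * q j j * hpow
      edge_ad := by rw [h₁₀', h₁₁]
      edge_bd := by
        rw [h₂₀, h₁₁, h₂₂]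
        linear_combination (q j j : ℂ) ^ 2 * hpow }
  simpa only [h₁₁, h₂₂] using hT.exceptional hA hbd

/-- The quantum Serre relation at a vertex labeled by a root of unity of order `n + 1`. -/
theorem adpow_mem_of_orderOf (hAAH : AAH) (hI : IsPreNicholsIdeal S I) (hGK : FinGK I)
    {i j : Fin θ} (hij : i ≠ j) {n : ℕ} (hn : n ≠ 0) (hQ : orderOf (q i i : ℂ) = n + 1)
    (hpow : qtil q i j ^ (n + 1) ≠ 1) : adpow q i j (n + 1) ∈ I := by
  have hQn : (q i i : ℂ) ^ (n + 1) = 1 := hQ ▸ pow_orderOf_eq_one _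
  have hxI : gen θ i ^ (n + 1) ∈ I := by
    by_contra hxI
    refine hpow ?_
    have h := qf_edge_eq_one_of_label_one hAAH hI hGK (by rw [sum_smul_delta]; omega)
      (pow_mem_homogD i (n + 1)) hxI (S.isPrimitiveIn_pow i (by omega) hQ)
      (by rw [qf_smul_left, qf_smul_right, qf_delta, hQn, one_pow]) j
    rwa [qf_smul_left, qf_smul_right, qf_delta, qf_delta, ← mul_pow] at h
  by_contra hzI
  have hbd := boundedGroupoid_adpow hAAH hI hGK hij hzI (by
    rw [S.Δ_adpow_orderOf i j hQ, add_sub_cancel_left]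
    exact Submodule.smul_mem _ _ (tmul_mem_mixedSub_left hxI _))
  set M := famMatrix q (Matrix.vecCons ((n + 1) • δ θ i + δ θ j) fun a => δ θ (![i, j] a))
  have h₁₁ : (M 1 1 : ℂ) = q i i := qf_delta q i i
  have h₂₂ : (M 2 2 : ℂ) = q j j := qf_delta q j j
  have h₁₂ : qtil M 1 2 = qtil q i j := congrArg₂ (· * ·) (qf_delta q i j) (qf_delta q j i)
  have h₀₀ : (M 0 0 : ℂ) = _ := qf_adpow_self q i j (n + 1)
  have h₁₀ : qtil M 1 0 = _ := qf_adpow_edge_left q i j (n + 1)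
  have h₂₀ : qtil M 2 0 = _ := qf_adpow_edge_right q i j (n + 1)
  have hT : PowerTri M 1 2 0 :=
    { ab := by decide
      ad := by decide
      bd := by decide
      edge_pow := by rwa [h₁₁, h₁₂, hQ]
      label := by rw [h₀₀, h₁₁, h₁₂, h₂₂, hQ, pow_mul, hQn, one_pow, one_mul]
      edge_ad := by rw [h₁₀, h₁₂, mul_comm 2, pow_mul, hQn, one_pow, one_mul]
      edge_bd := by rw [h₂₀, h₁₁, h₁₂, h₂₂, hQ] }
  exact hT.not_boundedGroupoid hbd

end SerreRelation

/-- Lemma 3.1(b): suppose `c_{ij} < 0` (i.e. `m := min cSet ≥ 1`, so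
`c_{ij} = -m`) and `q̃_{ij}^{1-c_{ij}} ≠ 1`.  If either the Dynkin diagram of
`kx_i ⊕ kx_j` is not `(q, q⁻¹, q)` with `q ∈ G₃'`, or `c_{ij} = -1`,
`q_{ii} = q_{jj} = q̃_{ij}⁻¹ ∈ G₃'` and `q̃_{ik}²q̃_{jk} ≠ 1` for some `k ∉ {i,j}`,
then `(ad_c x_i)^{1-c_{ij}} x_j = 0` in every finite-GKdim pre-Nichols algebra of `q`. -/
theorem statement_3 (θ : ℕ) (q : Fin θ → Fin θ → ℂˣ) (S : BraidedStr θ q)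
    (hconn : (dynkin q).Connected)
    (hfd : FiniteDimensional ℂ (TV θ ⧸ Jq S))
    (hAAH : AAH)
    (I : Submodule ℂ (TV θ)) (hI : IsPreNicholsIdeal S I) (hGK : FinGK I)
    (i j : Fin θ) (hij : i ≠ j)
    (hne : (cSet q i j).Nonempty)
    (hneg : 0 < sInf (cSet q i j))
    (hpow : qtil q i j ^ (1 + sInf (cSet q i j)) ≠ 1)
    (hyp :
      (¬ ∃ ζ : ℂ, IsPrimitiveRoot ζ 3 ∧
          (q i i : ℂ) = ζ ∧ (q j j : ℂ) = ζ ∧ qtil q i j = ζ⁻¹) ∨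
      (sInf (cSet q i j) = 1 ∧ IsPrimitiveRoot (q i i : ℂ) 3 ∧
        (q j j : ℂ) = (q i i : ℂ) ∧ qtil q i j = ((q i i : ℂ))⁻¹ ∧
        ∃ k : Fin θ, k ≠ i ∧ k ≠ j ∧ qtil q i k ^ 2 * qtil q j k ≠ 1)) :
    adpow q i j (1 + sInf (cSet q i j)) ∈ I := by
  have hmem := Nat.sInf_mem hne
  have hmin : ∀ n ∈ cSet q i j, sInf (cSet q i j) ≤ n := fun n hn => Nat.sInf_le hn
  generalize sInf (cSet q i j) = A at *
  rw [add_comm 1 A] at hpow ⊢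
  have hQ1 : (q i i : ℂ) ≠ 1 := by
    intro h
    have h' : A ∈ cartanSet (q i i) (qtil q i j) := hmem
    rw [mem_cartanSet, h] at h'
    exact hpow (by simpa using congrArg (· ^ (A + 1)) (show qtil q i j = 1 by simpa using h'))
  by_cases hQA : (q i i : ℂ) ^ (A + 1) = 1
  · refine adpow_mem_of_orderOf hAAH hI hGK hij hneg.ne' ?_ hpow
    refine (orderOf_eq_iff (Nat.succ_pos A)).2 ⟨hQA, fun m hm hm0 h => ?_⟩
    have := hmin (m - 1) (mem_cartanSet.2 (Or.inl ⟨hQ1, by rwa [Nat.sub_add_cancel hm0]⟩))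
    omega
  · have hserre : (q i i : ℂ) ^ A * qtil q i j = 1 :=
      (mem_cartanSet.1 hmem).resolve_left fun h => hQA h.2
    by_contra hzI
    obtain ⟨hord, rfl, hp⟩ :=
      adpow_notMem_exceptional hAAH hI hGK hij hneg.ne' hmin hserre hQA hzI
    rw [pow_one] at hserre
    rcases hyp with hyp | ⟨-, hζ, -, -, k, -, -, hk⟩
    · exact hyp ⟨q i i, hord ▸ IsPrimitiveRoot.orderOf _, rfl, hp,
        eq_inv_of_mul_eq_one_right hserre⟩
    · refine hk ?_
      have h := qf_edge_eq_one_of_label_one hAAH hI hGK (by rw [sum_smul_delta_add]; omega)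
        (adpow_mem_homogD i j 2) hzI (S.isPrimitiveIn_adpow i j (by rwa [pow_one]))
        (by
          rw [qf_adpow_self, hp]
          linear_combination ((q i i : ℂ) * qtil q i j + 1) * (q i i : ℂ) ^ 3 * hserre
            + hζ.pow_eq_one) k
      rw [← h]
      simp only [qf_add_left, qf_add_right, qf_smul_left, qf_smul_right, qf_delta, qtil]
      ring

end PreNicholsPaper
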